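/- arXiv:math/0001130 — 5 statements merged into one kernel-verified Lean document; each statement's English description precedes it below -/
import Mathlib

section
/- Classification of pairs of skew-symmetric bilinear forms on a complex vector space: Let c1, c2 be skew-symmetric N×N complex matrices. Then there exist an invertible complex N×N matrix P and a finite list of canonical pairs (D1^(1),D2^(1)),…,(D1^(r),D2^(r)) such that, for i = 1,2, Pᵀ·c_i·P is the block-diagonal matrix with diagonal blocks D_i^(1),…,D_i^(r), where each canonical pair (D1^(s),D2^(s)) is either (a) a Jordan block pair of some dimension 2m_s with some eigenvalue μ_s ∈ ℂ, or (a') the pair ([[0, J_{m_s}(0)],[−J_{m_s}(0)ᵀ, 0]], [[0, I_{m_s}],[−I_{m_s}, 0]]) (a Jordan block pair 'with eigenvalue ∞', i.e. with the roles of the two members interchanged and eigenvalue 0), or (b) a Kronecker block pair of some dimension 2n_s+1, n_s ≥ 0, over ℂ. -/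
open Matrix

noncomputable section

/-- The `n × (n+1)` matrix `B1(n)`: entries `1` on positions `(i, i)`, else `0`. -/
def kronB1 (K : Type*) [Zero K] [One K] (n : ℕ) : Matrix (Fin n) (Fin (n + 1)) K :=
  Matrix.of fun i j => if (j : ℕ) = (i : ℕ) then 1 else 0

/-- The `n × (n+1)` matrix `B2(n)`: entries `1` on positions `(i, i+1)`, else `0`. -/
def kronB2 (K : Type*) [Zero K] [One K] (n : ℕ) : Matrix (Fin n) (Fin (n + 1)) K :=
  Matrix.of fun i j => if (j : ℕ) = (i : ℕ) + 1 then 1 else 0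

/-- The first member `K1(n)` of the Kronecker block pair of dimension `2n+1`. -/
def kronK1 (K : Type*) [Zero K] [One K] [Neg K] (n : ℕ) :
    Matrix (Fin n ⊕ Fin (n + 1)) (Fin n ⊕ Fin (n + 1)) K :=
  Matrix.fromBlocks 0 (kronB1 K n) (-(kronB1 K n)ᵀ) 0

/-- The second member `K2(n)` of the Kronecker block pair of dimension `2n+1`. -/
def kronK2 (K : Type*) [Zero K] [One K] [Neg K] (n : ℕ) :
    Matrix (Fin n ⊕ Fin (n + 1)) (Fin n ⊕ Fin (n + 1)) K :=
  Matrix.fromBlocks 0 (kronB2 K n) (-(kronB2 K n)ᵀ) 0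

/-- The `m × m` upper-triangular Jordan block with eigenvalue `μ`. -/
def jordanA (m : ℕ) (μ : ℂ) : Matrix (Fin m) (Fin m) ℂ :=
  Matrix.of fun i j => if i = j then μ else if (j : ℕ) = (i : ℕ) + 1 then 1 else 0

/-- The first member `J1` of the Jordan block pair of dimension `2m`. -/
def jordanJ1 (m : ℕ) : Matrix (Fin m ⊕ Fin m) (Fin m ⊕ Fin m) ℂ :=
  Matrix.fromBlocks 0 (1 : Matrix (Fin m) (Fin m) ℂ) (-(1 : Matrix (Fin m) (Fin m) ℂ)ᵀ) 0

/-- The second member `J2` of the Jordan block pair of dimension `2m` with eigenvalue `μ`. -/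
def jordanJ2 (m : ℕ) (μ : ℂ) : Matrix (Fin m ⊕ Fin m) (Fin m ⊕ Fin m) ℂ :=
  Matrix.fromBlocks 0 (jordanA m μ) (-(jordanA m μ)ᵀ) 0

/-- A pair of square complex matrices is a canonical pair if (up to a simultaneous relabelling
of the rows/columns) it is (a) a Jordan block pair of some dimension `2m`, `m ≥ 1`, with some
eigenvalue `μ ∈ ℂ`; or (a') a Jordan block pair 'with eigenvalue ∞' (the two members
interchanged, eigenvalue `0`); or (b) a Kronecker block pair of some dimension `2n+1`,
`n ≥ 0`. -/
def IsCanonicalPair {ι : Type} (D₁ D₂ : Matrix ι ι ℂ) : Prop :=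
  (∃ (m : ℕ) (μ : ℂ) (f : ι ≃ (Fin m ⊕ Fin m)), 1 ≤ m ∧
      D₁ = Matrix.reindex f.symm f.symm (jordanJ1 m) ∧
      D₂ = Matrix.reindex f.symm f.symm (jordanJ2 m μ)) ∨
  (∃ (m : ℕ) (f : ι ≃ (Fin m ⊕ Fin m)), 1 ≤ m ∧
      D₁ = Matrix.reindex f.symm f.symm (jordanJ2 m 0) ∧
      D₂ = Matrix.reindex f.symm f.symm (jordanJ1 m)) ∨
  (∃ (n : ℕ) (f : ι ≃ (Fin n ⊕ Fin (n + 1))),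
      D₁ = Matrix.reindex f.symm f.symm (kronK1 ℂ n) ∧
      D₂ = Matrix.reindex f.symm f.symm (kronK2 ℂ n))

variable {V : Type*} [AddCommGroup V] [Module ℂ V]

/-- A pair of bilinear forms is canonically decomposable if some basis of the space splits into
mutually orthogonal pieces on each of which the Gram matrices form a canonical pair. -/
def IsDecomposable (A B : V →ₗ[ℂ] V →ₗ[ℂ] ℂ) : Prop :=
  ∃ (σ : Type) (_ : Finite σ) (ι : σ → Type) (D₁ D₂ : ∀ s, Matrix (ι s) (ι s) ℂ)
    (b : Module.Basis (Σ s, ι s) ℂ V), (∀ s, IsCanonicalPair (D₁ s) (D₂ s)) ∧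
    (∀ s i j, A (b ⟨s, i⟩) (b ⟨s, j⟩) = D₁ s i j ∧ B (b ⟨s, i⟩) (b ⟨s, j⟩) = D₂ s i j) ∧
    ∀ s t i j, s ≠ t → A (b ⟨s, i⟩) (b ⟨t, j⟩) = 0 ∧ B (b ⟨s, i⟩) (b ⟨t, j⟩) = 0

theorem isDecomposable_of_subsingleton [Subsingleton V] (A B : V →ₗ[ℂ] V →ₗ[ℂ] ℂ) :
    IsDecomposable A B :=
  ⟨Empty, inferInstance, fun _ => Empty, fun s => s.elim, fun s => s.elim, Module.Basis.empty V,
    fun s => s.elim, fun s => s.elim, fun s => s.elim⟩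

theorem isDecomposable_of_basis {κ : Type} {A B : V →ₗ[ℂ] V →ₗ[ℂ] ℂ} {M₁ M₂ : Matrix κ κ ℂ}
    (hM : IsCanonicalPair M₁ M₂) (b : Module.Basis κ ℂ V) (hA : ∀ i j, A (b i) (b j) = M₁ i j)
    (hB : ∀ i j, B (b i) (b j) = M₂ i j) : IsDecomposable A B := by
  refine ⟨Unit, inferInstance, fun _ => κ, fun _ => M₁, fun _ => M₂,
    b.reindex (Equiv.uniqueSigma fun _ : Unit => κ).symm, fun _ => hM, fun s i j => ?_,
    fun s t i j h => (h rfl).elim⟩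
  simpa using ⟨hA i j, hB i j⟩

theorem IsDecomposable.of_isCompl {A B : V →ₗ[ℂ] V →ₗ[ℂ] ℂ} (hA : A.IsAlt) (hB : B.IsAlt)
    {W U : Submodule ℂ V} (h : IsCompl W U)
    (hWU : ∀ w ∈ W, ∀ u ∈ U, A w u = 0 ∧ B w u = 0)
    (hW : IsDecomposable (A.domRestrict₁₂ W W) (B.domRestrict₁₂ W W))
    (hU : IsDecomposable (A.domRestrict₁₂ U U) (B.domRestrict₁₂ U U)) :
    IsDecomposable A B := by
  obtain ⟨σ, _, ι, D₁, D₂, b, hc, hd, ho⟩ := hW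
  obtain ⟨σ', _, ι', D₁', D₂', b', hc', hd', ho'⟩ := hU
  have hUW : ∀ u ∈ U, ∀ w ∈ W, A u w = 0 ∧ B u w = 0 := fun u hu w hw =>
    ⟨hA.isRefl _ _ (hWU w hw u hu).1, hB.isRefl _ _ (hWU w hw u hu).2⟩
  let c : Module.Basis (Σ s, Sum.elim ι ι' s) ℂ V :=
    ((b.prod b').map (Submodule.prodEquivOfIsCompl W U h)).reindex
      (Equiv.sumSigmaDistrib (Sum.elim ι ι')).symm
  have hl : ∀ s i, c ⟨.inl s, i⟩ = b ⟨s, i⟩ := fun s i => by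
    simp [c, Equiv.sumSigmaDistrib, Module.Basis.prod_apply]
  have hr : ∀ s i, c ⟨.inr s, i⟩ = b' ⟨s, i⟩ := fun s i => by
    simp [c, Equiv.sumSigmaDistrib, Module.Basis.prod_apply]
  refine ⟨σ ⊕ σ', inferInstance, Sum.elim ι ι', fun s => s.rec D₁ D₁', fun s => s.rec D₂ D₂', c,
    ?_, ?_, ?_⟩
  · rintro (s | s)
    exacts [hc s, hc' s]
  · rintro (s | s) i j
    · rw [hl, hl]; exact hd s i j
    · rw [hr, hr]; exact hd' s i j
  · rintro (s | s) (t | t) i j hst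
    · rw [hl, hl]; exact ho s t i j fun h => hst (h ▸ rfl)
    · rw [hl, hr]; exact hWU _ (b _).2 _ (b' _).2
    · rw [hr, hl]; exact hUW _ (b' _).2 _ (b _).2
    · rw [hr, hr]; exact ho' s t i j fun h => hst (h ▸ rfl)

/-- There are vectors with Gram matrices `M₁`, `M₂` whose span is an orthogonal direct summand for
both forms, the complement being cut out by a dual family of functionals. -/
def SplitsOff {κ : Type} [DecidableEq κ] (A B : V →ₗ[ℂ] V →ₗ[ℂ] ℂ) (M₁ M₂ : Matrix κ κ ℂ) : Prop :=
  ∃ (e : κ → V) (φ : κ → Module.Dual ℂ V), (∀ i j, φ i (e j) = (1 : Matrix κ κ ℂ) i j) ∧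
    (∀ i j, A (e i) (e j) = M₁ i j) ∧ (∀ i j, B (e i) (e j) = M₂ i j) ∧
    ∀ i u, (∀ k, φ k u = 0) → A (e i) u = 0 ∧ B (e i) u = 0

theorem SplitsOff.symm {κ : Type} [DecidableEq κ] {A B : V →ₗ[ℂ] V →ₗ[ℂ] ℂ} {M₁ M₂ : Matrix κ κ ℂ}
    (h : SplitsOff A B M₁ M₂) : SplitsOff B A M₂ M₁ := by
  obtain ⟨e, φ, h₁, h₂, h₃, h₄⟩ := h
  exact ⟨e, φ, h₁, h₃, h₂, fun i u hu => (h₄ i u hu).symm⟩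

theorem IsDecomposable.of_splitsOff {κ : Type} [DecidableEq κ] [Fintype κ]
    [Nonempty κ] {A B : V →ₗ[ℂ] V →ₗ[ℂ] ℂ} (hA : A.IsAlt) (hB : B.IsAlt) {M₁ M₂ : Matrix κ κ ℂ}
    (hM : IsCanonicalPair M₁ M₂) (h : SplitsOff A B M₁ M₂)
    (ih : ∀ U : Submodule ℂ V, U ≠ ⊤ →
      IsDecomposable (A.domRestrict₁₂ U U) (B.domRestrict₁₂ U U)) :
    IsDecomposable A B := by
  obtain ⟨e, φ, hφ, heA, heB, horth⟩ := h
  have hsum : ∀ (c : κ → ℂ) k, φ k (∑ i, c i • e i) = c k := fun c k => by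
    simp [hφ, Matrix.one_apply]
  have hli : LinearIndependent ℂ e := by
    rw [Fintype.linearIndependent_iff]
    intro c hc k
    rw [← hsum c k, hc, map_zero]
  let U : Submodule ℂ V := ⨅ k, LinearMap.ker (φ k)
  have hmem : ∀ u, u ∈ U ↔ ∀ k, φ k u = 0 := fun u => by simp [U]
  have hcompl : IsCompl (Submodule.span ℂ (Set.range e)) U := by
    constructor
    · rw [Submodule.disjoint_def]
      intro w hw hwU
      obtain ⟨c, rfl⟩ := (Submodule.mem_span_range_iff_exists_fun ℂ).1 hw
      have : c = 0 := funext fun k => by rw [← hsum c k, (hmem _).1 hwU k, Pi.zero_apply]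
      simp [this]
    · rw [codisjoint_iff, eq_top_iff]
      intro v _
      refine Submodule.mem_sup.2 ⟨∑ i, φ i v • e i,
        (Submodule.mem_span_range_iff_exists_fun ℂ).2 ⟨_, rfl⟩, v - ∑ i, φ i v • e i, ?_, by simp⟩
      exact (hmem _).2 fun k => by rw [map_sub, hsum, sub_self]
  refine .of_isCompl hA hB hcompl ?_ ?_ (ih U ?_)
  · intro w hw u hu
    obtain ⟨c, rfl⟩ := (Submodule.mem_span_range_iff_exists_fun ℂ).1 hw
    have := fun i => horth i u ((hmem u).1 hu)
    simp [this]
  · refine isDecomposable_of_basis hM (Module.Basis.span hli) (fun i j => ?_) fun i j => ?_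
    · rw [LinearMap.domRestrict₁₂_apply, Module.Basis.span_apply, Module.Basis.span_apply, heA]
    · rw [LinearMap.domRestrict₁₂_apply, Module.Basis.span_apply, Module.Basis.span_apply, heB]
  · intro hU
    obtain ⟨k⟩ := ‹Nonempty κ›
    have := (hmem (e k)).1 (hU ▸ Submodule.mem_top) k
    simp [hφ] at this

theorem apply_pow_left {A : V →ₗ[ℂ] V →ₗ[ℂ] ℂ} {N : Module.End ℂ V}
    (hN : ∀ x y, A (N x) y = A x (N y)) (k : ℕ) (x y : V) : A ((N ^ k) x) y = A x ((N ^ k) y) := by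
  induction k generalizing x y with
  | zero => rfl
  | succ k ih =>
    rw [pow_succ, Module.End.mul_apply, ih, hN, ← Module.End.mul_apply, ← pow_succ', pow_succ]

theorem apply_pow_self {A : V →ₗ[ℂ] V →ₗ[ℂ] ℂ} (hA : A.IsAlt) {N : Module.End ℂ V}
    (hN : ∀ x y, A (N x) y = A x (N y)) (k : ℕ) (x : V) : A ((N ^ k) x) x = 0 := by
  have h := hA.neg ((N ^ k) x) x
  rw [← apply_pow_left hN] at h
  linear_combination -h / 2

theorem exists_pow_dual_vector [FiniteDimensional ℂ V] {A : V →ₗ[ℂ] V →ₗ[ℂ] ℂ}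
    (hinj : Function.Injective A) {N : Module.End ℂ V}
    (hN : ∀ x y, A (N x) y = A x (N y)) {m : ℕ}
    (hm : LinearMap.ker (N ^ (m + 1)) = LinearMap.ker (N ^ (m + 2)))
    {x : V} (hx : (N ^ m) x ≠ 0) (hx' : (N ^ (m + 1)) x = 0) :
    ∃ y, (N ^ (m + 1)) y = 0 ∧ ∀ k, A ((N ^ k) x) y = if k = m then 1 else 0 := by
  have hzero : ∀ k, m < k → (N ^ k) x = 0 := fun k hk => by
    obtain ⟨d, rfl⟩ := Nat.exists_eq_add_of_lt hk
    rw [show m + d + 1 = d + (m + 1) by omega, pow_add, Module.End.mul_apply, hx', map_zero]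
  have hy₀ : ∃ y, (N ^ (m + 1)) y = 0 ∧ A ((N ^ m) x) y ≠ 0 := by
    by_contra! hcon
    have hf : A ((N ^ m) x) ∈ LinearMap.range (N ^ (m + 1)).dualMap := by
      rw [LinearMap.range_dualMap_eq_dualAnnihilator_ker, Submodule.mem_dualAnnihilator]
      exact fun y hy => hcon y hy
    obtain ⟨g, hg⟩ := hf
    obtain ⟨z, rfl⟩ := (LinearMap.injective_iff_surjective_of_finrank_eq_finrank
      (Subspace.dual_finrank_eq).symm).1 hinj g
    have hz : (N ^ m) x = (N ^ (m + 1)) z := hinj <| LinearMap.ext fun y => by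
      rw [apply_pow_left hN (m + 1), ← hg]; rfl
    have hz' : z ∈ LinearMap.ker (N ^ (m + 2)) := by
      rw [LinearMap.mem_ker, pow_succ', Module.End.mul_apply, ← hz, ← Module.End.mul_apply,
        ← pow_succ', hx']
    rw [← hm, LinearMap.mem_ker, ← hz] at hz'
    exact hx hz'
  have hstep : ∀ j ≤ m, ∃ y, (N ^ (m + 1)) y = 0 ∧
      ∀ k, m ≤ k + j → A ((N ^ k) x) y = if k = m then 1 else 0 := by
    intro j
    induction j with
    | zero =>
      obtain ⟨y, hy, hy'⟩ := hy₀
      refine fun _ => ⟨(A ((N ^ m) x) y)⁻¹ • y, by simp [hy], fun k hk => ?_⟩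
      split_ifs with h
      · simp [h, hy']
      · simp [hzero k (by omega)]
    | succ j ih =>
      intro hj
      obtain ⟨y, hy, hy'⟩ := ih (by omega)
      refine ⟨y - A ((N ^ (m - (j + 1))) x) y • (N ^ (j + 1)) y, ?_, fun k hk => ?_⟩
      · rw [map_sub, map_smul, hy, ← Module.End.mul_apply, ← pow_add, add_comm (m + 1), pow_add,
          Module.End.mul_apply, hy]
        simp
      · rw [map_sub, map_smul, ← apply_pow_left hN, ← Module.End.mul_apply, ← pow_add,
          hy' (j + 1 + k) (by omega)]
        rcases eq_or_ne k (m - (j + 1)) with rfl | hk'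
        · rw [if_pos (by omega), if_neg (by omega)]
          simp
        · rw [if_neg (show ¬j + 1 + k = m by omega), hy' k (by omega)]
          simp
  obtain ⟨y, hy, hy'⟩ := hstep m le_rfl
  exact ⟨y, hy, fun k => hy' k (by omega)⟩

theorem exists_splitsOff_jordan [FiniteDimensional ℂ V] {A B : V →ₗ[ℂ] V →ₗ[ℂ] ℂ} (hA : A.IsAlt)
    (hinj : Function.Injective A) {T : Module.End ℂ V} (hT : ∀ x y, A (T x) y = B x y)
    (hT' : ∀ x y, A (T x) y = A x (T y)) {μ : ℂ} (hμ : T.HasEigenvalue μ) :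
    ∃ m, 1 ≤ m ∧ SplitsOff A B (jordanJ1 m) (jordanJ2 m μ) := by
  let N : Module.End ℂ V := T - algebraMap ℂ _ μ
  have hNT : ∀ x, N x = T x - μ • x := fun x => rfl
  have hN : ∀ x y, A (N x) y = A x (N y) := fun x y => by simp [hNT, hT']
  have hex : ∃ k, LinearMap.ker (N ^ k) = LinearMap.ker (N ^ (k + 1)) := by
    obtain ⟨k, _, hk⟩ := Module.End.exists_ker_pow_eq_ker_pow_succ N
    exact ⟨k, hk⟩
  obtain ⟨m, hm, hmin⟩ : ∃ m, LinearMap.ker (N ^ m) = LinearMap.ker (N ^ (m + 1)) ∧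
      ∀ k < m, LinearMap.ker (N ^ k) ≠ LinearMap.ker (N ^ (k + 1)) :=
    ⟨Nat.find hex, Nat.find_spec hex, fun k hk => Nat.find_min hex hk⟩
  obtain ⟨v, hv⟩ := hμ.exists_hasEigenvector
  obtain _ | m := m
  · have : v ∈ LinearMap.ker (N ^ (0 + 1)) := by simp [hNT, hv.apply_eq_smul]
    rw [← hm] at this
    exact (hv.2 (by simpa using this)).elim
  obtain ⟨x, hx', hx⟩ : ∃ x, (N ^ (m + 1)) x = 0 ∧ (N ^ m) x ≠ 0 := by
    by_contra! hcon
    refine hmin m (by omega) (le_antisymm (fun x hx => ?_) fun x hx => hcon x hx)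
    rw [LinearMap.mem_ker] at hx ⊢
    rw [pow_succ', Module.End.mul_apply, hx, map_zero]
  obtain ⟨y, hy, hxy⟩ := exists_pow_dual_vector hinj hN hm hx hx'
  have hB : ∀ u v, B u v = A (N u) v + μ * A u v := fun u v => by simp [hNT, hT]
  have hpp : ∀ (z : V) i j, A ((N ^ i) z) ((N ^ j) z) = 0 := fun z i j => by
    rw [← apply_pow_left hN, ← Module.End.mul_apply, ← pow_add, apply_pow_self hA hN]
  have hNp : ∀ (z : V) i, N ((N ^ i) z) = (N ^ (i + 1)) z := fun z i => by
    rw [pow_succ', Module.End.mul_apply]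
  have hpq : ∀ i j, j ≤ m → A ((N ^ i) x) ((N ^ (m - j)) y) = if i = j then 1 else 0 := by
    intro i j hj
    rw [← apply_pow_left hN, ← Module.End.mul_apply, ← pow_add, hxy]
    exact if_congr (by omega) rfl rfl
  have hqp : ∀ i j, j ≤ m → A ((N ^ (m - j)) y) ((N ^ i) x) = if i = j then -1 else 0 := by
    intro i j hj
    rw [← hA.neg, hpq i j hj]
    split_ifs <;> simp
  have hqp' : ∀ i j, j ≤ m → A ((N ^ (m - j + 1)) y) ((N ^ i) x) = if j = i + 1 then -1 else 0 := by
    intro i j hj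
    rw [← hNp, hN, hNp, hqp _ _ hj]
    exact if_congr (by omega) rfl rfl
  refine ⟨m + 1, by omega, Sum.elim (fun i => (N ^ (i : ℕ)) x) (fun j => (N ^ (m - j : ℕ)) y),
    Sum.elim (fun i => A.flip ((N ^ (m - i : ℕ)) y)) (fun j => A ((N ^ (j : ℕ)) x)), ?_, ?_, ?_, ?_⟩
  · rintro (i | i) (j | j)
    · simp [hpq _ _ i.is_le, Matrix.one_apply, Fin.ext_iff, eq_comm]
    · simp [hpp]
    · simp [hpp]
    · simp [hpq _ _ j.is_le, Matrix.one_apply, Fin.ext_iff]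
  · rintro (i | i) (j | j)
    · simp [hpp, jordanJ1]
    · simp [hpq _ _ j.is_le, Matrix.one_apply, Fin.ext_iff, jordanJ1]
    · simp [hqp _ _ i.is_le, Matrix.one_apply, Fin.ext_iff, jordanJ1, eq_comm]
      split_ifs <;> simp
    · simp [hpp, jordanJ1]
  · rintro (i | i) (j | j)
    · simp [hB, hNp, hpp, jordanJ2]
    · simp only [hB, hNp, Sum.elim_inl, Sum.elim_inr, hpq _ _ j.is_le, jordanJ2, jordanA,
        Matrix.fromBlocks_apply₁₂, Matrix.of_apply, Fin.ext_iff]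
      split_ifs <;> first | omega | simp
    · simp only [hB, hNp, Sum.elim_inl, Sum.elim_inr, hqp _ _ i.is_le, hqp' _ _ i.is_le, jordanJ2,
        jordanA, Matrix.fromBlocks_apply₂₁, Matrix.of_apply, Matrix.neg_apply,
        Matrix.transpose_apply, Fin.ext_iff]
      split_ifs <;> first | omega | simp
    · simp [hB, hNp, hpp, jordanJ2]
  · intro k u hu
    have hp : ∀ i, A ((N ^ i) x) u = 0 := fun i => by
      rcases le_or_gt i m with hi | hi
      · exact hu (.inr ⟨i, by omega⟩)
      · rw [show i = (i - (m + 1)) + (m + 1) by omega, pow_add, Module.End.mul_apply, hx']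
        simp
    have hq : ∀ i, A ((N ^ i) y) u = 0 := fun i => by
      rcases le_or_gt i m with hi | hi
      · have := hu (.inl ⟨m - i, by omega⟩)
        simp only [Sum.elim_inl, LinearMap.flip_apply, Nat.sub_sub_self hi] at this
        rw [← hA.neg, this, neg_zero]
      · rw [show i = (i - (m + 1)) + (m + 1) by omega, pow_add, Module.End.mul_apply, hy]
        simp
    rcases k with k | k
    · simp [hB, hNp, hp]
    · simp [hB, hNp, hq]

theorem eq_swap_of_hankel {R : Type*} {f : ℕ → ℕ → R} {k : ℕ}
    (hf : ∀ i j, i < k → j < k → f i (j + 1) = f (i + 1) j) {i j : ℕ} (hi : i ≤ k) (hj : j ≤ k) :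
    f i j = f j i := by
  have key : ∀ d i, i + d ≤ k → f i (i + d) = f (i + d) i := by
    intro d
    induction d using Nat.twoStepInduction with
    | zero => exact fun i _ => rfl
    | one => exact fun i h => hf i i (by omega) (by omega)
    | more d ih _ =>
      intro i h
      have h₁ := hf i (i + d + 1) (by omega) (by omega)
      have h₂ := hf (i + d + 1) i (by omega) (by omega)
      have h₃ := ih (i + 1) (by omega)
      rw [show i + 1 + d = i + d + 1 by omega] at h₃
      exact (h₁.trans h₃).trans h₂
  rcases le_total i j with h | h
  · obtain ⟨d, rfl⟩ := Nat.exists_eq_add_of_le h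
    exact key d i hj
  · obtain ⟨d, rfl⟩ := Nat.exists_eq_add_of_le h
    exact (key d j hi).symm

theorem apply_eq_zero_of_hankel {A : V →ₗ[ℂ] V →ₗ[ℂ] ℂ} (hA : A.IsAlt) {x : ℕ → V} {k : ℕ}
    (hx : ∀ i j, i < k → j < k → A (x i) (x (j + 1)) = A (x (i + 1)) (x j)) {i j : ℕ}
    (hi : i ≤ k) (hj : j ≤ k) : A (x i) (x j) = 0 := by
  have h₁ : A (x i) (x j) = A (x j) (x i) :=
    eq_swap_of_hankel (f := fun i j => A (x i) (x j)) hx hi hj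
  have h₂ := hA.neg (x i) (x j)
  linear_combination h₁ / 2 - h₂ / 2

/-- A sequence of vectors `x` such that `∑ i, λ ^ i • x i` is formally annihilated by
`B - λ • A`. -/
def IsKernelChain (A B : V →ₗ[ℂ] V →ₗ[ℂ] ℂ) (x : ℕ → V) : Prop :=
  B (x 0) = 0 ∧ ∀ i, B (x (i + 1)) = A (x i)

theorem exists_dual_chain [FiniteDimensional ℂ V] {A B : V →ₗ[ℂ] V →ₗ[ℂ] ℂ} (hA : A.IsAlt)
    (hB : B.IsAlt) {x₀ : V} (hx₀ : x₀ ≠ 0) (hBx₀ : B x₀ = 0) {k : ℕ}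
    (hmin : ∀ y, IsKernelChain A B y → (∀ i, k < i → y i = 0) → y = 0) :
    ∃ w : ℕ → V, (∀ j < k, B (w j) = A (w (j + 1))) ∧ A x₀ (w 0) = 1 := by
  let Θ : (ℕ → V) →ₗ[ℂ] (Fin k → Module.Dual ℂ V) := LinearMap.pi fun j =>
    B.comp (LinearMap.proj (j : ℕ)) - A.comp (LinearMap.proj ((j : ℕ) + 1))
  have hΘ : ∀ w j, Θ w j = B (w j) - A (w (j + 1)) := fun w j => rfl
  by_contra! hcon
  have hf : (A x₀).comp (LinearMap.proj 0) ∈ LinearMap.range Θ.dualMap := by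
    rw [LinearMap.range_dualMap_eq_dualAnnihilator_ker, Submodule.mem_dualAnnihilator]
    intro w hw
    by_contra hne
    change A x₀ (w 0) ≠ 0 at hne
    have hw' : ∀ j < k, B (w j) = A (w (j + 1)) := fun j hj =>
      sub_eq_zero.1 (congrFun (LinearMap.mem_ker.1 hw) ⟨j, hj⟩)
    refine hcon ((A x₀ (w 0))⁻¹ • w) (fun j hj => ?_) ?_
    · simp [hw' j hj]
    · simp [hne]
  obtain ⟨h, hh⟩ := hf
  let y : ℕ → V := fun j => if hj : j < k then
    (Module.evalEquiv ℂ V).symm (h.comp (LinearMap.single ℂ (fun _ => Module.Dual ℂ V) ⟨j, hj⟩))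
    else 0
  have hy : ∀ (j : Fin k) ψ, h (Pi.single j ψ) = ψ (y j) := fun j ψ => by
    simp [y]
  have hsum : ∀ w : ℕ → V,
      A x₀ (w 0) = ∑ j ∈ Finset.range k, (B (w j) (y j) - A (w (j + 1)) (y j)) := by
    intro w
    have h₁ : A x₀ (w 0) = h (Θ w) := (LinearMap.congr_fun hh w).symm
    rw [h₁, ← Finset.univ_sum_single (Θ w), map_sum, Finset.sum_range]
    exact Finset.sum_congr rfl fun j _ => by rw [hy, hΘ, LinearMap.sub_apply]
  have hyk : ∀ j, k ≤ j → y j = 0 := fun j hj => dif_neg (by omega)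
  have hzero : B (y 0) = -A x₀ := by
    ext v
    have := hsum (Pi.single 0 v)
    simp only [Pi.single_apply] at this
    rcases Nat.eq_zero_or_pos k with rfl | hk
    · simpa [hyk] using this
    · have hs : ∑ j ∈ Finset.range k, B (if j = 0 then v else 0) (y j) = B v (y 0) := by
        rw [Finset.sum_eq_single_of_mem 0 (by simpa using hk)] <;> simp +contextual
      simp [hs] at this
      rw [← hB.neg, ← this]; simp
  have hsucc : ∀ i, B (y (i + 1)) = A (y i) := by
    intro i
    ext v
    rcases lt_or_ge i k with hi | hi
    · have := hsum (Pi.single (i + 1) v)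
      have h₁ : ∑ j ∈ Finset.range k, A (Pi.single (M := fun _ => V) (i + 1) v (j + 1)) (y j)
          = A v (y i) := by
        rw [Finset.sum_eq_single_of_mem i (by simpa using hi)]
        · simp
        · intro j _ hj; simp [hj]
      have h₂ : ∑ j ∈ Finset.range k, B (Pi.single (M := fun _ => V) (i + 1) v j) (y j)
          = B v (y (i + 1)) := by
        rw [Finset.sum_eq_single (i + 1)]
        · simp
        · intro j _ hj; simp [hj]
        · intro hj; rw [hyk (i + 1) (by simpa using hj)]; simp
      rw [Finset.sum_sub_distrib, h₁, h₂] at this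
      rw [← hB.neg, ← hA.neg, neg_inj, ← sub_eq_zero, ← this]
      simp
    · rw [hyk i hi, hyk (i + 1) (by omega)]; simp
  let z : ℕ → V := fun i => i.casesOn x₀ fun j => -y j
  have hz : z = 0 := by
    refine hmin z ⟨hBx₀, fun i => ?_⟩ fun i hi => ?_
    · obtain _ | i := i
      · simp [z, hzero]
      · simp [z, hsucc]
    · obtain _ | i := i
      · omega
      · simp [z, hyk i (by omega)]
  exact hx₀ (congrFun hz 0)

theorem exists_splitsOff_kronecker [FiniteDimensional ℂ V] {A B : V →ₗ[ℂ] V →ₗ[ℂ] ℂ}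
    (hA : A.IsAlt) (hB : B.IsAlt)
    (h : ∃ (n : ℕ) (x : ℕ → V), IsKernelChain A B x ∧ (∀ i, n < i → x i = 0) ∧ x ≠ 0) :
    ∃ n, SplitsOff A B (kronK1 ℂ n) (kronK2 ℂ n) := by
  classical
  obtain ⟨n, ⟨x, hx, hxn, hne⟩, hmin⟩ :
      ∃ n, (∃ x, IsKernelChain A B x ∧ (∀ i, n < i → x i = 0) ∧ x ≠ 0) ∧
        ∀ k < n, ∀ y, IsKernelChain A B y → (∀ i, k < i → y i = 0) → y = 0 := by
    refine ⟨Nat.find h, Nat.find_spec h, fun k hk y hy hyk => ?_⟩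
    by_contra hne
    exact Nat.find_min h hk ⟨y, hy, hyk, hne⟩
  have hx₀ : x 0 ≠ 0 := by
    intro h₀
    have hne' : (fun i => x (i + 1)) ≠ 0 := fun h' => hne <| funext fun i => by
      obtain _ | i := i
      exacts [h₀, congrFun h' i]
    obtain _ | n := n
    · exact hne' (funext fun i => hxn _ (by omega))
    · refine hne' (hmin n (by omega) _ ⟨?_, fun i => hx.2 _⟩ fun i hi => hxn _ (by omega))
      rw [hx.2, h₀, map_zero]
  have hxA : ∀ i j, A (x i) (x (j + 1)) = A (x (i + 1)) (x j) := fun i j => by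
    rw [← hx.2 i, ← hB.neg, hx.2, hA.neg]
  have hxxA : ∀ i j, A (x i) (x j) = 0 := fun i j =>
    apply_eq_zero_of_hankel hA (k := max i j) (fun i j _ _ => hxA i j)
      (le_max_left i j) (le_max_right i j)
  have hxxB : ∀ i j, B (x i) (x j) = 0 := fun i j => by
    obtain _ | i := i
    · simp [hx.1]
    · rw [hx.2, hxxA]
  obtain _ | k := n
  · obtain ⟨φ, hφ⟩ := Module.Projective.exists_dual_ne_zero ℂ hx₀
    have hA₀ : A (x 0) = 0 := by rw [← hx.2, hxn 1 (by omega), map_zero]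
    refine ⟨0, fun _ => x 0, fun _ => (φ (x 0))⁻¹ • φ, ?_, ?_, ?_, ?_⟩
    · rintro (i | i) (j | j)
      · exact i.elim0
      · exact i.elim0
      · exact j.elim0
      · obtain rfl : i = j := Subsingleton.elim (α := Fin 1) i j
        simp [hφ]
    · rintro (i | i) (j | j)
      · exact i.elim0
      · exact i.elim0
      · exact j.elim0
      · simp [hA₀, kronK1]
    · rintro (i | i) (j | j)
      · exact i.elim0
      · exact i.elim0
      · exact j.elim0
      · simp [hx.1, kronK2]
    · intro _ u _
      simp [hA₀, hx.1]
  obtain ⟨w, hw, hw₀⟩ := exists_dual_chain hA hB hx₀ hx.1 (hmin k (by omega))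
  have hshift : ∀ i j, j < k → A (x (i + 1)) (w (j + 1)) = A (x i) (w j) := fun i j hj => by
    rw [← hA.neg, ← hw j hj, hB.neg, hx.2]
  have hA₀ : ∀ j < k, A (x 0) (w (j + 1)) = 0 := fun j hj => by
    rw [← hA.neg, ← hw j hj, hB.neg, hx.1, LinearMap.zero_apply]
  have hxw : ∀ j ≤ k, ∀ i, A (x i) (w j) = if i = j then 1 else 0 := by
    have hlow : ∀ j ≤ k, ∀ i ≤ j, A (x i) (w j) = if i = j then 1 else 0 := by
      intro j
      induction j with
      | zero =>
        intro _ i hi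
        obtain rfl : i = 0 := by omega
        simp [hw₀]
      | succ j ih =>
        intro hj i hi
        obtain _ | i := i
        · simp [hA₀ j (by omega)]
        · rw [hshift i j (by omega), ih (by omega) i (by omega)]
          simp
    have hhigh : ∀ d j, j + d = k → ∀ i, j < i → A (x i) (w j) = 0 := by
      intro d
      induction d with
      | zero =>
        intro j hj i hi
        rw [← hx.2, hxn (i + 1) (by omega)]
        simp
      | succ d ih =>
        intro j hj i hi
        rw [← hshift i j (by omega)]
        exact ih (j + 1) (by omega) (i + 1) (by omega)
    intro j hj i
    rcases le_or_gt i j with hij | hij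
    · exact hlow j hj i hij
    · rw [hhigh (k - j) j (by omega) i hij, if_neg (by omega)]
  have hxwB : ∀ j ≤ k, ∀ i, B (x i) (w j) = if i = j + 1 then 1 else 0 := fun j hj i => by
    obtain _ | i := i
    · simp [hx.1]
    · rw [hx.2, hxw j hj]
      exact if_congr (by omega) rfl rfl
  have hwx : ∀ j ≤ k, ∀ i, A (w j) (x i) = -if i = j then 1 else 0 := fun j hj i => by
    rw [← hxw j hj, hA.neg]
  have hwxB : ∀ j ≤ k, ∀ i, B (w j) (x i) = -if i = j + 1 then 1 else 0 := fun j hj i => by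
    rw [← hxwB j hj, hB.neg]
  have hwwA : ∀ i j, i ≤ k → j ≤ k → A (w i) (w j) = 0 := fun i j =>
    apply_eq_zero_of_hankel hA fun i j hi hj => by
      rw [← hw i hi, ← hA.neg, ← hw j hj, hB.neg]
  have hwwB : ∀ i j, i ≤ k → j ≤ k → B (w i) (w j) = 0 := fun i j hi hj => by
    rcases hi.lt_or_eq with hi' | rfl
    · rw [hw i hi', hwwA _ _ hi' hj]
    rcases hj.lt_or_eq with hj' | rfl
    · rw [← hB.neg, hw j hj', hwwA _ _ hj' hi, neg_zero]
    · exact hB _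
  have hlt : ∀ i : Fin (k + 1), (i : ℕ) ≤ k := Fin.is_le
  refine ⟨k + 1, Sum.elim (fun i => -w i) (fun j => x j),
    Sum.elim (fun i => -A (x i)) (fun j => if (j : ℕ) ≤ k then -A (w j) else -B (w k)),
    ?_, ?_, ?_, ?_⟩
  · rintro (i | i) (j | j)
    · simp [hxw _ (hlt j), Matrix.one_apply, Fin.ext_iff]
    · simp [hxxA]
    · rcases le_or_gt (i : ℕ) k with hi | hi
      · simp [hi, hwwA _ _ hi (hlt j)]
      · simp [hi.not_ge, hwwB _ _ le_rfl (hlt j)]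
    · rcases le_or_gt (i : ℕ) k with hi | hi
      · simp [hi, hwx _ hi, Matrix.one_apply, Fin.ext_iff, eq_comm]
      · have hik : (i : ℕ) = k + 1 := by omega
        simp [hwxB _ le_rfl, Matrix.one_apply, Fin.ext_iff, hik, eq_comm]
  · rintro (i | i) (j | j)
    · simp [hwwA _ _ (hlt i) (hlt j), kronK1]
    · simp [hwx _ (hlt i), kronK1, kronB1]
    · simp [hxw _ (hlt j), kronK1, kronB1]
    · simp [hxxA, kronK1]
  · rintro (i | i) (j | j)
    · simp [hwwB _ _ (hlt i) (hlt j), kronK2]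
    · simp [hwxB _ (hlt i), kronK2, kronB2]
    · simp [hxwB _ (hlt j), kronK2, kronB2]
    · simp [hxxB, kronK2]
  · intro l u hu
    have hxu : ∀ i, A (x i) u = 0 := fun i => by
      rcases le_or_gt i k with hi | hi
      · simpa using hu (.inl ⟨i, by omega⟩)
      · rw [← hx.2, hxn (i + 1) (by omega)]
        simp
    have hwu : ∀ i ≤ k, A (w i) u = 0 := fun i hi => by
      simpa [hi] using hu (.inr ⟨i, by omega⟩)
    rcases l with l | l
    · refine ⟨by simp [hwu _ (hlt l)], ?_⟩
      rcases (hlt l).lt_or_eq with hl | hl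
      · simp [hw _ hl, hwu _ hl]
      · simpa [hl] using hu (.inr ⟨k + 1, by omega⟩)
    · refine ⟨hxu l, ?_⟩
      simp only [Sum.elim_inr]
      cases (l : ℕ) with
      | zero => simp [hx.1]
      | succ l => rw [hx.2, hxu]

open Polynomial in
theorem exists_isKernelChain [FiniteDimensional ℂ V] {A B : V →ₗ[ℂ] V →ₗ[ℂ] ℂ}
    (h : ∀ c : ℂ, ∃ v ≠ 0, (B - c • A) v = 0) :
    ∃ (n : ℕ) (x : ℕ → V), IsKernelChain A B x ∧ (∀ i, n < i → x i = 0) ∧ x ≠ 0 := by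
  let b := Module.finBasis ℂ V
  let MA := LinearMap.toMatrix b b.dualBasis A
  let MB := LinearMap.toMatrix b b.dualBasis B
  let M : Matrix _ _ ℂ[X] := MB.map C - (X : ℂ[X]) • MA.map C
  have hdet : M.det = 0 := by
    refine Polynomial.funext fun c => ?_
    obtain ⟨v, hv, hv0⟩ := h c
    have hMc : (evalRingHom c).mapMatrix M = LinearMap.toMatrix b b.dualBasis (B - c • A) := by
      ext i j
      simp [M, MA, MB, mul_comm c]
    rw [← coe_evalRingHom, RingHom.map_det, hMc, map_zero, ← Matrix.exists_mulVec_eq_zero_iff]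
    refine ⟨b.repr v, fun h0 => hv ?_, ?_⟩
    · exact b.repr.map_eq_zero_iff.1 (DFunLike.coe_injective h0)
    · rw [LinearMap.toMatrix_mulVec_repr, hv0]
      simp
  obtain ⟨p, hp, hp0⟩ := Matrix.exists_mulVec_eq_zero_iff.2 hdet
  let x : ℕ → V := fun i => ∑ k, (p k).coeff i • b k
  have hrepr : ∀ i, (b.repr (x i) : _ → ℂ) = fun k => (p k).coeff i := fun i => by
    simp only [x, ← b.equivFun_symm_apply]
    exact b.equivFun.apply_symm_apply _
  have hmul : ∀ (F : V →ₗ[ℂ] V →ₗ[ℂ] ℂ) i k, b.dualBasis.repr (F (x i)) k =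
      (((LinearMap.toMatrix b b.dualBasis F).map C *ᵥ p) k).coeff i := fun F i k => by
    rw [← LinearMap.toMatrix_mulVec_repr b, hrepr]
    simp [Matrix.mulVec, dotProduct]
  have hM : ∀ k, (MB.map C *ᵥ p) k = X * (MA.map C *ᵥ p) k := fun k => by
    have := congrFun hp0 k
    rw [Matrix.sub_mulVec, Matrix.smul_mulVec] at this
    exact sub_eq_zero.1 this
  refine ⟨Finset.univ.sup fun k => (p k).natDegree, x, ⟨?_, fun i => ?_⟩, fun i hi => ?_,
    fun h0 => ?_⟩
  · refine b.dualBasis.ext_elem fun k => ?_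
    rw [hmul, hM]
    simp
  · refine b.dualBasis.ext_elem fun k => ?_
    rw [hmul, hmul, hM, coeff_X_mul]
  · refine Finset.sum_eq_zero fun k _ => ?_
    rw [coeff_eq_zero_of_natDegree_lt, zero_smul]
    exact (Finset.le_sup (f := fun k => (p k).natDegree) (Finset.mem_univ k)).trans_lt hi
  · refine hp (funext fun k => Polynomial.ext fun i => ?_)
    rw [← congrFun (hrepr i) k, h0]
    simp

theorem isCanonicalPair_jordan {m : ℕ} (hm : 1 ≤ m) (μ : ℂ) :
    IsCanonicalPair (jordanJ1 m) (jordanJ2 m μ) :=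
  .inl ⟨m, μ, .refl _, hm, rfl, rfl⟩

theorem isCanonicalPair_jordan_infinity {m : ℕ} (hm : 1 ≤ m) :
    IsCanonicalPair (jordanJ2 m 0) (jordanJ1 m) :=
  .inr (.inl ⟨m, .refl _, hm, rfl, rfl⟩)

theorem isCanonicalPair_kronecker (n : ℕ) : IsCanonicalPair (kronK1 ℂ n) (kronK2 ℂ n) :=
  .inr (.inr ⟨n, .refl _, rfl, rfl⟩)

theorem exists_recursion_operator [FiniteDimensional ℂ V] {A B : V →ₗ[ℂ] V →ₗ[ℂ] ℂ}
    (hA : A.IsAlt) (hB : B.IsAlt) (hinj : Function.Injective A) :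
    ∃ T : Module.End ℂ V, (∀ x y, A (T x) y = B x y) ∧ ∀ x y, A (T x) y = A x (T y) := by
  let E : V ≃ₗ[ℂ] Module.Dual ℂ V :=
    LinearEquiv.ofInjectiveOfFinrankEq A hinj Subspace.dual_finrank_eq.symm
  have hT : ∀ x y, A (E.symm (B x)) y = B x y := fun x y =>
    LinearMap.congr_fun (E.apply_symm_apply (B x)) y
  refine ⟨E.symm.toLinearMap ∘ₗ B, hT, fun x y => ?_⟩
  rw [← hA.neg ((E.symm.toLinearMap ∘ₗ B) y) x]
  exact (hT x y).trans (by rw [← hB.neg, ← hT y x]; rfl)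

theorem isDecomposable_of_isAlt [FiniteDimensional ℂ V] {A B : V →ₗ[ℂ] V →ₗ[ℂ] ℂ}
    (hA : A.IsAlt) (hB : B.IsAlt) : IsDecomposable A B := by
  induction hd : Module.finrank ℂ V using Nat.strong_induction_on generalizing V with
  | _ d ih =>
  have ih' : ∀ U : Submodule ℂ V, U ≠ ⊤ →
      IsDecomposable (A.domRestrict₁₂ U U) (B.domRestrict₁₂ U U) := fun U hU =>
    ih _ (hd ▸ Submodule.finrank_lt hU) (fun u => hA u) (fun u => hB u) rfl
  cases subsingleton_or_nontrivial V
  · exact isDecomposable_of_subsingleton A B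
  by_cases hreg : ∀ c : ℂ, ∃ v ≠ 0, (B - c • A) v = 0
  · obtain ⟨n, hn⟩ := exists_splitsOff_kronecker hA hB (exists_isKernelChain hreg)
    exact .of_splitsOff hA hB (isCanonicalPair_kronecker n) hn ih'
  push Not at hreg
  obtain ⟨c, hc⟩ := hreg
  by_cases hAinj : Function.Injective A
  · obtain ⟨T, hT, hT'⟩ := exists_recursion_operator hA hB hAinj
    obtain ⟨μ, hμ⟩ := Module.End.exists_eigenvalue T
    obtain ⟨m, hm, hs⟩ := exists_splitsOff_jordan hA hAinj hT hT' hμ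
    have : Nonempty (Fin m) := ⟨⟨0, hm⟩⟩
    exact .of_splitsOff hA hB (isCanonicalPair_jordan hm μ) hs ih'
  obtain ⟨a, ha, ha₀⟩ : ∃ a, A a = 0 ∧ a ≠ 0 := by
    simpa [injective_iff_map_eq_zero] using hAinj
  by_cases hBinj : Function.Injective B
  · obtain ⟨T, hT, hT'⟩ := exists_recursion_operator hB hA hBinj
    have hTa : T a = (0 : ℂ) • a := hBinj (LinearMap.ext fun y => by simp [hT, ha])
    have hμ : T.HasEigenvalue 0 := Module.End.hasEigenvalue_of_hasEigenvector
      (x := a) ⟨Module.End.mem_eigenspace_iff.2 hTa, ha₀⟩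
    obtain ⟨m, hm, hs⟩ := exists_splitsOff_jordan hB hBinj hT hT' hμ
    have : Nonempty (Fin m) := ⟨⟨0, hm⟩⟩
    exact .of_splitsOff hA hB (isCanonicalPair_jordan_infinity hm) hs.symm ih'
  obtain ⟨v, hv, hv₀⟩ : ∃ v, B v = 0 ∧ v ≠ 0 := by
    simpa [injective_iff_map_eq_zero] using hBinj
  have hC : (B - c • A).IsAlt := fun x => by simp [hA x, hB x]
  have hCinj : Function.Injective (B - c • A) :=
    (injective_iff_map_eq_zero _).2 fun v hv => by_contra fun h => hc v h hv
  obtain ⟨T, hT, hT'⟩ := exists_recursion_operator hC hA hCinj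
  obtain ⟨k, hk, hk₀⟩ := ((LinearMap.eventually_isCompl_ker_pow_range_pow T).and
    (Filter.eventually_gt_atTop 0)).exists
  have hTa : T a = 0 := hCinj (LinearMap.ext fun y => by rw [hT, ha, map_zero])
  have hTv : v = -c • T v := hCinj (LinearMap.ext fun y => by
    rw [map_smul, LinearMap.smul_apply, hT]; simp [hv])
  have hTv' : ∀ j, v = (-c) ^ j • (T ^ j) v := fun j => by
    induction j with
    | zero => simp
    | succ j ih =>
      rw [pow_succ', pow_succ', Module.End.mul_apply, mul_smul, ← map_smul T, ← ih, ← hTv]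
  have hak : a ∈ LinearMap.ker (T ^ k) := by
    obtain ⟨j, rfl⟩ := Nat.exists_eq_succ_of_ne_zero hk₀.ne'
    simp [pow_succ, hTa]
  refine .of_isCompl hA hB hk ?_ (ih' _ fun h => hv₀ ?_) (ih' _ fun h => ha₀ ?_)
  · rintro w hw _ ⟨z, rfl⟩
    rw [LinearMap.mem_ker] at hw
    have h₁ : (B - c • A) w ((T ^ k) z) = 0 := by
      rw [← apply_pow_left hT', hw]
      simp
    have h₂ : A w ((T ^ k) z) = 0 := by
      rw [← hT, ← apply_pow_left hT', ← Module.End.mul_apply, ← pow_succ, pow_succ',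
        Module.End.mul_apply, hw]
      simp
    exact ⟨h₂, by simpa [h₂] using h₁⟩
  · have : v ∈ LinearMap.ker (T ^ k) := h ▸ Submodule.mem_top
    rw [hTv' k, LinearMap.mem_ker.1 this, smul_zero]
  · exact (Submodule.disjoint_def.1 hk.disjoint) a hak (h ▸ Submodule.mem_top)

/-- classification of pairs of skew-symmetric bilinear forms on a complex vector
space: any pair of skew-symmetric `N×N` complex matrices is simultaneously congruent to a
block-diagonal matrix pair whose diagonal blocks are canonical pairs (Jordan blocks, Jordan
blocks with eigenvalue ∞, or Kronecker blocks). -/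
theorem skew_pair_classification (N : ℕ) (c₁ c₂ : Matrix (Fin N) (Fin N) ℂ)
    (h₁ : c₁ᵀ = -c₁) (h₂ : c₂ᵀ = -c₂) :
    ∃ (r : ℕ) (ι : Fin r → Type)
      (D₁ D₂ : ∀ s : Fin r, Matrix (ι s) (ι s) ℂ)
      (e : Fin N ≃ (Σ s : Fin r, ι s))
      (P : Matrix (Fin N) (Fin N) ℂ), IsUnit P ∧
      (∀ s : Fin r, IsCanonicalPair (D₁ s) (D₂ s)) ∧
      Pᵀ * c₁ * P = Matrix.reindex e.symm e.symm (Matrix.blockDiagonal' D₁) ∧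
      Pᵀ * c₂ * P = Matrix.reindex e.symm e.symm (Matrix.blockDiagonal' D₂) := by
  have halt : ∀ c : Matrix (Fin N) (Fin N) ℂ, cᵀ = -c → (Matrix.toBilin' c).IsAlt := by
    intro c hc v
    have h : v ⬝ᵥ c *ᵥ v = -(v ⬝ᵥ c *ᵥ v) := by
      conv_lhs => rw [dotProduct_mulVec, ← mulVec_transpose, hc, neg_mulVec, neg_dotProduct,
        dotProduct_comm]
    rw [Matrix.toBilin'_apply']
    linear_combination h / 2
  obtain ⟨σ, _, ι, D₁, D₂, b, hc, hd, ho⟩ := isDecomposable_of_isAlt (halt c₁ h₁) (halt c₂ h₂)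
  obtain ⟨r, ⟨g⟩⟩ := Finite.exists_equiv_fin σ
  let f : (Σ s : Fin r, ι (g.symm s)) ≃ Σ s, ι s := Equiv.sigmaCongrLeft g.symm
  let e : Fin N ≃ Σ s : Fin r, ι (g.symm s) :=
    ((Pi.basisFun ℂ (Fin N)).indexEquiv b).trans f.symm
  let b' : Module.Basis (Fin N) ℂ (Fin N → ℂ) := (b.reindex f.symm).reindex e.symm
  have hb' : ∀ i, b' i = b ⟨g.symm (e i).1, (e i).2⟩ := fun i => by
    simp [b', f, Equiv.sigmaCongrLeft]
  have hmul : ∀ c : Matrix (Fin N) (Fin N) ℂ, ∀ i j,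
      (((Pi.basisFun ℂ (Fin N)).toMatrix b')ᵀ * c * (Pi.basisFun ℂ (Fin N)).toMatrix b') i j =
        Matrix.toBilin' c (b' i) (b' j) := fun c i j => by
    rw [Matrix.toBilin'_apply', Matrix.mul_assoc, Matrix.mul_apply]
    rfl
  have hgram : ∀ (c : Matrix (Fin N) (Fin N) ℂ) (D : ∀ s, Matrix (ι s) (ι s) ℂ),
      (∀ s i j, Matrix.toBilin' c (b ⟨s, i⟩) (b ⟨s, j⟩) = D s i j) →
      (∀ s t i j, s ≠ t → Matrix.toBilin' c (b ⟨s, i⟩) (b ⟨t, j⟩) = 0) →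
      ((Pi.basisFun ℂ (Fin N)).toMatrix b')ᵀ * c * (Pi.basisFun ℂ (Fin N)).toMatrix b' =
        Matrix.reindex e.symm e.symm (Matrix.blockDiagonal' fun s => D (g.symm s)) := by
    intro c D hdiag hoff
    ext i j
    rw [hmul, hb', hb', Matrix.reindex_apply, Matrix.submatrix_apply, Equiv.symm_symm]
    generalize e i = p, e j = q
    obtain ⟨s, i⟩ := p
    obtain ⟨t, j⟩ := q
    rcases eq_or_ne s t with rfl | hst
    · rw [Matrix.blockDiagonal'_apply_eq, hdiag]
    · rw [Matrix.blockDiagonal'_apply_ne _ _ _ hst, hoff _ _ _ _ (g.symm.injective.ne hst)]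
  have := (Pi.basisFun ℂ (Fin N)).invertibleToMatrix b'
  exact ⟨r, fun s => ι (g.symm s), fun s => D₁ (g.symm s), fun s => D₂ (g.symm s), e,
    (Pi.basisFun ℂ (Fin N)).toMatrix b', isUnit_of_invertible _, fun s => hc _,
    hgram c₁ D₁ (fun s i j => (hd s i j).1) fun s t i j h => (ho s t i j h).1,
    hgram c₂ D₂ (fun s i j => (hd s i j).2) fun s t i j h => (ho s t i j h).2⟩

end
end

section
/- Real classification in the absence of Jordan blocks: Let C1, C2 be real skew-symmetric N×N matrices and let R0 be the maximum over (λ1,λ2) ∈ ℝ² of rank(λ1·C1 + λ2·C2). Assume that for every (λ1,λ2) ∈ ℂ² \ {(0,0)} the complex matrix λ1·C1 + λ2·C2 has rank R0. Then there exist an integer k ≥ 0, integers n_1,…,n_k ≥ 0 with N = Σ_{j=1}^k (2n_j+1), and an invertible real N×N matrix P such that, for i = 1,2, Pᵀ·C_i·P is the block-diagonal matrix with diagonal blocks K_i(n_1),…,K_i(n_k) (Kronecker block pairs over ℝ). -/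
open Matrix

noncomputable section

theorem Matrix.exists_mul_mul_eq_one {F m n : Type*} [Field F] [Fintype m] [Fintype n]
    [DecidableEq m] [DecidableEq n] (M : Matrix m n F) :
    ∃ (D : Matrix (Fin M.rank) m F) (E : Matrix n (Fin M.rank) F), D * M * E = 1 := by
  let f := M.mulVecLin
  let b : Module.Basis (Fin M.rank) F (LinearMap.range f) := Module.finBasisOfFinrankEq F _ rfl
  obtain ⟨g, hg⟩ := LinearMap.exists_leftInverse_of_injective (LinearMap.range f).subtype
    (Submodule.ker_subtype _)
  choose e he using fun i => (b i).2
  refine ⟨LinearMap.toMatrix' (b.equivFun.toLinearMap ∘ₗ g), Matrix.of fun j i => e i j, ?_⟩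
  have hM : ∀ i, M *ᵥ e i = (LinearMap.range f).subtype (b i) := he
  ext i j
  rw [Matrix.mul_assoc, Matrix.mul_apply_eq_vecMul]
  have hcol : (LinearMap.toMatrix' (b.equivFun.toLinearMap ∘ₗ g) * (M * Matrix.of fun j i => e i j))
      *ᵥ Pi.single j 1 = Pi.single j 1 := by
    have h1 : (Matrix.of fun j i => e i j) *ᵥ Pi.single j 1 = e j := by
      ext k; simp
    rw [← Matrix.mulVec_mulVec, ← Matrix.mulVec_mulVec, h1, hM, LinearMap.toMatrix'_mulVec,
      LinearMap.comp_apply, ← LinearMap.comp_apply g, hg]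
    ext k
    simp [Pi.single_apply, eq_comm]
  have := congrFun hcol i
  rw [Matrix.mulVec_single_one] at this
  simpa [Matrix.one_apply, Pi.single_apply, Matrix.mul_apply_eq_vecMul] using this

theorem Matrix.mulVec_eq_zero_of_rank_le {F l m n : Type*} [Field F] [Fintype l] [Fintype m]
    [Fintype n] (D : Matrix l m F) (M : Matrix m n F) (h : M.rank ≤ (D * M).rank)
    (x : n → F) (hx : (D * M) *ᵥ x = 0) : M *ᵥ x = 0 := by
  have hle : LinearMap.ker M.mulVecLin ≤ LinearMap.ker (D * M).mulVecLin := by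
    intro y hy
    simp only [LinearMap.mem_ker, Matrix.mulVecLin_apply] at hy ⊢
    rw [← Matrix.mulVec_mulVec, hy, Matrix.mulVec_zero]
  have h1 := LinearMap.finrank_range_add_finrank_ker M.mulVecLin
  have h2 := LinearMap.finrank_range_add_finrank_ker (D * M).mulVecLin
  have heq := Submodule.eq_of_le_of_finrank_le hle (by
    simp only [Matrix.rank] at h
    omega)
  have hxm : x ∈ LinearMap.ker (D * M).mulVecLin := by simpa using hx
  rw [← heq] at hxm
  simpa using hxm

open Polynomial in
/-- A kernel vector of `M₀` extends to a formal power series in the kernel of a pencil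
`M₀ + t • M₁` of constant rank. -/
theorem Matrix.exists_chain_of_rank_le {F m n : Type*} [Field F] [Infinite F] [Fintype m]
    [Fintype n] [DecidableEq m] [DecidableEq n] (M₀ M₁ : Matrix m n F)
    (h : ∀ t : F, (M₀ + t • M₁).rank ≤ M₀.rank) (w : n → F) (hw : M₀ *ᵥ w = 0) :
    ∃ x : ℕ → n → F, x 0 = w ∧ ∀ i, M₀ *ᵥ x (i + 1) + M₁ *ᵥ x i = 0 := by
  obtain ⟨D, E, hDE⟩ := M₀.exists_mul_mul_eq_one
  let M : Matrix m n F[X] := M₀.map C + (X : F[X]) • M₁.map C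
  let D' : Matrix _ m F[X] := D.map C
  let E' : Matrix n _ F[X] := E.map C
  let G := D' * M * E'
  let w' : n → F[X] := fun i => C (w i)
  let x : n → F[X] := G.det • w' - E' *ᵥ (G.adjugate *ᵥ ((D' * M) *ᵥ w'))
  have evM : ∀ t, M.map (evalRingHom t) = M₀ + t • M₁ := by
    intro t; ext i j
    simpa [M] using mul_comm _ _
  have evD : ∀ t, D'.map (evalRingHom t) = D := by intro t; ext i j; simp [D']
  have evE : ∀ t, E'.map (evalRingHom t) = E := by intro t; ext i j; simp [E']
  have evG : ∀ t, G.map (evalRingHom t) = D * (M₀ + t • M₁) * E := by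
    intro t
    simp only [G, Matrix.map_mul, evM, evD, evE]
  have evdet : ∀ t, G.det.eval t = (D * (M₀ + t • M₁) * E).det := by
    intro t
    rw [← evG, ← coe_evalRingHom, RingHom.map_det]; rfl
  have det0 : G.det.eval 0 = 1 := by rw [evdet]; simp [hDE]
  have hdet : G.det ≠ 0 := fun h0 => by simp [h0] at det0
  have hDMx : (D' * M) *ᵥ x = 0 := by
    simp only [x, Matrix.mulVec_sub, Matrix.mulVec_smul]
    rw [Matrix.mulVec_mulVec, show D' * M * E' = G from rfl, Matrix.mulVec_mulVec,
      Matrix.mul_adjugate, Matrix.smul_mulVec, Matrix.one_mulVec, sub_self]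
  have hMx : M *ᵥ x = 0 := by
    ext1 i
    suffices hs : G.det * (M *ᵥ x) i = 0 from (mul_eq_zero.1 hs).resolve_left hdet
    apply Polynomial.funext
    intro t
    rw [eval_mul, eval_zero]
    by_cases ht : G.det.eval t = 0
    · rw [ht, zero_mul]
    have hr : (M₀ + t • M₁).rank ≤ (D * (M₀ + t • M₁)).rank := by
      refine (h t).trans ?_
      have h1 : (D * (M₀ + t • M₁) * E).rank = M₀.rank := by
        rw [Matrix.rank_of_isUnit _ ((Matrix.isUnit_iff_isUnit_det _).2
          (isUnit_iff_ne_zero.2 (evdet t ▸ ht))), Fintype.card_fin]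
      exact h1.symm.le.trans (Matrix.rank_mul_le_left _ _)
    have h2 : (D * (M₀ + t • M₁)) *ᵥ (evalRingHom t ∘ x) = 0 := by
      ext k
      have := congrArg (evalRingHom t) (congrFun hDMx k)
      rw [RingHom.map_mulVec, Matrix.map_mul, evM, evD] at this
      simpa using this
    have h3 := congrFun (Matrix.mulVec_eq_zero_of_rank_le _ _ hr _ h2) i
    rw [← evM t, ← RingHom.map_mulVec] at h3
    rw [← coe_evalRingHom, h3]
    simp
  refine ⟨fun k i => (x i).coeff k, ?_, ?_⟩
  · ext i
    have hDMw : (fun k => eval 0 (((D' * M) *ᵥ w') k)) = 0 := by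
      ext k
      rw [← coe_evalRingHom, RingHom.map_mulVec, Matrix.map_mul, evM, evD]
      have : (evalRingHom 0 ∘ w' : n → F) = w := by ext; simp [w']
      rw [this, ← Matrix.mulVec_mulVec]
      simp [hw]
    have h4 : eval 0 ((E' *ᵥ (G.adjugate *ᵥ ((D' * M) *ᵥ w'))) i) = 0 := by
      rw [Matrix.mulVec_mulVec, ← coe_evalRingHom, RingHom.map_mulVec]
      have : (evalRingHom (0 : F) ∘ ((D' * M) *ᵥ w')) = 0 := hDMw
      rw [this]; simp
    simp only [coeff_zero_eq_eval_zero, x, Pi.sub_apply, Pi.smul_apply, smul_eq_mul, eval_sub,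
      eval_mul, det0, h4]
    simp [w']
  · intro k
    ext i
    have h5 := congrArg (fun p => p.coeff (k + 1)) (congrFun hMx i)
    simp only [M, Matrix.add_mulVec, Matrix.smul_mulVec, Pi.add_apply, Pi.smul_apply, smul_eq_mul,
      coeff_add, coeff_X_mul, Pi.zero_apply, coeff_zero] at h5
    simpa [Matrix.mulVec, dotProduct, finsetSum_coeff] using h5

open LinearMap (BilinForm)

section Pencil

variable {V : Type*} [AddCommGroup V] [Module ℝ V]

/-- Every vector of the radical of `B` is the start of an infinite chain of the pencil; this says
that the pencil has no Jordan block at infinity. -/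
def NoJordanInfty (A B : BilinForm ℝ V) : Prop :=
  ∀ w, B w = 0 → ∃ x : ℕ → V, x 0 = w ∧ ∀ i, B (x (i + 1)) = A (x i)

/-- Every vector `u + iv` in the kernel of `A - (α + iβ) B` on the complexification is the start
of an infinite chain; this says that the pencil has no Jordan block at `α + iβ`. -/
def NoJordanAt (A B : BilinForm ℝ V) (α β : ℝ) : Prop :=
  ∀ u v, A u - α • B u + β • B v = 0 → A v - α • B v - β • B u = 0 →
    ∃ x y : ℕ → V, x 0 = u ∧ y 0 = v ∧ ∀ i,
      A (x (i + 1)) - α • B (x (i + 1)) + β • B (y (i + 1)) = B (x i) ∧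
      A (y (i + 1)) - α • B (y (i + 1)) - β • B (x (i + 1)) = B (y i)

theorem LinearMap.BilinForm.IsAlt.swap {A : BilinForm ℝ V} (hA : A.IsAlt) (x y : V) :
    A x y = -A y x :=
  (LinearMap.IsAlt.neg hA y x).symm

theorem LinearMap.BilinForm.exists_mem_eq_of_vanish [FiniteDimensional ℝ V] (A : BilinForm ℝ V)
    (W : Submodule ℝ V) (f : Module.Dual ℝ V) (hf : ∀ x, (∀ w ∈ W, A w x = 0) → f x = 0) :
    ∃ w ∈ W, A w = f := by
  have h := Subspace.dualCoannihilator_dualAnnihilator_eq (W := W.map A)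
  have : f ∈ (W.map A).dualCoannihilator.dualAnnihilator := by
    rw [Submodule.mem_dualAnnihilator]
    intro x hx
    rw [Submodule.mem_dualCoannihilator] at hx
    exact hf x fun w hw => hx _ (Submodule.mem_map_of_mem hw)
  rw [h] at this
  simpa using this

/-- If `P` and `z` are dual for `A` and `z` is isotropic, then `P` can be made isotropic by adding
combinations of the `z l`. -/
theorem LinearMap.BilinForm.exists_correction {κ : Type*} [Fintype κ] [DecidableEq κ]
    {A : BilinForm ℝ V} (hA : A.IsAlt) (P z : κ → V)
    (hPz : ∀ i j, A (P i) (z j) = if i = j then 1 else 0) (hz : ∀ i j, A (z i) (z j) = 0) :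
    ∃ s : κ → κ → ℝ, ∀ i j, A (P i + ∑ l, s i l • z l) (P j + ∑ l, s j l • z l) = 0 := by
  refine ⟨fun j i => -(1 / 2) * A (P i) (P j), fun i j => ?_⟩
  have hzP : ∀ i j, A (z i) (P j) = -if j = i then 1 else 0 := fun i j => by rw [hA.swap, hPz]
  simp only [map_add, map_sum, map_smul, LinearMap.add_apply, LinearMap.sum_apply,
    LinearMap.smul_apply, hPz, hz, hzP, smul_eq_mul]
  simp
  rw [hA.swap (P j) (P i)]
  ring

variable {A B : BilinForm ℝ V}

/-- `V'` is a complement of the radical `W` of `B` in the `A`-orthogonal of `W`. -/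
structure IsReduction (A B : BilinForm ℝ V) (V' : Submodule ℝ V) : Prop where
  alt_left : A.IsAlt
  alt_right : B.IsAlt
  noJordan : NoJordanInfty A B
  apply_eq_zero : ∀ w, B w = 0 → ∀ v ∈ V', A w v = 0
  disjoint : ∀ v ∈ V', B v = 0 → v = 0
  exists_sub : ∀ u, (∀ w, B w = 0 → A w u = 0) → ∃ v ∈ V', B (v - u) = 0

theorem NoJordanInfty.apply_radical (hB : B.IsAlt) (h : NoJordanInfty A B)
    {w w' : V} (hw : B w = 0) (hw' : B w' = 0) : A w w' = 0 := by
  obtain ⟨x, hx0, hx⟩ := h w hw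
  rw [← hx0, ← hx, hB.swap, hw']
  simp

theorem exists_isReduction [FiniteDimensional ℝ V] (hA : A.IsAlt) (hB : B.IsAlt)
    (h : NoJordanInfty A B) : ∃ V' : Submodule ℝ V, IsReduction A B V' := by
  obtain ⟨C, hC⟩ := (LinearMap.ker B).exists_isCompl
  let U : Submodule ℝ V := ((LinearMap.ker B).map A).dualCoannihilator
  have hU : ∀ u, u ∈ U ↔ ∀ w, B w = 0 → A w u = 0 := by
    intro u
    simp [U, Submodule.mem_dualCoannihilator]
  refine ⟨C ⊓ U, hA, hB, h, fun w hw v hv => (hU v).1 hv.2 w hw, fun v hv hv' => ?_, ?_⟩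
  · exact Submodule.disjoint_def.1 hC.disjoint v hv' hv.1
  · intro u hu
    obtain ⟨w, hw, c, hc, hwc⟩ := Submodule.mem_sup.1 (hC.sup_eq_top ▸ Submodule.mem_top (x := u))
    have hw : B w = 0 := hw
    refine ⟨c, ⟨hc, ?_⟩, ?_⟩
    · refine (hU c).2 ?_
      intro w' hw'
      have := hu w' hw'
      rwa [← hwc, map_add, h.apply_radical hB hw' hw, zero_add] at this
    · rw [← hwc]; simp [hw]

namespace IsReduction

variable {V' : Submodule ℝ V} (R : IsReduction A B V')
include R

theorem apply_radical {w w' : V} (hw : B w = 0) (hw' : B w' = 0) : A w w' = 0 :=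
  R.noJordan.apply_radical R.alt_right hw hw'

theorem apply_radical_right {w : V} (hw : B w = 0) (x : V) : B x w = 0 := by
  rw [R.alt_right.swap, hw]; simp

theorem eq_of_vanish [FiniteDimensional ℝ V] (f : Module.Dual ℝ V) (hf : ∀ v ∈ V', f v = 0)
    (hf' : ∀ w, B w = 0 → f w = 0) : ∃ w, B w = 0 ∧ A w = f := by
  refine A.exists_mem_eq_of_vanish (LinearMap.ker B) f fun x hx => ?_
  obtain ⟨v, hv, hvx⟩ := R.exists_sub x hx
  have := hf' _ hvx
  rw [map_sub, hf v hv] at this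
  linarith

theorem left_eq_zero {u : V} (hu : ∀ w, B w = 0 → A w u = 0) {w : V} (hw : B w = 0) :
    A u w = 0 := by
  rw [R.alt_left.swap, hu w hw, neg_zero]

theorem project {x : ℕ → V} (hx : ∀ i, ∀ w, B w = 0 → A w (x i) = 0) (v : V')
    (hv : B (v - x 0) = 0) : ∃ x' : ℕ → V', x' 0 = v ∧ ∀ i, B (x' i - x i) = 0 := by
  choose y hy hyx using fun i => R.exists_sub (x i) (hx i)
  refine ⟨fun i => Nat.casesOn i v fun j => ⟨y (j + 1), hy (j + 1)⟩, rfl, fun i => ?_⟩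
  cases i with
  | zero => exact hv
  | succ j => exact hyx (j + 1)

theorem left_apply_congr {x y : V} (h : B (x - y) = 0) (v : V') : A x v = A y v := by
  have := R.apply_eq_zero _ h v v.2
  rw [map_sub, LinearMap.sub_apply] at this
  linarith

theorem chain_orthogonal {x : ℕ → V} (hx : ∀ i, B (x (i + 1)) = A (x i)) (i : ℕ) (w : V)
    (hw : B w = 0) : A w (x i) = 0 := by
  rw [R.alt_left.swap, ← hx, R.apply_radical_right hw, neg_zero]

theorem noJordanInfty_restrict [FiniteDimensional ℝ V] :
    NoJordanInfty (A.restrict V') (B.restrict V') := by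
  intro v hv
  have hv' : ∀ s : V', B v s = 0 := fun s => by
    simpa using LinearMap.congr_fun hv s
  obtain ⟨w, hw, hwv⟩ := R.eq_of_vanish (B v) (fun s hs => hv' ⟨s, hs⟩)
    fun w hw => R.apply_radical_right hw _
  obtain ⟨x, hx0, hx⟩ := R.noJordan w hw
  obtain ⟨x', hx'0, hx'⟩ := R.project (x := fun i => x (i + 1))
    (fun i => R.chain_orthogonal hx _) v (by rw [map_sub, hx, hx0, hwv, sub_self])
  refine ⟨x', hx'0, fun i => ?_⟩
  ext s
  have h1 := hx' (i + 1)
  rw [map_sub, sub_eq_zero] at h1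
  simpa [h1, hx (i + 1)] using (R.left_apply_congr (hx' i) s).symm

theorem noJordanAt_restrict [FiniteDimensional ℝ V] {α β : ℝ} (h : NoJordanAt A B α β) :
    NoJordanAt (A.restrict V') (B.restrict V') α β := by
  intro u v hu hv
  have hu' : ∀ s : V', (A u - α • B u + β • B v) s = 0 := fun s => by
    simpa using LinearMap.congr_fun hu s
  have hv' : ∀ s : V', (A v - α • B v - β • B u) s = 0 := fun s => by
    simpa using LinearMap.congr_fun hv s
  have hBw {w : V} (hw : B w = 0) (x : V) : B x w = 0 := R.apply_radical_right hw x
  have hAw {w : V} (hw : B w = 0) (s : V') : A s w = 0 :=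
    R.left_eq_zero (fun w hw => R.apply_eq_zero w hw s s.2) hw
  obtain ⟨w, hw, hwu⟩ := R.eq_of_vanish _ (fun s hs => hu' ⟨s, hs⟩)
    (fun w hw => by simp [hBw hw, hAw hw])
  obtain ⟨z, hz, hzv⟩ := R.eq_of_vanish _ (fun s hs => hv' ⟨s, hs⟩)
    (fun w hw => by simp [hBw hw, hAw hw])
  obtain ⟨x, y, hx0, hy0, hxy⟩ := h (u - w) (v - z)
    (by simp only [map_sub, hw, hz, hwu]; module)
    (by simp only [map_sub, hw, hz, hzv]; module)
  have hx : ∀ i, ∀ w, B w = 0 → A w (x i) = 0 := by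
    rintro (_ | i) w' hw'
    · rw [hx0, map_sub, R.apply_eq_zero _ hw' u u.2, R.apply_radical hw' hw, sub_zero]
    · have := LinearMap.congr_fun (hxy i).1 w'
      simp only [LinearMap.sub_apply, LinearMap.add_apply, LinearMap.smul_apply, hBw hw'] at this
      rw [R.alt_left.swap]
      simpa using this
  have hy : ∀ i, ∀ w, B w = 0 → A w (y i) = 0 := by
    rintro (_ | i) w' hw'
    · rw [hy0, map_sub, R.apply_eq_zero _ hw' v v.2, R.apply_radical hw' hz, sub_zero]
    · have := LinearMap.congr_fun (hxy i).2 w'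
      simp only [LinearMap.sub_apply, LinearMap.smul_apply, hBw hw'] at this
      rw [R.alt_left.swap]
      simpa using this
  obtain ⟨x', hx'0, hx'⟩ := R.project hx u (by simp [hx0, hw])
  obtain ⟨y', hy'0, hy'⟩ := R.project hy v (by simp [hy0, hz])
  have hBx : ∀ i, B (x' i) = B (x i) := fun i => by
    have := hx' i
    rwa [map_sub, sub_eq_zero] at this
  have hBy : ∀ i, B (y' i) = B (y i) := fun i => by
    have := hy' i
    rwa [map_sub, sub_eq_zero] at this
  refine ⟨x', y', hx'0, hy'0, fun i => ⟨?_, ?_⟩⟩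
  · ext s
    have := LinearMap.congr_fun (hxy i).1 s
    simpa [hBx, hBy, R.left_apply_congr (hx' _) s] using this
  · ext s
    have := LinearMap.congr_fun (hxy i).2 s
    simpa [hBx, hBy, R.left_apply_congr (hy' _) s] using this

end IsReduction

end Pencil

/-- The basis `b` brings the pair of forms `(A, B)` to a sum of Kronecker blocks. -/
structure IsKronecker {V : Type*} [AddCommGroup V] [Module ℝ V] (A B : BilinForm ℝ V)
    {κ : Type*} [DecidableEq κ] (n : κ → ℕ)
    (b : (Σ j : κ, Fin (n j) ⊕ Fin (n j + 1)) → V) : Prop where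
  left_inl_inl : ∀ j i l m, A (b ⟨j, .inl i⟩) (b ⟨l, .inl m⟩) = 0
  right_inl_inl : ∀ j i l m, B (b ⟨j, .inl i⟩) (b ⟨l, .inl m⟩) = 0
  left_inr_inr : ∀ j i l m, A (b ⟨j, .inr i⟩) (b ⟨l, .inr m⟩) = 0
  right_inr_inr : ∀ j i l m, B (b ⟨j, .inr i⟩) (b ⟨l, .inr m⟩) = 0
  left_inl_inr : ∀ j i l m,
    A (b ⟨j, .inl i⟩) (b ⟨l, .inr m⟩) = if j = l ∧ (m : ℕ) = i then 1 else 0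
  right_inl_inr : ∀ j i l m,
    B (b ⟨j, .inl i⟩) (b ⟨l, .inr m⟩) = if j = l ∧ (m : ℕ) = i + 1 then 1 else 0

namespace IsKronecker

variable {V : Type*} [AddCommGroup V] [Module ℝ V] {A B : BilinForm ℝ V}
  {κ : Type*} [DecidableEq κ] {n : κ → ℕ}
  {b : Module.Basis (Σ j : κ, Fin (n j) ⊕ Fin (n j + 1)) ℝ V}

omit [DecidableEq κ] in
theorem repr_inl_apply_inr (j l : κ) (i : Fin (n j)) (m : Fin (n l + 1)) :
    b.repr (b ⟨j, .inl i⟩) ⟨l, .inr m⟩ = 0 := by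
  rw [b.repr_self, Finsupp.single_eq_of_ne (by rintro ⟨⟩)]

theorem repr_inr_apply_inr (j l : κ) (i : Fin (n j + 1)) (m : Fin (n l + 1)) :
    b.repr (b ⟨j, .inr i⟩) ⟨l, .inr m⟩ = if j = l ∧ (i : ℕ) = m then 1 else 0 := by
  by_cases h : j = l
  · subst h
    simp [Finsupp.single_apply, Fin.ext_iff]
  · simp [h]

theorem right_inr_zero (K : IsKronecker A B n b) (hB : B.IsAlt) (j : κ) :
    B (b ⟨j, .inr 0⟩) = 0 := by
  refine b.ext ?_
  rintro ⟨l, m | m⟩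
  · rw [hB.swap, K.right_inl_inr]; simp
  · rw [K.right_inr_inr]; rfl

theorem coord_inl (K : IsKronecker A B n b) (l : κ) (i : Fin (n l)) (v : V) :
    b.repr v ⟨l, .inl i⟩ = B v (b ⟨l, .inr i.succ⟩) := by
  suffices h : b.coord ⟨l, .inl i⟩ = LinearMap.flip B (b ⟨l, .inr i.succ⟩) from
    LinearMap.congr_fun h v
  refine b.ext ?_
  rintro ⟨j, m | m⟩
  · rw [LinearMap.flip_apply, K.right_inl_inr]
    by_cases h : j = l
    · subst h
      simp [Finsupp.single_apply, Fin.ext_iff, eq_comm]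
    · simp [h]
  · rw [LinearMap.flip_apply, K.right_inr_inr]
    rw [b.coord_apply, b.repr_self, Finsupp.single_eq_of_ne (by rintro ⟨⟩)]

theorem coord_inr_succ (K : IsKronecker A B n b) (hB : B.IsAlt) (l : κ) (i : Fin (n l)) (v : V) :
    b.repr v ⟨l, .inr i.succ⟩ = - B v (b ⟨l, .inl i⟩) := by
  rw [hB.swap, neg_neg]
  suffices h : b.coord ⟨l, .inr i.succ⟩ = B (b ⟨l, .inl i⟩) from LinearMap.congr_fun h v
  refine b.ext ?_
  rintro ⟨j, m | m⟩
  · rw [K.right_inl_inl, b.coord_apply, repr_inl_apply_inr]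
  · rw [K.right_inl_inr, b.coord_apply, repr_inr_apply_inr, Fin.val_succ]
    simp only [eq_comm]

theorem eq_sum_of_right_eq_zero [Fintype κ] (K : IsKronecker A B n b) (hB : B.IsAlt) (v : V)
    (hv : B v = 0) : v = ∑ l, b.repr v ⟨l, .inr 0⟩ • b ⟨l, .inr 0⟩ := by
  conv_lhs => rw [← b.sum_repr v]
  simp only [Fintype.sum_sigma, Fintype.sum_sum_type, Fin.sum_univ_succ, K.coord_inl,
    K.coord_inr_succ hB, hv]
  simp

end IsKronecker

namespace IsReduction

variable {V : Type*} [AddCommGroup V] [Module ℝ V] [FiniteDimensional ℝ V] {A B : BilinForm ℝ V}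
  {V' : Submodule ℝ V} (R : IsReduction A B V') {κ : Type*} [Fintype κ] [DecidableEq κ]
  {n : κ → ℕ} {b : Module.Basis (Σ j : κ, Fin (n j) ⊕ Fin (n j + 1)) ℝ V'}
  (K : IsKronecker (A.restrict V') (B.restrict V') n b)
include R

theorem exists_right_eq (f : Module.Dual ℝ V') : ∃ x, ∀ v : V', B x v = f v := by
  have hinj : Function.Injective (B.domRestrict V') := by
    rw [← LinearMap.ker_eq_bot, LinearMap.ker_eq_bot']
    exact fun v hv => Subtype.ext (R.disjoint v v.2 hv)
  obtain ⟨F, hF⟩ := LinearMap.dualMap_surjective_of_injective hinj f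
  obtain ⟨x, rfl⟩ := (Module.evalEquiv ℝ V).surjective F
  refine ⟨-x, fun v => ?_⟩
  rw [← hF, map_neg, LinearMap.neg_apply, R.alt_right.swap, neg_neg]
  rfl

omit [FiniteDimensional ℝ V] in
theorem alt_restrict : (A.restrict V').IsAlt ∧ (B.restrict V').IsAlt :=
  ⟨fun v => R.alt_left v, fun v => R.alt_right v⟩

include K

omit [FiniteDimensional ℝ V] [Fintype κ] in
theorem right_inr_zero_apply (j : κ) (v : V') : B (b ⟨j, .inr 0⟩ : V') v = 0 := by
  simpa using LinearMap.congr_fun (K.right_inr_zero R.alt_restrict.2 j) v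

/-- The new vectors which extend a Kronecker basis of a reduction: `P j` and `w j` are to be put in
front of the two families of vectors of the block `j`. -/
theorem exists_new_vectors : ∃ P w : κ → V,
    (∀ j v, B (P j) (v : V') = b.repr v ⟨j, .inr 0⟩) ∧ (∀ i j, B (P i) (P j) = 0) ∧
    (∀ i j, A (P i) (P j) = 0) ∧ (∀ i j, A (P i) (w j) = if i = j then 1 else 0) ∧
    (∀ j, B (w j) = 0) := by
  let z : κ → V := fun j => (b ⟨j, .inr 0⟩ : V')
  have hz : ∀ j (v : V'), B (z j) v = 0 := R.right_inr_zero_apply K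
  choose P₀ hP₀ using fun j => R.exists_right_eq (b.coord ⟨j, .inr 0⟩)
  obtain ⟨s, hs⟩ := BilinForm.exists_correction R.alt_right P₀ z
    (fun i j => by
      rw [hP₀, b.coord_apply, IsKronecker.repr_inr_apply_inr]
      simp [eq_comm])
    (fun i j => hz i _)
  set P₁ : κ → V := fun i => P₀ i + ∑ l, s i l • z l with hP₁_def
  have hP₁ : ∀ j (v : V'), B (P₁ j) v = b.repr v ⟨j, .inr 0⟩ := by
    intro j v
    simp [hP₁_def, hz, hP₀]
  choose w hw hAw using fun j => R.eq_of_vanish (B (z j)) (fun v hv => hz j ⟨v, hv⟩)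
    (fun w hw => R.apply_radical_right hw _)
  have hP₁w : ∀ i j, A (P₁ i) (w j) = if i = j then 1 else 0 := by
    intro i j
    rw [R.alt_left.swap, hAw, R.alt_right.swap, neg_neg, hP₁,
      IsKronecker.repr_inr_apply_inr]
    simp [eq_comm]
  obtain ⟨r, hr⟩ := BilinForm.exists_correction R.alt_left P₁ w hP₁w
    (fun i j => R.apply_radical (hw i) (hw j))
  refine ⟨fun i => P₁ i + ∑ l, r i l • w l, w, fun j v => ?_, fun i j => ?_, hr, fun i j => ?_, hw⟩
  · simp [hw, hP₁]
  · simp only [map_add, map_sum, map_smul, LinearMap.add_apply, LinearMap.sum_apply,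
      LinearMap.smul_apply, hw, R.apply_radical_right (hw _)]
    simpa only [LinearMap.zero_apply, smul_zero, Finset.sum_const_zero, add_zero] using hs i j
  · simp [hP₁w, R.apply_radical (hw _) (hw _)]

/-- A Kronecker basis of a reduction yields one of the whole space: every block grows by one, and
the common radical contributes blocks of dimension one. -/
theorem exists_isKronecker : ∃ (d : ℕ)
    (b' : Module.Basis (Σ j : κ ⊕ Fin d, Fin (Sum.elim (fun j => n j + 1) (fun _ => 0) j) ⊕
      Fin (Sum.elim (fun j => n j + 1) (fun _ => 0) j + 1)) ℝ V),
    IsKronecker A B (Sum.elim (fun j => n j + 1) (fun _ => 0)) b' := by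
  obtain ⟨P, w, hBP, hBPP, hAPP, hAPw, hBw⟩ := R.exists_new_vectors K
  let W₀ : Submodule ℝ V := LinearMap.ker A ⊓ LinearMap.ker B
  let e := Module.finBasis ℝ W₀
  have hAe : ∀ a, A (e a) = 0 := fun a => (e a).2.1
  have hBe : ∀ a, B (e a) = 0 := fun a => (e a).2.2
  have hAe' : ∀ x a, A x (e a) = 0 := fun x a => by rw [R.alt_left.swap, hAe]; simp
  have hBe' : ∀ x a, B x (e a) = 0 := fun x a => R.apply_radical_right (hBe a) x
  have hBw' : ∀ x j, B x (w j) = 0 := fun x j => R.apply_radical_right (hBw j) x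
  have hAww : ∀ i j, A (w i) (w j) = 0 := fun i j => R.apply_radical (hBw i) (hBw j)
  have hAwv : ∀ j (v : V'), A (w j) v = 0 := fun j v => R.apply_eq_zero _ (hBw j) v v.2
  have hAvw : ∀ j (v : V'), A v (w j) = 0 := fun j v => by rw [R.alt_left.swap, hAwv, neg_zero]
  have hAwP : ∀ i j, A (w i) (P j) = -if j = i then 1 else 0 := fun i j => by
    rw [R.alt_left.swap, hAPw]
  let τ : V' →ₗ[ℝ] V := V'.subtype - ∑ j, ((A (P j)).domRestrict V').smulRight (w j)
  have hτ : ∀ v, τ v = v - ∑ j, A (P j) v • w j := fun v => by simp [τ]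
  have hAPτ : ∀ i v, A (P i) (τ v) = 0 := fun i v => by simp [hτ, hAPw]
  have hAτP : ∀ i v, A (τ v) (P i) = 0 := fun i v => by rw [R.alt_left.swap, hAPτ, neg_zero]
  have hBτ : ∀ v, B (τ v) = B v := fun v => by simp [hτ, hBw]
  have hBτ' : ∀ x v, B x (τ v) = B x v := fun x v => by simp [hτ, hBw']
  have hAτ : ∀ v v', A (τ v) (τ v') = A v v' := fun v v' => by
    simp [hτ, hAww, hAwv, hAvw]
  have hAwτ : ∀ j v, A (w j) (τ v) = 0 := fun j v => by simp [hτ, hAww, hAwv]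
  have hAτw : ∀ j v, A (τ v) (w j) = 0 := fun j v => by rw [R.alt_left.swap, hAwτ, neg_zero]
  have hBvP : ∀ j (v : V'), B v (P j) = - b.repr v ⟨j, .inr 0⟩ := fun j v => by
    rw [R.alt_right.swap, hBP]
  let n' : κ ⊕ Fin (Module.finrank ℝ W₀) → ℕ := Sum.elim (fun j => n j + 1) (fun _ => 0)
  let f : (Σ j, Fin (n' j) ⊕ Fin (n' j + 1)) → V := fun
    | ⟨.inl j, .inl i⟩ => Fin.cases (motive := fun _ => V) (P j) (fun i => τ (b ⟨j, .inl i⟩)) i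
    | ⟨.inl j, .inr i⟩ => Fin.cases (motive := fun _ => V) (w j) (fun i => τ (b ⟨j, .inr i⟩)) i
    | ⟨.inr _, .inl i⟩ => i.elim0
    | ⟨.inr a, .inr _⟩ => e a
  have hsum : ∀ g : (Σ j, Fin (n' j) ⊕ Fin (n' j + 1)) → ℝ, ∑ s, g s • f s =
      ∑ j, g ⟨.inl j, .inl (0 : Fin (n j + 1))⟩ • P j +
      ∑ j, g ⟨.inl j, .inr (0 : Fin (n j + 2))⟩ • w j +
      τ (∑ j, (∑ i : Fin (n j), g ⟨.inl j, .inl (i.succ : Fin (n j + 1))⟩ • b ⟨j, .inl i⟩ +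
        ∑ i : Fin (n j + 1), g ⟨.inl j, .inr (i.succ : Fin (n j + 2))⟩ • b ⟨j, .inr i⟩)) +
      ∑ a, g ⟨.inr a, .inr (0 : Fin 1)⟩ • (e a : V) := by
    intro g
    rw [Fintype.sum_sigma, Fintype.sum_sum_type]
    simp only [Fintype.sum_sum_type]
    have h1 : ∀ j : κ, ∑ i : Fin (n' (.inl j)), g ⟨.inl j, .inl i⟩ • f ⟨.inl j, .inl i⟩ =
        g ⟨.inl j, .inl (0 : Fin (n j + 1))⟩ • P j +
        ∑ i : Fin (n j), g ⟨.inl j, .inl (i.succ : Fin (n j + 1))⟩ • τ (b ⟨j, .inl i⟩) :=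
      fun j => Fin.sum_univ_succ (n := n j) _
    have h2 : ∀ j : κ, ∑ i : Fin (n' (.inl j) + 1), g ⟨.inl j, .inr i⟩ • f ⟨.inl j, .inr i⟩ =
        g ⟨.inl j, .inr (0 : Fin (n j + 2))⟩ • w j +
        ∑ i : Fin (n j + 1), g ⟨.inl j, .inr (i.succ : Fin (n j + 2))⟩ • τ (b ⟨j, .inr i⟩) :=
      fun j => Fin.sum_univ_succ (n := n j + 1) _
    have h3 : ∀ a, ∑ i : Fin (n' (.inr a)), g ⟨.inr a, .inl i⟩ • f ⟨.inr a, .inl i⟩ = 0 :=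
      fun a => Fin.sum_univ_zero _
    have h4 : ∀ a, ∑ i : Fin (n' (.inr a) + 1), g ⟨.inr a, .inr i⟩ • f ⟨.inr a, .inr i⟩ =
        g ⟨.inr a, .inr (0 : Fin 1)⟩ • (e a : V) :=
      fun a => Fin.sum_univ_one _
    simp only [h1, h2, h3, h4, map_sum, map_add, map_smul, Finset.sum_add_distrib]
    simp only [Finset.sum_const_zero, zero_add]
    abel
  have hBz := R.right_inr_zero_apply K
  have hli : LinearIndependent ℝ f := by
    rw [Fintype.linearIndependent_iff]
    intro g hg
    rw [hsum] at hg
    set u : V' := ∑ j, (∑ i : Fin (n j), g ⟨.inl j, .inl (i.succ : Fin (n j + 1))⟩ • b ⟨j, .inl i⟩ +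
        ∑ i : Fin (n j + 1), g ⟨.inl j, .inr (i.succ : Fin (n j + 2))⟩ • b ⟨j, .inr i⟩) with hu
    have hgP : ∀ l, g ⟨.inl l, .inl (0 : Fin (n l + 1))⟩ = 0 := by
      intro l
      have hBPz : ∀ j, B (P j) (b ⟨l, .inr 0⟩ : V') = if j = l then 1 else 0 := fun j => by
        rw [hBP, IsKronecker.repr_inr_apply_inr]
        simp [eq_comm]
      have hBuz : B u (b ⟨l, .inr 0⟩ : V') = 0 := by rw [R.alt_right.swap, hBz, neg_zero]
      have h := congrArg (fun x => B x (b ⟨l, .inr 0⟩ : V')) hg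
      simpa [hBPz, hBw, hBτ, hBe, hBuz] using h
    have hgw : ∀ l, g ⟨.inl l, .inr (0 : Fin (n l + 2))⟩ = 0 := by
      intro l
      have h := congrArg (A (P l)) hg
      simpa [hAPP, hAPw, hAPτ, hAe'] using h
    simp only [hgP, hgw, zero_smul, Finset.sum_const_zero, zero_add] at hg
    have hu0 : u = 0 := by
      have h := congrArg B hg
      simp only [map_add, hBτ, map_sum, map_smul, hBe, smul_zero, Finset.sum_const_zero, add_zero,
        map_zero] at h
      exact Subtype.ext (R.disjoint u u.2 h)
    rw [hu0, map_zero, zero_add] at hg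
    have hge := Fintype.linearIndependent_iff.1 e.linearIndependent
      (fun a => g ⟨.inr a, .inr (0 : Fin 1)⟩) (Subtype.ext (by simpa using hg))
    let g' : (Σ j : κ, Fin (n j) ⊕ Fin (n j + 1)) → ℝ := fun
      | ⟨j, .inl i⟩ => g ⟨.inl j, .inl (i.succ : Fin (n j + 1))⟩
      | ⟨j, .inr i⟩ => g ⟨.inl j, .inr (i.succ : Fin (n j + 2))⟩
    have hgb := Fintype.linearIndependent_iff.1 b.linearIndependent g' (by
      rw [Fintype.sum_sigma]
      simp only [Fintype.sum_sum_type]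
      rw [← hu0, hu])
    rintro ⟨j | a, i | i⟩
    · refine Fin.cases (n := n j) (hgP j) (fun i => hgb ⟨j, .inl i⟩) i
    · refine Fin.cases (n := n j + 1) (hgw j) (fun i => hgb ⟨j, .inr i⟩) i
    · exact i.elim0
    · rw [show i = (0 : Fin 1) from Subsingleton.elim (α := Fin 1) _ _]
      exact hge a
  have hdecomp : ∀ x : V, ∀ w₀, B w₀ = 0 →
      A w₀ (x - ∑ j, B x (b ⟨j, .inr 0⟩ : V') • P j) = 0 := by
    intro x w₀ hw₀
    obtain ⟨c, hc0, hc⟩ := R.noJordan w₀ hw₀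
    obtain ⟨v, hv, hvc⟩ := R.exists_sub (c 1) (R.chain_orthogonal hc 1)
    rw [map_sub, hc 0, hc0, sub_eq_zero] at hvc
    have hker := K.eq_sum_of_right_eq_zero R.alt_restrict.2 ⟨v, hv⟩ (by
      ext s
      simpa [hvc] using R.apply_eq_zero _ hw₀ s s.2)
    have hv' := congrArg V'.subtype hker
    simp only [map_sum, map_smul, Submodule.subtype_apply] at hv'
    rw [← hvc, hv']
    have hzP : ∀ l j, B (b ⟨l, .inr 0⟩ : V') (P j) = -if j = l then 1 else 0 := fun l j => by
      rw [hBvP, IsKronecker.repr_inr_apply_inr]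
      simp [eq_comm]
    have hxz : ∀ l, B x (b ⟨l, .inr 0⟩ : V') = -B (b ⟨l, .inr 0⟩ : V') x :=
      fun l => R.alt_right.swap _ _
    simp only [map_sum, map_smul, LinearMap.sum_apply,
      LinearMap.smul_apply, map_sub, hzP, hxz]
    simp [mul_comm]
  have hspan : ⊤ ≤ Submodule.span ℝ (Set.range f) := by
    intro x _
    obtain ⟨v, hv, hvx⟩ := R.exists_sub _ (hdecomp x)
    set c : κ → ℝ := fun j => B x (b ⟨j, .inr 0⟩ : V') with hc
    set z := x - ∑ j, c j • P j - τ ⟨v, hv⟩ with hz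
    have hBz : B z = 0 := by
      rw [hz, map_sub, hBτ, ← neg_eq_zero, neg_sub, ← map_sub, hvx]
    set z₀ := z - ∑ j, A (P j) z • w j with hz₀
    have hBz₀ : B z₀ = 0 := by simp [hz₀, hBz, hBw]
    have hAz₀ : A z₀ = 0 := by
      ext y
      have h := hdecomp y z₀ hBz₀
      have hP : ∀ l, A z₀ (P l) = 0 := by
        intro l
        rw [R.alt_left.swap, hz₀]
        simp [hAPw]
      simpa [hP] using h
    let z' : W₀ := ⟨z₀, hAz₀, hBz₀⟩
    let g : (Σ j, Fin (n' j) ⊕ Fin (n' j + 1)) → ℝ := fun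
      | ⟨.inl j, .inl i⟩ => Fin.cases (motive := fun _ => ℝ) (c j)
          (fun i => b.repr ⟨v, hv⟩ ⟨j, .inl i⟩) i
      | ⟨.inl j, .inr i⟩ => Fin.cases (motive := fun _ => ℝ) (A (P j) z)
          (fun i => b.repr ⟨v, hv⟩ ⟨j, .inr i⟩) i
      | ⟨.inr _, .inl _⟩ => 0
      | ⟨.inr a, .inr _⟩ => e.repr z' a
    have hgx : ∑ s, g s • f s = x := by
      rw [hsum]
      have h1 : ∑ a, e.repr z' a • (e a : V) = z₀ := by
        have := congrArg W₀.subtype (e.sum_repr z')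
        simpa only [map_sum, map_smul, Submodule.subtype_apply] using this
      have h2 : ∑ j, (∑ i : Fin (n j), b.repr ⟨v, hv⟩ ⟨j, .inl i⟩ • b ⟨j, .inl i⟩ +
          ∑ i : Fin (n j + 1), b.repr ⟨v, hv⟩ ⟨j, .inr i⟩ • b ⟨j, .inr i⟩) = ⟨v, hv⟩ := by
        conv_rhs => rw [← b.sum_repr ⟨v, hv⟩]
        rw [Fintype.sum_sigma]
        simp only [Fintype.sum_sum_type]
      change ∑ j, c j • P j + ∑ j, A (P j) z • w j +
        τ (∑ j, (∑ i : Fin (n j), b.repr ⟨v, hv⟩ ⟨j, .inl i⟩ • b ⟨j, .inl i⟩ +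
          ∑ i : Fin (n j + 1), b.repr ⟨v, hv⟩ ⟨j, .inr i⟩ • b ⟨j, .inr i⟩)) +
        ∑ a, e.repr z' a • (e a : V) = x
      rw [h1, h2, hz₀]
      rw [hz]
      abel
    rw [← hgx]
    exact Submodule.sum_mem _ fun s _ => Submodule.smul_mem _ _ (Submodule.subset_span ⟨s, rfl⟩)
  refine ⟨Module.finrank ℝ W₀, Module.Basis.mk hli hspan, ?_⟩
  rw [Module.Basis.coe_mk]
  have KA : ∀ s t, A (b s : V) (b t : V) = (A.restrict V') (b s) (b t) := fun s t => rfl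
  have KB : ∀ s t, B (b s : V) (b t : V) = (B.restrict V') (b s) (b t) := fun s t => rfl
  constructor
  · rintro (j | a) i (l | c) m
    · refine Fin.cases (n := n j) ?_ (fun i => ?_) i <;>
      refine Fin.cases (n := n l) ?_ (fun m => ?_) m
      · exact hAPP j l
      · exact hAPτ j _
      · exact hAτP l _
      · exact (hAτ _ _).trans (K.left_inl_inl ..)
    · exact m.elim0
    · exact i.elim0
    · exact i.elim0
  · rintro (j | a) i (l | c) m
    · refine Fin.cases (n := n j) ?_ (fun i => ?_) i <;>
      refine Fin.cases (n := n l) ?_ (fun m => ?_) m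
      · exact hBPP j l
      · change B (P j) (τ _) = 0
        rw [hBτ', hBP, IsKronecker.repr_inl_apply_inr]
      · change B (τ _) (P l) = 0
        rw [hBτ, hBvP, IsKronecker.repr_inl_apply_inr, neg_zero]
      · change B (τ _) (τ _) = 0
        rw [hBτ, hBτ', KB, K.right_inl_inl]
    · exact m.elim0
    · exact i.elim0
    · exact i.elim0
  · rintro (j | a) i (l | c) m
    · refine Fin.cases (n := n j + 1) ?_ (fun i => ?_) i <;>
      refine Fin.cases (n := n l + 1) ?_ (fun m => ?_) m
      · exact hAww j l
      · exact hAwτ j _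
      · exact hAτw l _
      · exact (hAτ _ _).trans (K.left_inr_inr ..)
    · exact hAe' _ _
    · exact LinearMap.congr_fun (hAe a) _
    · exact LinearMap.congr_fun (hAe a) _
  · rintro (j | a) i (l | c) m
    · refine Fin.cases (n := n j + 1) ?_ (fun i => ?_) i <;>
      refine Fin.cases (n := n l + 1) ?_ (fun m => ?_) m
      · exact hBw' _ l
      · exact LinearMap.congr_fun (hBw j) _
      · exact hBw' _ l
      · change B (τ _) (τ _) = 0
        rw [hBτ, hBτ', KB, K.right_inr_inr]
    · exact hBe' _ _
    · exact LinearMap.congr_fun (hBe a) _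
    · exact LinearMap.congr_fun (hBe a) _
  · rintro (j | a) i (l | c) m
    · refine Fin.cases (n := n j) ?_ (fun i => ?_) i <;>
      refine Fin.cases (n := n l + 1) ?_ (fun m => ?_) m
      · change A (P j) (w l) = _
        rw [hAPw]
        simp
      · change A (P j) (τ _) = _
        rw [hAPτ]
        simp
      · change A (τ _) (w l) = _
        rw [hAτw]
        simp
      · change A (τ _) (τ _) = _
        rw [hAτ, KA, K.left_inl_inr]
        simp
    · rw [if_neg (by simp)]
      exact hAe' _ _
    · exact i.elim0
    · exact i.elim0
  · rintro (j | a) i (l | c) m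
    · refine Fin.cases (n := n j) ?_ (fun i => ?_) i <;>
      refine Fin.cases (n := n l + 1) ?_ (fun m => ?_) m
      · change B (P j) (w l) = _
        rw [hBw']
        simp
      · change B (P j) (τ _) = _
        rw [hBτ', hBP, IsKronecker.repr_inr_apply_inr]
        simp [eq_comm]
      · change B (τ _) (w l) = _
        rw [hBw']
        simp
      · change B (τ _) (τ _) = _
        rw [hBτ, hBτ', KB, K.right_inl_inr]
        simp
    · rw [if_neg (by simp)]
      exact hBe' _ _
    · exact i.elim0
    · exact i.elim0

end IsReduction

theorem Matrix.map_ofReal_mulVec_re {m n : Type*} [Fintype n] (M : Matrix m n ℝ) (z : n → ℂ)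
    (i : m) : ((M.map Complex.ofReal *ᵥ z) i).re = (M *ᵥ fun j => (z j).re) i := by
  simp [mulVec, dotProduct]

theorem Matrix.map_ofReal_mulVec_im {m n : Type*} [Fintype n] (M : Matrix m n ℝ) (z : n → ℂ)
    (i : m) : ((M.map Complex.ofReal *ᵥ z) i).im = (M *ᵥ fun j => (z j).im) i := by
  simp [mulVec, dotProduct]

section Main

variable {V : Type*} [AddCommGroup V] [Module ℝ V] [FiniteDimensional ℝ V]

/-- A real endomorphism has a complex eigenvector `u + iv`, here split into real and imaginary
parts. -/
theorem Module.End.exists_complex_eigenvector [Nontrivial V] (T : Module.End ℝ V) :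
    ∃ (α β : ℝ) (u v : V), (u, v) ≠ 0 ∧ T u = α • u - β • v ∧ T v = α • v + β • u := by
  let b := Module.finBasis ℝ V
  have : Nonempty (Fin (Module.finrank ℝ V)) := ⟨⟨0, Module.finrank_pos⟩⟩
  let M := LinearMap.toMatrix b b T
  obtain ⟨μ, hμ⟩ := Module.End.exists_eigenvalue (Matrix.toLin' (M.map Complex.ofReal))
  obtain ⟨z, hz⟩ := hμ.exists_hasEigenvector
  have hMz : M.map Complex.ofReal *ᵥ z = μ • z := by
    simpa using hz.apply_eq_smul
  have hT : ∀ x, b.equivFun (T (b.equivFun.symm x)) = M *ᵥ x := fun x => by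
    have := LinearMap.toMatrix_mulVec_repr b b T (b.equivFun.symm x)
    rw [← b.equivFun_apply, b.equivFun.apply_symm_apply] at this
    exact this.symm
  refine ⟨μ.re, μ.im, b.equivFun.symm fun i => (z i).re, b.equivFun.symm fun i => (z i).im,
    fun h => hz.2 ?_, b.equivFun.injective ?_, b.equivFun.injective ?_⟩
  · rw [Prod.mk_eq_zero, LinearEquiv.map_eq_zero_iff, LinearEquiv.map_eq_zero_iff] at h
    exact funext fun i => Complex.ext (congrFun h.1 i) (congrFun h.2 i)
  · rw [hT]
    ext i
    rw [← Matrix.map_ofReal_mulVec_re, hMz]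
    simp only [map_sub, map_smul, LinearEquiv.apply_symm_apply]
    simp
  · rw [hT]
    ext i
    rw [← Matrix.map_ofReal_mulVec_im, hMz]
    simp only [map_add, map_smul, LinearEquiv.apply_symm_apply]
    simp

/-- In finite dimension, an infinite chain of an endomorphism which ends in the kernel is trivial. -/
theorem Module.End.eq_zero_of_chain {K E : Type*} [Field K] [AddCommGroup E] [Module K E]
    [FiniteDimensional K E] (S : Module.End K E) (z : ℕ → E) (h0 : S (z 0) = 0)
    (h : ∀ i, S (z (i + 1)) = z i) : z 0 = 0 := by
  have hpow : ∀ i, (S ^ i) (z i) = z 0 := by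
    intro i
    induction i with
    | zero => simp
    | succ i ih => rw [pow_succ, Module.End.mul_apply, h, ih]
  set d := Module.finrank K E
  have hmem : z d ∈ LinearMap.ker (S ^ (d + 1)) := by
    rw [LinearMap.mem_ker, pow_succ', Module.End.mul_apply, hpow, h0]
  rw [Module.End.ker_pow_eq_ker_pow_finrank_of_le d.le_succ, LinearMap.mem_ker, hpow] at hmem
  exact hmem

variable {A B : BilinForm ℝ V}

theorem exists_radical_ne_zero [Nontrivial V] (h : ∀ α β, NoJordanAt A B α β) :
    LinearMap.ker B ≠ ⊥ := by
  intro hB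
  let e : V ≃ₗ[ℝ] Module.Dual ℝ V := LinearEquiv.ofInjectiveOfFinrankEq B
    (LinearMap.ker_eq_bot.1 hB) Subspace.dual_finrank_eq.symm
  let T : Module.End ℝ V := e.symm.toLinearMap ∘ₗ A
  have hT : ∀ x, A x = B (T x) := fun x => (e.apply_symm_apply (A x)).symm
  have hinj {x y : V} (hxy : B x = B y) : x = y := LinearMap.ker_eq_bot.1 hB hxy
  obtain ⟨α, β, u, v, huv, hu, hv⟩ := T.exists_complex_eigenvector
  obtain ⟨x, y, rfl, rfl, hxy⟩ := h α β u v
    (by rw [hT, hu]; simp only [map_sub, map_smul]; abel)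
    (by rw [hT, hv]; simp only [map_add, map_smul]; abel)
  let S : Module.End ℝ (V × V) :=
    ((T - α • 1).coprod (β • 1)).prod ((-β • (1 : Module.End ℝ V)).coprod (T - α • 1))
  have hS : ∀ a b, S (a, b) = (T a - α • a + β • b, T b - α • b - β • a) := fun a b => by
    ext <;> simp [S]; abel
  refine huv (S.eq_zero_of_chain (fun i => (x i, y i)) ?_ fun i => ?_)
  · rw [hS, hu, hv]
    ext <;> simp
  · rw [hS]
    refine Prod.ext (hinj ?_) (hinj ?_)
    · simpa [hT] using (hxy i).1
    · simpa [hT] using (hxy i).2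

/-- A pair of alternating forms without Jordan blocks has a Kronecker basis. -/
theorem exists_isKronecker (hA : A.IsAlt) (hB : B.IsAlt) (hinf : NoJordanInfty A B)
    (h : ∀ α β, NoJordanAt A B α β) :
    ∃ (κ : Type) (_ : Fintype κ) (_ : DecidableEq κ) (n : κ → ℕ)
      (b : Module.Basis (Σ j, Fin (n j) ⊕ Fin (n j + 1)) ℝ V), IsKronecker A B n b := by
  induction hd : Module.finrank ℝ V using Nat.strong_induction_on generalizing V with
  | _ d ih =>
    subst hd
    rcases subsingleton_or_nontrivial V with hV | hV
    · exact ⟨Empty, inferInstance, inferInstance, Empty.elim, Module.Basis.empty V,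
        ⟨nofun, nofun, nofun, nofun, nofun, nofun⟩⟩
    obtain ⟨V', R⟩ := exists_isReduction hA hB hinf
    obtain ⟨w, hw, hw0⟩ := Submodule.exists_mem_ne_zero_of_ne_bot (exists_radical_ne_zero h)
    have hV' : V' ≠ ⊤ := fun hV' => hw0 (R.disjoint w (hV' ▸ Submodule.mem_top) hw)
    obtain ⟨κ, _, _, n, b, K⟩ := ih _ (Submodule.finrank_lt hV') R.alt_restrict.1
      R.alt_restrict.2 R.noJordanInfty_restrict (fun α β => R.noJordanAt_restrict (h α β)) rfl
    obtain ⟨d, b', K'⟩ := R.exists_isKronecker K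
    exact ⟨κ ⊕ Fin d, inferInstance, inferInstance, _, b', K'⟩

end Main

section Matrices

theorem Matrix.blockDiagonal'_kronK1_apply {κ : Type*} [DecidableEq κ] {V : Type*}
    [AddCommGroup V] [Module ℝ V] {A B : BilinForm ℝ V} (hA : A.IsAlt) {n : κ → ℕ}
    {b : (Σ j : κ, Fin (n j) ⊕ Fin (n j + 1)) → V} (K : IsKronecker A B n b) :
    (Matrix.blockDiagonal' fun j => kronK1 ℝ (n j)) = Matrix.of fun s t => A (b s) (b t) := by
  ext ⟨j, i | i⟩ ⟨l, m | m⟩ <;> rw [Matrix.of_apply, Matrix.blockDiagonal'_apply]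
  · rw [K.left_inl_inl]
    split_ifs with h
    · cases h; rfl
    · rfl
  · rw [K.left_inl_inr]
    by_cases h : j = l
    · cases h; simp [kronK1, kronB1]
    · simp [h]
  · rw [hA.swap, K.left_inl_inr]
    by_cases h : j = l
    · cases h; simp [kronK1, kronB1]
    · simp [h, Ne.symm h]
  · rw [K.left_inr_inr]
    split_ifs with h
    · cases h; rfl
    · rfl

theorem Matrix.blockDiagonal'_kronK2_apply {κ : Type*} [DecidableEq κ] {V : Type*}
    [AddCommGroup V] [Module ℝ V] {A B : BilinForm ℝ V} (hB : B.IsAlt) {n : κ → ℕ}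
    {b : (Σ j : κ, Fin (n j) ⊕ Fin (n j + 1)) → V} (K : IsKronecker A B n b) :
    (Matrix.blockDiagonal' fun j => kronK2 ℝ (n j)) = Matrix.of fun s t => B (b s) (b t) := by
  ext ⟨j, i | i⟩ ⟨l, m | m⟩ <;> rw [Matrix.of_apply, Matrix.blockDiagonal'_apply]
  · rw [K.right_inl_inl]
    split_ifs with h
    · cases h; rfl
    · rfl
  · rw [K.right_inl_inr]
    by_cases h : j = l
    · cases h; simp [kronK2, kronB2]
    · simp [h]
  · rw [hB.swap, K.right_inl_inr]
    by_cases h : j = l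
    · cases h; simp [kronK2, kronB2]
    · simp [h, Ne.symm h]
  · rw [K.right_inr_inr]
    split_ifs with h
    · cases h; rfl
    · rfl

theorem IsKronecker.reindex {V : Type*} [AddCommGroup V] [Module ℝ V] {A B : BilinForm ℝ V}
    {κ ι : Type*} [DecidableEq κ] [DecidableEq ι] {n : κ → ℕ}
    {b : (Σ j : κ, Fin (n j) ⊕ Fin (n j + 1)) → V} (K : IsKronecker A B n b) (e : ι ≃ κ) :
    IsKronecker A B (fun j => n (e j))
      (b ∘ Equiv.sigmaCongrLeft (β := fun j => Fin (n j) ⊕ Fin (n j + 1)) e) where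
  left_inl_inl _ _ _ _ := K.left_inl_inl ..
  right_inl_inl _ _ _ _ := K.right_inl_inl ..
  left_inr_inr _ _ _ _ := K.left_inr_inr ..
  right_inr_inr _ _ _ _ := K.right_inr_inr ..
  left_inl_inr _ _ _ _ := (K.left_inl_inr ..).trans (by simp only [e.injective.eq_iff])
  right_inl_inr _ _ _ _ := (K.right_inl_inr ..).trans (by simp only [e.injective.eq_iff])

variable {ι : Type*} [Fintype ι] [DecidableEq ι] {C₁ C₂ C : Matrix ι ι ℝ}

theorem Matrix.toBilin'_isAlt (h : Cᵀ = -C) : (Matrix.toBilin' C).IsAlt := by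
  intro x
  have h1 : x ⬝ᵥ C *ᵥ x = x ⬝ᵥ Cᵀ *ᵥ x := by
    rw [Matrix.dotProduct_mulVec, ← Matrix.mulVec_transpose, dotProduct_comm]
  rw [h, Matrix.neg_mulVec, dotProduct_neg] at h1
  rw [Matrix.toBilin'_apply']
  linarith

theorem Matrix.toBilin'_eq_dotProductEquiv (h : Cᵀ = -C) (x : ι → ℝ) :
    Matrix.toBilin' C x = -dotProductEquiv ℝ ι (C *ᵥ x) := by
  rw [← map_neg, ← Matrix.neg_mulVec, ← h]
  ext y
  simp [Matrix.toBilin'_apply', mulVec, dotProduct_comm]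
  rfl

theorem noJordanInfty_toBilin' (h₁ : C₁ᵀ = -C₁) (h₂ : C₂ᵀ = -C₂)
    (h : ∀ t : ℂ, (C₂.map Complex.ofReal + t • -C₁.map Complex.ofReal).rank ≤
      (C₂.map Complex.ofReal).rank) :
    NoJordanInfty (Matrix.toBilin' C₁) (Matrix.toBilin' C₂) := by
  intro w hw
  rw [Matrix.toBilin'_eq_dotProductEquiv h₂, neg_eq_zero, LinearEquiv.map_eq_zero_iff] at hw
  obtain ⟨x, hx0, hx⟩ := Matrix.exists_chain_of_rank_le _ _ h (fun i => (w i : ℂ)) (by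
    ext i
    refine Complex.ext ?_ ?_
    · rw [Matrix.map_ofReal_mulVec_re]; simp [hw]
    · rw [Matrix.map_ofReal_mulVec_im]; simp [← Pi.zero_def])
  refine ⟨fun i j => (x i j).re, by simp [hx0], fun i => ?_⟩
  rw [Matrix.toBilin'_eq_dotProductEquiv h₁, Matrix.toBilin'_eq_dotProductEquiv h₂]
  congr 2
  ext j
  have := congrArg Complex.re (congrFun (hx i) j)
  rw [Matrix.neg_mulVec, Pi.add_apply, Pi.neg_apply, Complex.add_re, Complex.neg_re,
    Matrix.map_ofReal_mulVec_re, Matrix.map_ofReal_mulVec_re, Pi.zero_apply,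
    Complex.zero_re] at this
  linarith

theorem noJordanAt_toBilin' (h₁ : C₁ᵀ = -C₁) (h₂ : C₂ᵀ = -C₂) (α β : ℝ)
    (h : ∀ t : ℂ, (C₁.map Complex.ofReal - (⟨α, β⟩ : ℂ) • C₂.map Complex.ofReal +
      t • -C₂.map Complex.ofReal).rank ≤
      (C₁.map Complex.ofReal - (⟨α, β⟩ : ℂ) • C₂.map Complex.ofReal).rank) :
    NoJordanAt (Matrix.toBilin' C₁) (Matrix.toBilin' C₂) α β := by
  have hre : ∀ (z : ι → ℂ) (i : ι),
      (((C₁.map Complex.ofReal - (⟨α, β⟩ : ℂ) • C₂.map Complex.ofReal) *ᵥ z) i).re =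
      (C₁ *ᵥ (fun j => (z j).re) - α • C₂ *ᵥ (fun j => (z j).re) +
        β • C₂ *ᵥ (fun j => (z j).im)) i := fun z i => by
    simp only [Matrix.sub_mulVec, Matrix.smul_mulVec, Pi.sub_apply, Pi.add_apply, Pi.smul_apply,
      smul_eq_mul, Complex.sub_re, Complex.mul_re, Matrix.map_ofReal_mulVec_re,
      Matrix.map_ofReal_mulVec_im]
    ring
  have him : ∀ (z : ι → ℂ) (i : ι),
      (((C₁.map Complex.ofReal - (⟨α, β⟩ : ℂ) • C₂.map Complex.ofReal) *ᵥ z) i).im =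
      (C₁ *ᵥ (fun j => (z j).im) - α • C₂ *ᵥ (fun j => (z j).im) -
        β • C₂ *ᵥ (fun j => (z j).re)) i := fun z i => by
    simp only [Matrix.sub_mulVec, Matrix.smul_mulVec, Pi.sub_apply, Pi.smul_apply,
      smul_eq_mul, Complex.sub_im, Complex.mul_im, Matrix.map_ofReal_mulVec_re,
      Matrix.map_ofReal_mulVec_im]
    ring
  have key₁ : ∀ x y : ι → ℝ, Matrix.toBilin' C₁ x - α • Matrix.toBilin' C₂ x +
      β • Matrix.toBilin' C₂ y =
      -dotProductEquiv ℝ ι (C₁ *ᵥ x - α • C₂ *ᵥ x + β • C₂ *ᵥ y) := fun x y => by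
    simp only [Matrix.toBilin'_eq_dotProductEquiv h₁, Matrix.toBilin'_eq_dotProductEquiv h₂,
      map_add, map_sub, map_smul]
    module
  have key₂ : ∀ x y : ι → ℝ, Matrix.toBilin' C₁ y - α • Matrix.toBilin' C₂ y -
      β • Matrix.toBilin' C₂ x =
      -dotProductEquiv ℝ ι (C₁ *ᵥ y - α • C₂ *ᵥ y - β • C₂ *ᵥ x) := fun x y => by
    simp only [Matrix.toBilin'_eq_dotProductEquiv h₁, Matrix.toBilin'_eq_dotProductEquiv h₂,
      map_sub, map_smul]
    module
  intro u v hu hv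
  rw [key₁, neg_eq_zero, LinearEquiv.map_eq_zero_iff] at hu
  rw [key₂, neg_eq_zero, LinearEquiv.map_eq_zero_iff] at hv
  obtain ⟨x, hx0, hx⟩ := Matrix.exists_chain_of_rank_le _ _ h (fun i => ⟨u i, v i⟩) (by
    ext i
    refine Complex.ext ?_ ?_
    · rw [hre, hu]; rfl
    · rw [him, hv]; rfl)
  refine ⟨fun i j => (x i j).re, fun i j => (x i j).im, by simp [hx0], by simp [hx0],
    fun i => ⟨?_, ?_⟩⟩
  · rw [key₁, Matrix.toBilin'_eq_dotProductEquiv h₂]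
    congr 2
    ext j
    have := congrArg Complex.re (congrFun (hx i) j)
    rw [Matrix.neg_mulVec, Pi.add_apply, Pi.neg_apply, Complex.add_re, Complex.neg_re, hre,
      Matrix.map_ofReal_mulVec_re, Pi.zero_apply, Complex.zero_re] at this
    linarith
  · rw [key₂, Matrix.toBilin'_eq_dotProductEquiv h₂]
    congr 2
    ext j
    have := congrArg Complex.im (congrFun (hx i) j)
    rw [Matrix.neg_mulVec, Pi.add_apply, Pi.neg_apply, Complex.add_im, Complex.neg_im, him,
      Matrix.map_ofReal_mulVec_im, Pi.zero_apply, Complex.zero_im] at this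
    linarith

theorem Matrix.transpose_mul_mul_eq_of_basis {σ : Type*} [Fintype σ] (C : Matrix ι ι ℝ)
    (b : σ → ι → ℝ) (e : ι ≃ σ) {D : Matrix σ σ ℝ}
    (hD : D = Matrix.of fun s t => Matrix.toBilin' C (b s) (b t)) :
    (Matrix.of fun i x => b (e x) i)ᵀ * C * (Matrix.of fun i x => b (e x) i) =
      Matrix.reindex e.symm e.symm D := by
  ext x y
  rw [hD, Matrix.mul_assoc]
  simp [Matrix.toBilin'_apply', Matrix.mul_apply, dotProduct, mulVec]

end Matrices

/-- real classification in the absence of Jordan blocks: if the complexified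
pencil of a real skew-symmetric pair `(C1, C2)` has constant rank `R0` (the maximal real rank)
on `ℂ² \ {0}`, then the pair is simultaneously congruent over `ℝ` to a block-diagonal sum of
real Kronecker block pairs `K_i(n_1), …, K_i(n_k)`. -/
theorem real_kronecker_decomposition (N : ℕ) (C₁ C₂ : Matrix (Fin N) (Fin N) ℝ)
    (h₁ : C₁ᵀ = -C₁) (h₂ : C₂ᵀ = -C₂) (R0 : ℕ)
    (hR0 : IsGreatest {R : ℕ | ∃ l : ℝ × ℝ, (l.1 • C₁ + l.2 • C₂).rank = R} R0)
    (hconst : ∀ l : ℂ × ℂ, l ≠ 0 →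
      (l.1 • C₁.map Complex.ofReal + l.2 • C₂.map Complex.ofReal).rank = R0) :
    ∃ (k : ℕ) (n : Fin k → ℕ)
      (e : Fin N ≃ (Σ j : Fin k, Fin (n j) ⊕ Fin (n j + 1)))
      (P : Matrix (Fin N) (Fin N) ℝ), IsUnit P ∧
      N = ∑ j : Fin k, (2 * n j + 1) ∧
      Pᵀ * C₁ * P =
        Matrix.reindex e.symm e.symm (Matrix.blockDiagonal' fun j => kronK1 ℝ (n j)) ∧
      Pᵀ * C₂ * P =
        Matrix.reindex e.symm e.symm (Matrix.blockDiagonal' fun j => kronK2 ℝ (n j)) := by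
  have hJ : ∀ α β, NoJordanAt (Matrix.toBilin' C₁) (Matrix.toBilin' C₂) α β := fun α β => by
    refine noJordanAt_toBilin' h₁ h₂ α β fun t => le_of_eq ?_
    have ha := hconst (1, -⟨α, β⟩ - t) (by simp)
    have hb := hconst (1, -⟨α, β⟩) (by simp)
    rw [one_smul] at ha hb
    rw [sub_eq_add_neg, ← neg_smul, hb, ← ha]
    congr 1
    module
  have hinf : NoJordanInfty (Matrix.toBilin' C₁) (Matrix.toBilin' C₂) := by
    refine noJordanInfty_toBilin' h₁ h₂ fun t => le_of_eq ?_
    have ha := hconst (-t, 1) (by simp)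
    have hb := hconst (0, 1) (by simp)
    rw [zero_smul, zero_add, one_smul] at hb
    rw [hb, ← ha]
    congr 1
    module
  have hA := Matrix.toBilin'_isAlt h₁
  have hB := Matrix.toBilin'_isAlt h₂
  obtain ⟨κ, _, _, n, b, K⟩ := exists_isKronecker hA hB hinf hJ
  let f := (Fintype.equivFin κ).symm
  let b' := b.reindex (Equiv.sigmaCongrLeft (β := fun j => Fin (n j) ⊕ Fin (n j + 1)) f).symm
  have K' : IsKronecker (Matrix.toBilin' C₁) (Matrix.toBilin' C₂) (fun j => n (f j)) b' := by
    rw [Module.Basis.coe_reindex]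
    exact K.reindex f
  let e := (Pi.basisFun ℝ (Fin N)).indexEquiv b'
  refine ⟨Fintype.card κ, fun j => n (f j), e, Matrix.of fun i x => b' (e x) i, ?_, ?_, ?_, ?_⟩
  · have hdet := (Pi.basisFun ℝ (Fin N)).isUnit_det (b'.reindex e.symm)
    rw [Module.Basis.det_apply] at hdet
    rw [Matrix.isUnit_iff_isUnit_det]
    convert hdet using 2
    ext i x
    simp [Module.Basis.toMatrix_apply]
  · simpa [two_mul, add_assoc] using Fintype.card_congr e
  · exact Matrix.transpose_mul_mul_eq_of_basis C₁ b' e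
      (Matrix.blockDiagonal'_kronK1_apply hA K')
  · exact Matrix.transpose_mul_mul_eq_of_basis C₂ b' e
      (Matrix.blockDiagonal'_kronK2_apply hB K')

end
end

section
/- Completeness at a point is equivalent to a purely Kronecker decomposition: Let C1, C2 be complex skew-symmetric N×N matrices. Then the rank of λ1·C1 + λ2·C2 is the same for all (λ1,λ2) ∈ ℂ² \ {(0,0)} if and only if there exist an integer k ≥ 0, integers n_1,…,n_k ≥ 0 with N = Σ_{j=1}^k (2n_j+1), and an invertible complex N×N matrix P such that, for i = 1,2, Pᵀ·C_i·P is the block-diagonal matrix with diagonal blocks K_i(n_1),…,K_i(n_k) (i.e. the decomposition of the pair contains no Jordan blocks). -/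
open Matrix

noncomputable section

/-- Rank-nullity for the restriction of a linear map to a subspace. -/
theorem finrank_map_add_finrank_inf_ker {K V W : Type*} [Field K] [AddCommGroup V] [Module K V]
    [FiniteDimensional K V] [AddCommGroup W] [Module K W] (f : V →ₗ[K] W) (L : Submodule K V) :
    Module.finrank K (L.map f) + Module.finrank K (L ⊓ LinearMap.ker f : Submodule K V) =
      Module.finrank K L := by
  rw [← LinearMap.finrank_range_add_finrank_ker (f.domRestrict L), LinearMap.range_domRestrict]
  congr 1
  rw [LinearMap.ker_domRestrict, ← Submodule.finrank_map_subtype_eq L, Submodule.map_comap_subtype]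

/-- First-order semicontinuity of the rank: if `A + t • B` has rank at most `r` for all `t ≠ 0`,
then `range A + B (ker A)` has dimension at most `r`. -/
theorem finrank_range_sup_map_ker_le {V W : Type*} [AddCommGroup V] [Module ℂ V]
    [AddCommGroup W] [Module ℂ W] [FiniteDimensional ℂ V] [FiniteDimensional ℂ W]
    (A B : V →ₗ[ℂ] W) (r : ℕ)
    (h : ∀ t : ℂ, t ≠ 0 → Module.finrank ℂ (LinearMap.range (A + t • B)) ≤ r) :
    Module.finrank ℂ (LinearMap.range A ⊔ (LinearMap.ker A).map B : Submodule ℂ W) ≤ r := by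
  set S : Submodule ℂ W := LinearMap.range A ⊔ (LinearMap.ker A).map B
  let b := Module.finBasis ℂ S
  have hb : ∀ i, ∃ u k, A k = 0 ∧ A u + B k = (b i : W) := by
    intro i
    obtain ⟨y, ⟨u, rfl⟩, z, ⟨k, hk, rfl⟩, hyz⟩ := Submodule.mem_sup.mp (b i).2
    exact ⟨u, k, hk, hyz⟩
  choose u k hk huk using hb
  let e := (Module.finBasis ℂ W).equivFun
  let f : ℂ → Fin (Module.finrank ℂ S) → (Fin (Module.finrank ℂ W) → ℂ) :=
    fun t i => e (b i) + t • e (B (u i))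
  have hf : Continuous f := by fun_prop
  have hli : LinearIndependent ℂ (f 0) := by
    have h1 : LinearIndependent ℂ (fun i => (b i : W)) :=
      b.linearIndependent.map' S.subtype S.ker_subtype
    have h2 := h1.map' e.toLinearMap e.ker
    have h3 : f 0 = e.toLinearMap ∘ fun i => (b i : W) := by
      funext i
      simp [f]
    rw [h3]
    exact h2
  have hev : ∀ᶠ t in nhds (0 : ℂ), LinearIndependent ℂ (f t) :=
    hf.continuousAt.eventually hli.eventually
  have hev' : ∀ᶠ t in nhdsWithin (0 : ℂ) {0}ᶜ, LinearIndependent ℂ (f t) :=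
    hev.filter_mono nhdsWithin_le_nhds
  obtain ⟨t, ht, ht0⟩ := (hev'.and self_mem_nhdsWithin).exists
  have ht0 : t ≠ 0 := ht0
  have hft : f t = e.toLinearMap ∘ fun i => (A + t • B) (u i + t⁻¹ • k i) := by
    funext i
    have : (A + t • B) (u i + t⁻¹ • k i) = b i + t • B (u i) := by
      rw [← huk i]
      simp only [LinearMap.add_apply, LinearMap.smul_apply, map_add, map_smul, hk, smul_zero,
        smul_add, inv_smul_smul₀ ht0]
      abel
    simp only [Function.comp, this, f, LinearEquiv.coe_coe, map_add, map_smul]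
  rw [hft] at ht
  have hli' := ht.of_comp
  calc Module.finrank ℂ S = Fintype.card (Fin (Module.finrank ℂ S)) := by simp
    _ = Module.finrank ℂ (Submodule.span ℂ (Set.range fun i => (A + t • B) (u i + t⁻¹ • k i))) :=
        (finrank_span_eq_card hli').symm
    _ ≤ Module.finrank ℂ (LinearMap.range (A + t • B)) := by
        apply Submodule.finrank_mono
        rw [Submodule.span_le]
        rintro _ ⟨i, rfl⟩
        exact LinearMap.mem_range_self _ _
    _ ≤ r := h t ht0

/-- The restriction of a bilinear form to a subspace. -/
def restrictForm {K V : Type*} [Field K] [AddCommGroup V] [Module K V]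
    (C : V →ₗ[K] Module.Dual K V) (U : Submodule K V) : U →ₗ[K] Module.Dual K U :=
  U.subtype.dualMap ∘ₗ C ∘ₗ U.subtype

@[simp]
theorem restrictForm_apply {K V : Type*} [Field K] [AddCommGroup V] [Module K V]
    (C : V →ₗ[K] Module.Dual K V) (U : Submodule K V) (x y : U) :
    restrictForm C U x y = C x y := rfl

theorem skew_smul_add_smul {K V : Type*} [Field K] [AddCommGroup V] [Module K V]
    {C₁ C₂ : V →ₗ[K] Module.Dual K V} (h₁ : ∀ x y, C₁ x y = -C₁ y x)
    (h₂ : ∀ x y, C₂ x y = -C₂ y x) (a b : K) (x y : V) :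
    (a • C₁ + b • C₂) x y = -(a • C₁ + b • C₂) y x := by
  simp only [LinearMap.add_apply, LinearMap.smul_apply, smul_eq_mul]
  rw [h₁ x y, h₂ x y]
  ring

/-- All nonzero members of the pencil spanned by `C₁` and `C₂` have corank `c`. -/
def HasConstCorank {V : Type*} [AddCommGroup V] [Module ℂ V]
    (C₁ C₂ : V →ₗ[ℂ] Module.Dual ℂ V) (c : ℕ) : Prop :=
  ∀ a b : ℂ, a ≠ 0 ∨ b ≠ 0 → Module.finrank ℂ (LinearMap.ker (a • C₁ + b • C₂)) = c

theorem HasConstCorank.finrank_ker_left {V : Type*} [AddCommGroup V] [Module ℂ V]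
    {C₁ C₂ : V →ₗ[ℂ] Module.Dual ℂ V} {c : ℕ} (h : HasConstCorank C₁ C₂ c) :
    Module.finrank ℂ (LinearMap.ker C₁) = c := by
  have h10 := h 1 0 (by simp)
  rwa [one_smul, zero_smul, add_zero] at h10

theorem HasConstCorank.ker_isotropic {V : Type*} [AddCommGroup V] [Module ℂ V]
    [FiniteDimensional ℂ V] {C₁ C₂ : V →ₗ[ℂ] Module.Dual ℂ V} {c : ℕ}
    (h : HasConstCorank C₁ C₂ c) (h₁ : ∀ x y, C₁ x y = -C₁ y x)
    {x y : V} (hx : C₁ x = 0) (hy : C₁ y = 0) : C₂ x y = 0 := by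
  have hle := finrank_range_sup_map_ker_le C₁ C₂ (Module.finrank ℂ (LinearMap.range C₁)) (by
    intro t ht
    have e1 := LinearMap.finrank_range_add_finrank_ker (C₁ + t • C₂)
    have e2 := LinearMap.finrank_range_add_finrank_ker C₁
    have e3 := h 1 t (by simp)
    rw [one_smul] at e3
    have e4 := h.finrank_ker_left
    omega)
  have heq := Submodule.eq_of_le_of_finrank_le le_sup_left hle
  have hmem : C₂ x ∈ LinearMap.range C₁ := by
    rw [heq]
    exact Submodule.mem_sup_right ⟨x, hx, rfl⟩
  obtain ⟨v, hv⟩ := hmem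
  rw [← hv, h₁, hy]
  simp

theorem HasConstCorank.subsingleton {V : Type*} [AddCommGroup V] [Module ℂ V]
    [FiniteDimensional ℂ V] {C₁ C₂ : V →ₗ[ℂ] Module.Dual ℂ V}
    (h : HasConstCorank C₁ C₂ 0) : Subsingleton V := by
  by_contra hV
  rw [not_subsingleton_iff_nontrivial] at hV
  have hker : LinearMap.ker C₁ = ⊥ := Submodule.finrank_eq_zero.mp h.finrank_ker_left
  have hfr : Module.finrank ℂ V = Module.finrank ℂ (Module.Dual ℂ V) :=
    Subspace.dual_finrank_eq.symm
  let e := LinearEquiv.ofInjectiveOfFinrankEq C₁ (LinearMap.ker_eq_bot.mp hker) hfr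
  obtain ⟨μ, hμ⟩ := Module.End.exists_eigenvalue (e.symm.toLinearMap ∘ₗ C₂)
  obtain ⟨v, hv⟩ := hμ.exists_hasEigenvector
  have hv1 : e.symm (C₂ v) = μ • v := hv.apply_eq_smul
  have hv2 : C₂ v = μ • C₁ v := by
    rw [LinearEquiv.symm_apply_eq, map_smul] at hv1
    exact hv1
  have hbot := Submodule.finrank_eq_zero.mp (h μ (-1) (by simp))
  have hmem : v ∈ LinearMap.ker (μ • C₁ + (-1 : ℂ) • C₂) := by
    simp [hv2]
  rw [hbot] at hmem
  exact hv.2 (by simpa using hmem)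

/-- A complement of the radical of `C₁` inside the `C₂`-orthogonal of that radical. -/
structure IsReduction_s2 {K V : Type*} [Field K] [AddCommGroup V] [Module K V]
    (C₁ C₂ : V →ₗ[K] Module.Dual K V) (U : Submodule K V) : Prop where
  isotropic : ∀ x y, C₁ x = 0 → C₁ y = 0 → C₂ x y = 0
  inf_eq : U ⊓ LinearMap.ker C₁ = ⊥
  sup_eq : U ⊔ LinearMap.ker C₁ = ((LinearMap.ker C₁).map C₂).dualCoannihilator

theorem exists_isReduction_s2 {K V : Type*} [Field K] [AddCommGroup V] [Module K V]
    {C₁ C₂ : V →ₗ[K] Module.Dual K V}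
    (h : ∀ x y, C₁ x = 0 → C₁ y = 0 → C₂ x y = 0) :
    ∃ U : Submodule K V, IsReduction_s2 C₁ C₂ U := by
  obtain ⟨T, hT⟩ := (LinearMap.ker C₁).exists_isCompl
  refine ⟨((LinearMap.ker C₁).map C₂).dualCoannihilator ⊓ T, h, ?_, ?_⟩
  · rw [inf_assoc, inf_comm T, hT.inf_eq_bot, inf_bot_eq]
  · rw [inf_sup_assoc_of_le, sup_comm, hT.sup_eq_top, inf_top_eq]
    intro y hy
    rw [Submodule.mem_dualCoannihilator]
    rintro _ ⟨x, hx, rfl⟩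
    exact h x y hx hy

namespace IsReduction_s2

variable {V : Type*} [AddCommGroup V] [Module ℂ V] {C₁ C₂ : V →ₗ[ℂ] Module.Dual ℂ V}
  {U : Submodule ℂ V}

theorem apply_ker (hU : IsReduction_s2 C₁ C₂ U) {x u : V} (hx : C₁ x = 0) (hu : u ∈ U) :
    C₂ x u = 0 := by
  have hmem : u ∈ ((LinearMap.ker C₁).map C₂).dualCoannihilator := by
    rw [← hU.sup_eq]
    exact Submodule.mem_sup_left hu
  exact (Submodule.mem_dualCoannihilator u).mp hmem _ ⟨x, hx, rfl⟩

theorem eq_zero (hU : IsReduction_s2 C₁ C₂ U) {u : V} (hu : u ∈ U) (h : C₁ u = 0) : u = 0 := by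
  have : u ∈ U ⊓ LinearMap.ker C₁ := ⟨hu, h⟩
  simpa [hU.inf_eq] using this

theorem exists_ker_eq [FiniteDimensional ℂ V] (hU : IsReduction_s2 C₁ C₂ U) {φ : Module.Dual ℂ V}
    (hφU : ∀ u ∈ U, φ u = 0) (hφK : ∀ x, C₁ x = 0 → φ x = 0) :
    ∃ k, C₁ k = 0 ∧ C₂ k = φ := by
  have hmem : φ ∈ (LinearMap.ker C₁).map C₂ := by
    rw [← Subspace.dualCoannihilator_dualAnnihilator_eq (W := (LinearMap.ker C₁).map C₂),
      ← hU.sup_eq, Submodule.mem_dualAnnihilator]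
    intro w hw
    obtain ⟨u, hu, x, hx, rfl⟩ := Submodule.mem_sup.mp hw
    rw [map_add, hφU u hu, hφK x hx, add_zero]
  obtain ⟨k, hk, hk'⟩ := hmem
  exact ⟨k, hk, hk'⟩

theorem finrank_ker_restrict_of_ne_zero [FiniteDimensional ℂ V] (hU : IsReduction_s2 C₁ C₂ U)
    (h₁ : ∀ x y, C₁ x y = -C₁ y x) (h₂ : ∀ x y, C₂ x y = -C₂ y x) (a : ℂ) {b : ℂ} (hb : b ≠ 0) :
    Module.finrank ℂ (LinearMap.ker (a • restrictForm C₁ U + b • restrictForm C₂ U)) +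
        Module.finrank ℂ (LinearMap.ker C₁ ⊓ LinearMap.ker C₂ : Submodule ℂ V) =
      Module.finrank ℂ (LinearMap.ker (a • C₁ + b • C₂)) := by
  have hdisj : Disjoint U (LinearMap.ker C₁) := disjoint_iff.mpr hU.inf_eq
  obtain ⟨T, hUT, hT⟩ := hdisj.exists_isCompl
  let f := T.projection (LinearMap.ker C₁) hT
  have hskew := skew_smul_add_smul h₁ h₂ a b
  have hfU : ∀ u ∈ U, ∀ x, C₁ x = 0 → f (u + x) = u := by
    intro u hu x hx
    have e1 : f u = u := Submodule.projection_apply_of_mem_left hT (hUT hu)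
    have e2 : f x = 0 := (Submodule.projection_apply_eq_zero_iff hT).mpr hx
    rw [map_add, e1, e2, add_zero]
  rw [← finrank_map_add_finrank_inf_ker f (LinearMap.ker (a • C₁ + b • C₂))]
  congr 1
  · rw [← Submodule.finrank_map_subtype_eq U]
    refine congrArg (fun S : Submodule ℂ V => Module.finrank ℂ S) ?_
    ext w
    constructor
    · rintro ⟨u, hu, rfl⟩
      obtain ⟨k, hk, hk'⟩ := hU.exists_ker_eq (φ := (a • C₁ + b • C₂) u)
        (fun u' hu' => LinearMap.congr_fun hu ⟨u', hu'⟩)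
        (fun x hx => by
          rw [hskew]
          simp [hx, hU.apply_ker hx u.2])
      refine ⟨u + (-b⁻¹ • k), ?_, hfU u u.2 _ (by rw [map_smul, hk, smul_zero])⟩
      change (a • C₁ + b • C₂) _ = 0
      rw [map_add, ← hk']
      ext y
      simp [hk, hb]
    · rintro ⟨v, hv, rfl⟩
      have hv' : (a • C₁ + b • C₂) v = 0 := hv
      have hmem : v ∈ U ⊔ LinearMap.ker C₁ := by
        rw [hU.sup_eq, Submodule.mem_dualCoannihilator]
        rintro _ ⟨x, hx, rfl⟩
        have hx' : C₁ x = 0 := hx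
        have e := hskew v x
        rw [hv'] at e
        simpa [hx', hb] using e
      obtain ⟨u, hu, x, hx, rfl⟩ := Submodule.mem_sup.mp hmem
      have hx' : C₁ x = 0 := hx
      rw [hfU u hu x hx]
      refine ⟨⟨u, hu⟩, ?_, rfl⟩
      change _ = _
      ext u'
      have e := LinearMap.congr_fun hv' (u' : V)
      have e2 := hU.apply_ker hx' u'.2
      simpa [hx', e2] using e
  · refine congrArg (fun S : Submodule ℂ V => Module.finrank ℂ S) ?_
    ext x
    simp only [Submodule.mem_inf, LinearMap.mem_ker]
    have e2 : f x = 0 ↔ C₁ x = 0 := Submodule.projection_apply_eq_zero_iff hT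
    rw [e2, and_comm]
    refine and_congr_left fun hx => ?_
    simp [hx, hb]

theorem finrank_map_ker [FiniteDimensional ℂ V] :
    Module.finrank ℂ ((LinearMap.ker C₁).map C₂) +
        Module.finrank ℂ (LinearMap.ker C₁ ⊓ LinearMap.ker C₂ : Submodule ℂ V) =
      Module.finrank ℂ (LinearMap.ker C₁) :=
  finrank_map_add_finrank_inf_ker _ _

theorem finrank_ker_restrict_le [FiniteDimensional ℂ V] (hU : IsReduction_s2 C₁ C₂ U)
    (h₁ : ∀ x y, C₁ x y = -C₁ y x) :
    Module.finrank ℂ (LinearMap.ker (restrictForm C₁ U)) +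
        Module.finrank ℂ (LinearMap.ker C₁ ⊓ LinearMap.ker C₂ : Submodule ℂ V) ≤
      Module.finrank ℂ (LinearMap.ker C₁) := by
  rw [← finrank_map_ker (C₁ := C₁) (C₂ := C₂)]
  gcongr
  have hinj : Function.Injective (C₁ ∘ₗ U.subtype) := by
    rw [← LinearMap.ker_eq_bot, LinearMap.ker_eq_bot']
    intro u hu
    exact Subtype.ext (hU.eq_zero u.2 hu)
  rw [(Submodule.equivMapOfInjective _ hinj (LinearMap.ker (restrictForm C₁ U))).finrank_eq]
  apply Submodule.finrank_mono
  rintro _ ⟨u, hu, rfl⟩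
  obtain ⟨k, hk, hk'⟩ := hU.exists_ker_eq (φ := C₁ u)
    (fun u' hu' => LinearMap.congr_fun hu ⟨u', hu'⟩) (fun x hx => by rw [h₁, hx]; simp)
  exact ⟨k, hk, hk'⟩

theorem hasConstCorank [FiniteDimensional ℂ V] (hU : IsReduction_s2 C₁ C₂ U)
    (h₁ : ∀ x y, C₁ x y = -C₁ y x) (h₂ : ∀ x y, C₂ x y = -C₂ y x) {c : ℕ}
    (h : HasConstCorank C₁ C₂ c) :
    HasConstCorank (restrictForm C₁ U) (restrictForm C₂ U)
      (c - Module.finrank ℂ (LinearMap.ker C₁ ⊓ LinearMap.ker C₂ : Submodule ℂ V)) := by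
  set d := Module.finrank ℂ (LinearMap.ker C₁ ⊓ LinearMap.ker C₂ : Submodule ℂ V) with hd
  have hgen : ∀ a b : ℂ, b ≠ 0 →
      Module.finrank ℂ (LinearMap.ker (a • restrictForm C₁ U + b • restrictForm C₂ U)) = c - d := by
    intro a b hb
    have e := hU.finrank_ker_restrict_of_ne_zero h₁ h₂ a hb
    rw [h a b (Or.inr hb)] at e
    omega
  intro a b hab
  by_cases hb : b = 0
  · subst hb
    have ha : a ≠ 0 := by simpa using hab
    have hker : LinearMap.ker (a • restrictForm C₁ U + (0 : ℂ) • restrictForm C₂ U) =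
        LinearMap.ker (restrictForm C₁ U) := by
      rw [zero_smul, add_zero, LinearMap.ker_smul _ _ ha]
    rw [hker]
    have hle := hU.finrank_ker_restrict_le h₁
    rw [h.finrank_ker_left] at hle
    have hsc := finrank_range_sup_map_ker_le (restrictForm C₁ U) (restrictForm C₂ U)
      (Module.finrank ℂ U - (c - d)) (by
        intro t ht
        have e := hgen 1 t ht
        rw [one_smul] at e
        have e1 := LinearMap.finrank_range_add_finrank_ker
          (restrictForm C₁ U + t • restrictForm C₂ U)
        omega)
    have hsc' := (Submodule.finrank_mono le_sup_left).trans hsc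
    have e1 := LinearMap.finrank_range_add_finrank_ker (restrictForm C₁ U)
    have e2 := hgen 0 1 one_ne_zero
    have e3 := Submodule.finrank_le
      (LinearMap.ker ((0 : ℂ) • restrictForm C₁ U + (1 : ℂ) • restrictForm C₂ U))
    omega
  · exact hgen a b hb

end IsReduction_s2

/-- Vectors `p j i` (`i < n j`) and `q j i` (`i ≤ n j`) that span the space and in which the pair
of skew forms `C₁, C₂` is the direct sum of the Kronecker block pairs `K₁(n j), K₂(n j)`. -/
structure IsKroneckerFamily {V : Type*} [AddCommGroup V] [Module ℂ V]
    (C₁ C₂ : V →ₗ[ℂ] Module.Dual ℂ V) {ι : Type} [Fintype ι] [DecidableEq ι]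
    (n : ι → ℕ) (p q : ι → ℕ → V) : Prop where
  eq_top : ∀ S : Submodule ℂ V, (∀ j i, i < n j → p j i ∈ S) → (∀ j i, i ≤ n j → q j i ∈ S) → S = ⊤
  finrank_eq : Module.finrank ℂ V = ∑ j, (2 * n j + 1)
  p_p_left : ∀ j i j' i', i < n j → i' < n j' → C₁ (p j i) (p j' i') = 0
  p_p_right : ∀ j i j' i', i < n j → i' < n j' → C₂ (p j i) (p j' i') = 0
  q_q_left : ∀ j i j' i', i ≤ n j → i' ≤ n j' → C₁ (q j i) (q j' i') = 0
  q_q_right : ∀ j i j' i', i ≤ n j → i' ≤ n j' → C₂ (q j i) (q j' i') = 0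
  p_q_left : ∀ j i j' i', i < n j → i' ≤ n j' →
    C₁ (p j i) (q j' i') = if j = j' ∧ i' = i then 1 else 0
  p_q_right : ∀ j i j' i', i < n j → i' ≤ n j' →
    C₂ (p j i) (q j' i') = if j = j' ∧ i' = i + 1 then 1 else 0

namespace IsKroneckerFamily

variable {V : Type*} [AddCommGroup V] [Module ℂ V] {C₁ C₂ : V →ₗ[ℂ] Module.Dual ℂ V}
  {ι : Type} [Fintype ι] [DecidableEq ι] {n : ι → ℕ} {p q : ι → ℕ → V}

/-- The basis formed by the vectors of a Kronecker family. -/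
def basis (h : IsKroneckerFamily C₁ C₂ n p q) :
    Module.Basis (Σ j, Fin (n j) ⊕ Fin (n j + 1)) ℂ V :=
  basisOfTopLeSpanOfCardEqFinrank
    (fun x => Sum.elim (fun i : Fin (n x.1) => p x.1 i) (fun i : Fin (n x.1 + 1) => q x.1 i) x.2)
    (by
      rw [h.eq_top (Submodule.span ℂ _)]
      · intro j i hi
        exact Submodule.subset_span ⟨⟨j, Sum.inl ⟨i, hi⟩⟩, rfl⟩
      · intro j i hi
        exact Submodule.subset_span ⟨⟨j, Sum.inr ⟨i, Nat.lt_succ_of_le hi⟩⟩, rfl⟩)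
    (by
      rw [h.finrank_eq, Fintype.card_sigma]
      refine Finset.sum_congr rfl fun j _ => ?_
      simp
      ring)

theorem basis_inl (h : IsKroneckerFamily C₁ C₂ n p q) (j : ι) (i : Fin (n j)) :
    h.basis ⟨j, Sum.inl i⟩ = p j i := by
  simp [basis]

theorem basis_inr (h : IsKroneckerFamily C₁ C₂ n p q) (j : ι) (i : Fin (n j + 1)) :
    h.basis ⟨j, Sum.inr i⟩ = q j i := by
  simp [basis]

end IsKroneckerFamily

/-- Vectors dual to an isotropic family with respect to a skew form can be made isotropic by
adding elements of the span of that family. -/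
theorem exists_isotropic_of_dual {V ι : Type*} [AddCommGroup V] [Module ℂ V] [Fintype ι]
    [DecidableEq ι] {C : V →ₗ[ℂ] Module.Dual ℂ V} (hC : ∀ x y, C x y = -C y x) {P Q : ι → V}
    (hPQ : ∀ j l, C (P j) (Q l) = if j = l then 1 else 0) (hQQ : ∀ j l, C (Q j) (Q l) = 0) :
    ∃ P' : ι → V, (∀ j, P' j - P j ∈ Submodule.span ℂ (Set.range Q)) ∧
      ∀ j l, C (P' j) (P' l) = 0 := by
  refine ⟨fun j => P j + ∑ l, (C (P j) (P l) / 2) • Q l, fun j => ?_, fun j l => ?_⟩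
  · rw [add_sub_cancel_left]
    exact Submodule.sum_mem _ fun l _ =>
      Submodule.smul_mem _ _ (Submodule.subset_span (Set.mem_range_self l))
  · have hQP : ∀ j l, C (Q j) (P l) = if l = j then -1 else 0 := by
      intro j l
      rw [hC, hPQ]
      split_ifs <;> simp
    simp only [map_add, map_sum, map_smul, LinearMap.add_apply, LinearMap.sum_apply,
      LinearMap.smul_apply, smul_eq_mul, hPQ, hQQ, hQP, mul_ite, mul_one, mul_zero, mul_neg,
      Finset.sum_ite_eq, Finset.mem_univ, if_true, Finset.sum_const_zero,
      add_zero]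
    rw [hC (P l) (P j)]
    ring

namespace IsReduction_s2

variable {V : Type*} [AddCommGroup V] [Module ℂ V] [FiniteDimensional ℂ V]
  {C₁ C₂ : V →ₗ[ℂ] Module.Dual ℂ V} {U : Submodule ℂ V}

theorem exists_restrict_eq (hU : IsReduction_s2 C₁ C₂ U) (h₁ : ∀ x y, C₁ x y = -C₁ y x)
    (φ : Module.Dual ℂ U) : ∃ v, ∀ u : U, C₁ v u = φ u := by
  let B : V →ₗ[ℂ] U →ₗ[ℂ] ℂ := U.subtype.dualMap ∘ₗ C₁
  have hB : Function.Injective B.flip := by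
    rw [← LinearMap.ker_eq_bot, LinearMap.ker_eq_bot']
    intro u hu
    refine Subtype.ext (hU.eq_zero u.2 ?_)
    ext x
    have e : C₁ x u = 0 := LinearMap.congr_fun hu x
    rw [h₁, e]
    simp
  obtain ⟨v, hv⟩ := LinearMap.flip_injective_iff₁.mp hB φ
  exact ⟨v, fun u => LinearMap.congr_fun hv u⟩

variable {ι : Type} [Fintype ι] [DecidableEq ι] {n : ι → ℕ} {p q : ι → ℕ → U}

/-- The last vectors `q j (n j)` of a Kronecker family on a reduction lift to vectors `k j` of the
radical of `C₁`, which span it modulo the common radical. -/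
theorem exists_ker_lift (hU : IsReduction_s2 C₁ C₂ U) (h₁ : ∀ x y, C₁ x y = -C₁ y x)
    (hf : IsKroneckerFamily (restrictForm C₁ U) (restrictForm C₂ U) n p q)
    (hcard : Fintype.card ι +
        Module.finrank ℂ (LinearMap.ker C₁ ⊓ LinearMap.ker C₂ : Submodule ℂ V) =
      Module.finrank ℂ (LinearMap.ker C₁)) :
    ∃ k : ι → V, (∀ j, C₁ (k j) = 0) ∧ (∀ j, C₂ (k j) = C₁ (q j (n j))) ∧
      LinearMap.ker C₁ ≤
        Submodule.span ℂ (Set.range k) ⊔ (LinearMap.ker C₁ ⊓ LinearMap.ker C₂) := by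
  have hQ : ∀ j, restrictForm C₁ U (q j (n j)) = 0 := by
    intro j
    rw [← LinearMap.ker_eq_top]
    refine hf.eq_top _ (fun j' i hi => ?_) (fun j' i hi => ?_)
    · have e := hf.p_q_left j' i j (n j) hi le_rfl
      have hne : ¬(j' = j ∧ n j = i) := by
        rintro ⟨rfl, rfl⟩
        exact lt_irrefl _ hi
      rw [if_neg hne, restrictForm_apply] at e
      rw [LinearMap.mem_ker, restrictForm_apply, h₁, e, neg_zero]
    · exact hf.q_q_left j (n j) j' i le_rfl hi
  have hk : ∀ j, ∃ k, C₁ k = 0 ∧ C₂ k = C₁ (q j (n j)) := fun j =>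
    hU.exists_ker_eq (fun u hu => LinearMap.congr_fun (hQ j) ⟨u, hu⟩)
      (fun x hx => by rw [h₁, hx]; simp)
  choose k hk₁ hk₂ using hk
  refine ⟨k, hk₁, hk₂, ?_⟩
  have hinj : LinearMap.ker (C₁ ∘ₗ U.subtype) = ⊥ := by
    rw [LinearMap.ker_eq_bot']
    intro u hu
    exact Subtype.ext (hU.eq_zero u.2 hu)
  have hli : LinearIndependent ℂ fun j => q j (n j) := by
    have e := hf.basis.linearIndependent.comp
      (fun j : ι => (⟨j, Sum.inr (Fin.last (n j))⟩ : Σ j, Fin (n j) ⊕ Fin (n j + 1)))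
      (fun j j' hjj' => congrArg Sigma.fst hjj')
    have hfun : (fun j => q j (n j)) =
        hf.basis ∘ fun j : ι => ⟨j, Sum.inr (Fin.last (n j))⟩ := by
      funext j
      simp [hf.basis_inr]
    rw [hfun]
    exact e
  have hli₂ : LinearIndependent ℂ fun j => C₂ (k j) := by
    have hfun : (fun j => C₂ (k j)) = (C₁ ∘ₗ U.subtype) ∘ fun j => q j (n j) := funext hk₂
    rw [hfun]
    exact hli.map' _ hinj
  have hle : Submodule.span ℂ (Set.range fun j => C₂ (k j)) ≤ (LinearMap.ker C₁).map C₂ := by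
    rw [Submodule.span_le]
    rintro _ ⟨j, rfl⟩
    exact ⟨k j, hk₁ j, rfl⟩
  have heq := Submodule.eq_of_le_of_finrank_eq hle (by
    rw [finrank_span_eq_card hli₂]
    have e := finrank_map_ker (C₁ := C₁) (C₂ := C₂)
    omega)
  have hspan : Submodule.span ℂ (Set.range fun j => C₂ (k j)) =
      (Submodule.span ℂ (Set.range k)).map C₂ := by
    rw [Submodule.map_span, ← Set.range_comp]
    rfl
  intro x hx
  have hx₂ : C₂ x ∈ (Submodule.span ℂ (Set.range k)).map C₂ := by
    rw [← hspan, heq]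
    exact ⟨x, hx, rfl⟩
  obtain ⟨y, hy, hyx⟩ := hx₂
  have hy₁ : C₁ y = 0 := by
    have e : Submodule.span ℂ (Set.range k) ≤ LinearMap.ker C₁ := by
      rw [Submodule.span_le]
      rintro _ ⟨j, rfl⟩
      exact hk₁ j
    exact e hy
  have hx₁ : C₁ x = 0 := hx
  rw [← add_sub_cancel y x]
  refine Submodule.add_mem_sup hy ⟨?_, ?_⟩
  · simp [hy₁, hx₁]
  · simp [hyx]

/-- Vectors `P j` dual to the lifts of the last vectors of a Kronecker family. -/
theorem exists_dual_lift (hU : IsReduction_s2 C₁ C₂ U) (h₁ : ∀ x y, C₁ x y = -C₁ y x)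
    (h₂ : ∀ x y, C₂ x y = -C₂ y x)
    (hf : IsKroneckerFamily (restrictForm C₁ U) (restrictForm C₂ U) n p q)
    {k : ι → V} (hk₁ : ∀ j, C₁ (k j) = 0) (hk₂ : ∀ j, C₂ (k j) = C₁ (q j (n j))) :
    ∃ P : ι → V, (∀ j l, C₁ (P j) (P l) = 0) ∧ (∀ j l, C₂ (P j) (P l) = 0) ∧
      (∀ j j' i, i < n j' → C₁ (P j) (p j' i) = 0) ∧
      (∀ j j' i, i ≤ n j' → C₁ (P j) (q j' i) = if j = j' ∧ i = n j then 1 else 0) := by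
  choose P₀ hP₀ using fun j =>
    hU.exists_restrict_eq h₁ (hf.basis.coord ⟨j, Sum.inr (Fin.last (n j))⟩)
  have hP₀p : ∀ j j' i, i < n j' → C₁ (P₀ j) (p j' i) = 0 := by
    intro j j' i hi
    have e := hf.basis_inl j' ⟨i, hi⟩
    simp only at e
    rw [hP₀, ← e, Module.Basis.coord_apply, Module.Basis.repr_self, Finsupp.single_apply, if_neg]
    intro h
    by_cases hj : j' = j
    · subst hj
      simp at h
    · exact hj (congrArg Sigma.fst h)
  have hP₀q : ∀ j j' i, i ≤ n j' →
      C₁ (P₀ j) (q j' i) = if j = j' ∧ i = n j then 1 else 0 := by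
    intro j j' i hi
    have e := hf.basis_inr j' ⟨i, Nat.lt_succ_of_le hi⟩
    simp only at e
    rw [hP₀, ← e, Module.Basis.coord_apply, Module.Basis.repr_self, Finsupp.single_apply]
    congr 1
    by_cases hj : j' = j
    · subst hj
      simp [Fin.ext_iff]
    · simp [hj, Ne.symm hj]
  have hkill : ∀ j, ∀ u : U, C₁ (q j (n j)) u = 0 := by
    intro j u
    rw [← hk₂, hU.apply_ker (hk₁ j) u.2]
  obtain ⟨P₁, hP₁, hP₁P₁⟩ := exists_isotropic_of_dual (C := C₁) (P := P₀)
    (Q := fun j => (q j (n j) : V)) h₁ (fun j l => by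
      rw [hP₀q _ _ _ le_rfl]
      refine if_congr ⟨fun h => h.1, ?_⟩ rfl rfl
      rintro rfl
      exact ⟨rfl, rfl⟩) (fun j l => hkill j _)
  have hP₁U : ∀ j, ∀ u : U, C₁ (P₁ j) u = C₁ (P₀ j) u := by
    intro j u
    have hle : Submodule.span ℂ (Set.range fun j => (q j (n j) : V)) ≤
        LinearMap.ker (C₁.flip u) := by
      rw [Submodule.span_le]
      rintro _ ⟨l, rfl⟩
      exact hkill l u
    have e : C₁ (P₁ j - P₀ j) u = 0 := hle (hP₁ j)
    rw [map_sub, LinearMap.sub_apply] at e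
    exact sub_eq_zero.mp e
  obtain ⟨P, hP, hPP⟩ := exists_isotropic_of_dual (C := C₂) (P := P₁) (Q := k) h₂
    (fun j l => by
      rw [h₂, hk₂, h₁, neg_neg, hP₁U, hP₀q _ _ _ le_rfl]
      refine if_congr ⟨fun h => h.1, ?_⟩ rfl rfl
      rintro rfl
      exact ⟨rfl, rfl⟩)
    (fun j l => hU.isotropic _ _ (hk₁ j) (hk₁ l))
  have hPP₁ : ∀ j, C₁ (P j) = C₁ (P₁ j) := by
    intro j
    have hle : Submodule.span ℂ (Set.range k) ≤ LinearMap.ker C₁ := by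
      rw [Submodule.span_le]
      rintro _ ⟨l, rfl⟩
      exact hk₁ l
    have e : C₁ (P j - P₁ j) = 0 := hle (hP j)
    rw [map_sub] at e
    exact sub_eq_zero.mp e
  refine ⟨P, fun j l => ?_, hPP, fun j j' i hi => ?_, fun j j' i hi => ?_⟩
  · rw [hPP₁, h₁, hPP₁, h₁, neg_neg, hP₁P₁]
  · rw [hPP₁, hP₁U, hP₀p _ _ _ hi]
  · rw [hPP₁, hP₁U, hP₀q _ _ _ hi]

/-- A Kronecker family on a reduction extends to the whole space: each block grows by one, and the
common radical contributes blocks of dimension one. -/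
theorem exists_isKroneckerFamily (hU : IsReduction_s2 C₁ C₂ U) (h₁ : ∀ x y, C₁ x y = -C₁ y x)
    (h₂ : ∀ x y, C₂ x y = -C₂ y x)
    (hf : IsKroneckerFamily (restrictForm C₁ U) (restrictForm C₂ U) n p q)
    (hcard : Fintype.card ι +
        Module.finrank ℂ (LinearMap.ker C₁ ⊓ LinearMap.ker C₂ : Submodule ℂ V) =
      Module.finrank ℂ (LinearMap.ker C₁)) :
    ∃ (κ : Type) (_ : Fintype κ) (_ : DecidableEq κ) (m : κ → ℕ) (p' q' : κ → ℕ → V),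
      Fintype.card κ = Module.finrank ℂ (LinearMap.ker C₁) ∧
        IsKroneckerFamily C₁ C₂ m p' q' := by
  obtain ⟨k, hk₁, hk₂, hker⟩ := hU.exists_ker_lift h₁ hf hcard
  obtain ⟨P, hPP₁, hPP₂, hPp, hPq⟩ := hU.exists_dual_lift h₁ h₂ hf hk₁ hk₂
  let z := Module.finBasis ℂ (LinearMap.ker C₁ ⊓ LinearMap.ker C₂ : Submodule ℂ V)
  have hz₁ : ∀ l, C₁ (z l) = 0 := fun l => (z l).2.1
  have hz₂ : ∀ l, C₂ (z l) = 0 := fun l => (z l).2.2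
  have hz₁' : ∀ x l, C₁ x (z l) = 0 := fun x l => by rw [h₁, hz₁]; simp
  have hz₂' : ∀ x l, C₂ x (z l) = 0 := fun x l => by rw [h₂, hz₂]; simp
  have hk₁' : ∀ x l, C₁ x (k l) = 0 := fun x l => by rw [h₁, hk₁]; simp
  have hPk : ∀ j l, C₂ (P j) (k l) = if j = l then 1 else 0 := by
    intro j l
    rw [h₂, hk₂, h₁, neg_neg, hPq _ _ _ le_rfl]
    refine if_congr ⟨fun h => h.1, ?_⟩ rfl rfl
    rintro rfl
    exact ⟨rfl, rfl⟩
  have hkk : ∀ j l, C₂ (k j) (k l) = 0 := fun j l => hU.isotropic _ _ (hk₁ j) (hk₁ l)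
  have hkU : ∀ j, ∀ u : U, C₂ (k j) u = 0 := fun j u => hU.apply_ker (hk₁ j) u.2
  have hUk : ∀ j, ∀ u : U, C₂ u (k j) = 0 := fun j u => by rw [h₂, hkU, neg_zero]
  let τ : U → V := fun u => u - ∑ j, C₂ (P j) u • k j
  have hτ₁ : ∀ u, C₁ (τ u) = C₁ u := by
    intro u
    simp [τ, hk₁]
  have hτ₁' : ∀ x u, C₁ x (τ u) = C₁ x u := by
    intro x u
    rw [h₁, hτ₁, h₁, neg_neg]
  have hττ : ∀ u v, C₂ (τ u) (τ v) = C₂ u v := by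
    intro u v
    simp [τ, hkU, hUk, hkk]
  have hτk : ∀ u j, C₂ (τ u) (k j) = 0 := by
    intro u j
    simp [τ, hUk, hkk]
  have hPτ : ∀ j u, C₂ (P j) (τ u) = 0 := by
    intro j u
    simp [τ, hPk]
  let m : ι ⊕ Fin (Module.finrank ℂ (LinearMap.ker C₁ ⊓ LinearMap.ker C₂ : Submodule ℂ V)) → ℕ :=
    Sum.elim (fun j => n j + 1) fun _ => 0
  let p' : ι ⊕ Fin (Module.finrank ℂ (LinearMap.ker C₁ ⊓ LinearMap.ker C₂ : Submodule ℂ V)) →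
      ℕ → V := Sum.elim (fun j i => if i < n j then τ (p j i) else P j) fun _ _ => 0
  let q' : ι ⊕ Fin (Module.finrank ℂ (LinearMap.ker C₁ ⊓ LinearMap.ker C₂ : Submodule ℂ V)) →
      ℕ → V := Sum.elim (fun j i => if i ≤ n j then τ (q j i) else k j) fun l _ => z l
  refine ⟨_, inferInstance, inferInstance, m, p', q', by simp [hcard], ?_⟩
  constructor
  · intro S hp hq
    have hkS : ∀ j, k j ∈ S := by
      intro j
      have e := hq (Sum.inl j) (n j + 1) le_rfl
      simpa [q'] using e
    have hzS : ∀ l, (z l : V) ∈ S := fun l => hq (Sum.inr l) 0 le_rfl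
    have hPS : ∀ j, P j ∈ S := by
      intro j
      have e := hp (Sum.inl j) (n j) (Nat.lt_succ_self _)
      simpa [p'] using e
    have hτS : ∀ u, τ u ∈ S → (u : V) ∈ S := by
      intro u hu
      have e := S.add_mem hu (S.sum_mem fun j (_ : j ∈ Finset.univ) =>
        S.smul_mem (C₂ (P j) u) (hkS j))
      simpa only [τ, sub_add_cancel] using e
    have hUS : U ≤ S := by
      have e : S.comap U.subtype = ⊤ := by
        refine hf.eq_top _ (fun j i hi => hτS _ ?_) (fun j i hi => hτS _ ?_)
        · have e := hp (Sum.inl j) i (Nat.lt_succ_of_lt hi)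
          simpa [p', hi] using e
        · have e := hq (Sum.inl j) i (Nat.le_succ_of_le hi)
          simpa [q', hi] using e
      intro u hu
      have e2 : (⟨u, hu⟩ : U) ∈ S.comap U.subtype := by
        rw [e]
        trivial
      exact e2
    have hkerS : LinearMap.ker C₁ ≤ S := by
      refine hker.trans (sup_le ?_ ?_)
      · rw [Submodule.span_le]
        rintro _ ⟨j, rfl⟩
        exact hkS j
      · intro x hx
        have e := z.sum_repr ⟨x, hx⟩
        have e2 := congrArg Subtype.val e
        change _ = x at e2
        rw [← e2, Submodule.coe_sum]
        exact S.sum_mem fun l _ => S.smul_mem _ (hzS l)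
    rw [eq_top_iff]
    intro v _
    have hv : v - ∑ j, C₂ v (k j) • P j ∈ U ⊔ LinearMap.ker C₁ := by
      rw [hU.sup_eq, Submodule.mem_dualCoannihilator]
      rintro _ ⟨x, hx, rfl⟩
      have hle : LinearMap.ker C₁ ≤
          LinearMap.ker (C₂.flip (v - ∑ j, C₂ v (k j) • P j)) := by
        refine hker.trans (sup_le ?_ ?_)
        · rw [Submodule.span_le]
          rintro _ ⟨l, rfl⟩
          change C₂ (k l) _ = 0
          rw [h₂]
          simp [hPk]
        · intro y hy
          have hy₂ : C₂ y = 0 := hy.2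
          simp [hy₂]
      exact hle hx
    have e := S.add_mem (sup_le hUS hkerS hv) (S.sum_mem fun j (_ : j ∈ Finset.univ) =>
      S.smul_mem (C₂ v (k j)) (hPS j))
    rwa [sub_add_cancel] at e
  · have e1 := Subspace.finrank_add_finrank_dualCoannihilator_eq ((LinearMap.ker C₁).map C₂)
    have e2 := finrank_map_ker (C₁ := C₁) (C₂ := C₂)
    have e3 := Submodule.finrank_sup_add_finrank_inf_eq U (LinearMap.ker C₁)
    rw [hU.inf_eq, finrank_bot, hU.sup_eq] at e3
    have e4 := hf.finrank_eq
    have e5 : ∑ j, (2 * m j + 1) = ∑ j, (2 * n j + 1) + 2 * Fintype.card ι +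
        Module.finrank ℂ (LinearMap.ker C₁ ⊓ LinearMap.ker C₂ : Submodule ℂ V) := by
      rw [Fintype.sum_sum_type]
      have e6 : ∀ j, 2 * (n j + 1) + 1 = (2 * n j + 1) + 2 := fun j => by ring
      simp only [m, Sum.elim_inl, Sum.elim_inr, e6,
        Finset.sum_add_distrib (f := fun j => 2 * n j + 1)]
      simp [mul_comm]
    omega
  · rintro (j | j) i (j' | j') i' hi hi'
    · change i < n j + 1 at hi
      change i' < n j' + 1 at hi'
      simp only [p', Sum.elim_inl]
      split_ifs with hin hin' hin'
      · rw [hτ₁, hτ₁']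
        exact hf.p_p_left j i j' i' hin hin'
      · rw [hτ₁, h₁, hPp _ _ _ hin, neg_zero]
      · rw [hτ₁', hPp _ _ _ hin']
      · exact hPP₁ j j'
    all_goals simp [p']
  · rintro (j | j) i (j' | j') i' hi hi'
    · change i < n j + 1 at hi
      change i' < n j' + 1 at hi'
      simp only [p', Sum.elim_inl]
      split_ifs with hin hin' hin'
      · rw [hττ]
        exact hf.p_p_right j i j' i' hin hin'
      · rw [h₂, hPτ, neg_zero]
      · exact hPτ j _
      · exact hPP₂ j j'
    all_goals simp [p']
  · rintro (j | j) i (j' | j') i' hi hi'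
    · simp only [q', Sum.elim_inl]
      split_ifs with hin hin' hin'
      · rw [hτ₁, hτ₁']
        exact hf.q_q_left j i j' i' hin hin'
      · exact hk₁' _ _
      all_goals simp [hk₁]
    all_goals simp [q', hz₁, hz₁']
  · rintro (j | j) i (j' | j') i' hi hi'
    · simp only [q', Sum.elim_inl]
      split_ifs with hin hin' hin'
      · rw [hττ]
        exact hf.q_q_right j i j' i' hin hin'
      · exact hτk _ _
      · rw [h₂, hτk, neg_zero]
      · exact hkk j j'
    all_goals simp [q', hz₂, hz₂']
  · rintro (j | j) i (j' | j') i' hi hi'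
    · change i < n j + 1 at hi
      change i' ≤ n j' + 1 at hi'
      simp only [p', q', Sum.elim_inl, Sum.inl.injEq]
      by_cases hin : i < n j
      · rw [if_pos hin]
        by_cases hin' : i' ≤ n j'
        · rw [if_pos hin', hτ₁, hτ₁']
          exact hf.p_q_left j i j' i' hin hin'
        · rw [if_neg hin', hk₁', if_neg]
          rintro ⟨rfl, rfl⟩
          omega
      · obtain rfl : i = n j := by omega
        rw [if_neg hin]
        by_cases hin' : i' ≤ n j'
        · rw [if_pos hin', hτ₁', hPq _ _ _ hin']
        · rw [if_neg hin', hk₁', if_neg]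
          rintro ⟨rfl, rfl⟩
          omega
    · simp [p', q', hz₁']
    · exact absurd hi (Nat.not_lt_zero i)
    · exact absurd hi (Nat.not_lt_zero i)
  · rintro (j | j) i (j' | j') i' hi hi'
    · change i < n j + 1 at hi
      change i' ≤ n j' + 1 at hi'
      simp only [p', q', Sum.elim_inl, Sum.inl.injEq]
      by_cases hin : i < n j
      · rw [if_pos hin]
        by_cases hin' : i' ≤ n j'
        · rw [if_pos hin', hττ]
          exact hf.p_q_right j i j' i' hin hin'
        · rw [if_neg hin', hτk, if_neg]
          rintro ⟨rfl, rfl⟩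
          omega
      · obtain rfl : i = n j := by omega
        rw [if_neg hin]
        by_cases hin' : i' ≤ n j'
        · rw [if_pos hin', hPτ, if_neg]
          rintro ⟨rfl, rfl⟩
          omega
        · obtain rfl : i' = n j' + 1 := by omega
          rw [if_neg hin', hPk]
          refine if_congr ⟨?_, fun h => h.1⟩ rfl rfl
          rintro rfl
          exact ⟨rfl, rfl⟩
    · simp [p', q', hz₂']
    · exact absurd hi (Nat.not_lt_zero i)
    · exact absurd hi (Nat.not_lt_zero i)

end IsReduction_s2

theorem HasConstCorank.exists_isKroneckerFamily {V : Type*} [AddCommGroup V] [Module ℂ V]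
    [FiniteDimensional ℂ V] {C₁ C₂ : V →ₗ[ℂ] Module.Dual ℂ V} {c : ℕ}
    (h : HasConstCorank C₁ C₂ c) (h₁ : ∀ x y, C₁ x y = -C₁ y x)
    (h₂ : ∀ x y, C₂ x y = -C₂ y x) :
    ∃ (ι : Type) (_ : Fintype ι) (_ : DecidableEq ι) (n : ι → ℕ) (p q : ι → ℕ → V),
      Fintype.card ι = c ∧ IsKroneckerFamily C₁ C₂ n p q := by
  induction hd : Module.finrank ℂ V using Nat.strong_induction_on generalizing V c with
  | _ d ih =>
    rcases Nat.eq_zero_or_pos c with rfl | hc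
    · have := h.subsingleton
      refine ⟨Empty, inferInstance, inferInstance, nofun, nofun, nofun, by simp, ?_⟩
      constructor
      · intro S _ _
        exact Subsingleton.elim _ _
      · simp [Module.finrank_zero_of_subsingleton]
      all_goals exact nofun
    · obtain ⟨U, hU⟩ := exists_isReduction_s2 (C₁ := C₁) (C₂ := C₂)
        fun x y hx hy => h.ker_isotropic h₁ hx hy
      have e1 := Submodule.finrank_sup_add_finrank_inf_eq U (LinearMap.ker C₁)
      rw [hU.inf_eq, finrank_bot, h.finrank_ker_left] at e1
      have e2 := Submodule.finrank_le (U ⊔ LinearMap.ker C₁)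
      obtain ⟨ι, _, _, n, p, q, hcard, hf⟩ := ih (Module.finrank ℂ U) (by omega)
        (hU.hasConstCorank h₁ h₂ h) (fun x y => h₁ x y) (fun x y => h₂ x y) rfl
      have e3 := IsReduction_s2.finrank_map_ker (C₁ := C₁) (C₂ := C₂)
      rw [h.finrank_ker_left] at e3
      rw [← h.finrank_ker_left]
      refine hU.exists_isKroneckerFamily h₁ h₂ hf ?_
      rw [h.finrank_ker_left]
      omega

namespace IsKroneckerFamily

variable {V : Type*} [AddCommGroup V] [Module ℂ V] {C₁ C₂ : V →ₗ[ℂ] Module.Dual ℂ V}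
  {ι : Type} [Fintype ι] [DecidableEq ι] {n : ι → ℕ} {p q : ι → ℕ → V}

theorem reindex (h : IsKroneckerFamily C₁ C₂ n p q) {κ : Type} [Fintype κ] [DecidableEq κ]
    (f : κ ≃ ι) : IsKroneckerFamily C₁ C₂ (n ∘ f) (p ∘ f) (q ∘ f) where
  eq_top S hp hq := by
    refine h.eq_top S (fun j i hi => ?_) (fun j i hi => ?_)
    · simpa using hp (f.symm j) i (by simpa using hi)
    · simpa using hq (f.symm j) i (by simpa using hi)
  finrank_eq := by
    rw [h.finrank_eq]
    exact (f.sum_comp fun j => 2 * n j + 1).symm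
  p_p_left j i j' i' := h.p_p_left (f j) i (f j') i'
  p_p_right j i j' i' := h.p_p_right (f j) i (f j') i'
  q_q_left j i j' i' := h.q_q_left (f j) i (f j') i'
  q_q_right j i j' i' := h.q_q_right (f j) i (f j') i'
  p_q_left j i j' i' hi hi' := by
    have e := h.p_q_left (f j) i (f j') i' hi hi'
    simp only [f.apply_eq_iff_eq] at e
    exact e
  p_q_right j i j' i' hi hi' := by
    have e := h.p_q_right (f j) i (f j') i' hi hi'
    simp only [f.apply_eq_iff_eq] at e
    exact e

theorem apply_basis_left (h : IsKroneckerFamily C₁ C₂ n p q) (h₁ : ∀ x y, C₁ x y = -C₁ y x)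
    (s t : Σ j, Fin (n j) ⊕ Fin (n j + 1)) :
    C₁ (h.basis s) (h.basis t) = Matrix.blockDiagonal' (fun j => kronK1 ℂ (n j)) s t := by
  obtain ⟨j, s⟩ := s
  obtain ⟨j', t⟩ := t
  by_cases hj : j = j'
  · subst hj
    rw [Matrix.blockDiagonal'_apply_eq]
    rcases s with s | s <;> rcases t with t | t
    · simpa [basis_inl, kronK1] using h.p_p_left j s j t s.2 t.2
    · simpa [basis_inl, basis_inr, kronK1, kronB1] using
        h.p_q_left j s j t s.2 (Nat.le_of_lt_succ t.2)
    · rw [h₁]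
      simpa [basis_inl, basis_inr, kronK1, kronB1] using
        h.p_q_left j t j s t.2 (Nat.le_of_lt_succ s.2)
    · simpa [basis_inr, kronK1] using
        h.q_q_left j s j t (Nat.le_of_lt_succ s.2) (Nat.le_of_lt_succ t.2)
  · rw [Matrix.blockDiagonal'_apply_ne _ _ _ hj]
    rcases s with s | s <;> rcases t with t | t
    · simpa [basis_inl] using h.p_p_left j s j' t s.2 t.2
    · simpa [basis_inl, basis_inr, hj] using
        h.p_q_left j s j' t s.2 (Nat.le_of_lt_succ t.2)
    · rw [h₁]
      simpa [basis_inl, basis_inr, Ne.symm hj] using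
        h.p_q_left j' t j s t.2 (Nat.le_of_lt_succ s.2)
    · simpa [basis_inr] using
        h.q_q_left j s j' t (Nat.le_of_lt_succ s.2) (Nat.le_of_lt_succ t.2)

theorem apply_basis_right (h : IsKroneckerFamily C₁ C₂ n p q) (h₂ : ∀ x y, C₂ x y = -C₂ y x)
    (s t : Σ j, Fin (n j) ⊕ Fin (n j + 1)) :
    C₂ (h.basis s) (h.basis t) = Matrix.blockDiagonal' (fun j => kronK2 ℂ (n j)) s t := by
  obtain ⟨j, s⟩ := s
  obtain ⟨j', t⟩ := t
  by_cases hj : j = j'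
  · subst hj
    rw [Matrix.blockDiagonal'_apply_eq]
    rcases s with s | s <;> rcases t with t | t
    · simpa [basis_inl, kronK2] using h.p_p_right j s j t s.2 t.2
    · simpa [basis_inl, basis_inr, kronK2, kronB2] using
        h.p_q_right j s j t s.2 (Nat.le_of_lt_succ t.2)
    · rw [h₂]
      simpa [basis_inl, basis_inr, kronK2, kronB2] using
        h.p_q_right j t j s t.2 (Nat.le_of_lt_succ s.2)
    · simpa [basis_inr, kronK2] using
        h.q_q_right j s j t (Nat.le_of_lt_succ s.2) (Nat.le_of_lt_succ t.2)
  · rw [Matrix.blockDiagonal'_apply_ne _ _ _ hj]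
    rcases s with s | s <;> rcases t with t | t
    · simpa [basis_inl] using h.p_p_right j s j' t s.2 t.2
    · simpa [basis_inl, basis_inr, hj] using
        h.p_q_right j s j' t s.2 (Nat.le_of_lt_succ t.2)
    · rw [h₂]
      simpa [basis_inl, basis_inr, Ne.symm hj] using
        h.p_q_right j' t j s t.2 (Nat.le_of_lt_succ s.2)
    · simpa [basis_inr] using
        h.q_q_right j s j' t (Nat.le_of_lt_succ s.2) (Nat.le_of_lt_succ t.2)

end IsKroneckerFamily

/-- The bilinear form of a square matrix, as a map to the dual space. -/
def matrixForm {N : ℕ} (M : Matrix (Fin N) (Fin N) ℂ) :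
    (Fin N → ℂ) →ₗ[ℂ] Module.Dual ℂ (Fin N → ℂ) :=
  Matrix.toBilin' M

theorem matrixForm_apply {N : ℕ} (M : Matrix (Fin N) (Fin N) ℂ) (x y : Fin N → ℂ) :
    matrixForm M x y = x ⬝ᵥ M *ᵥ y :=
  Matrix.toBilin'_apply' M x y

theorem matrixForm_smul_add_smul {N : ℕ} (A B : Matrix (Fin N) (Fin N) ℂ) (a b : ℂ) :
    a • matrixForm A + b • matrixForm B = matrixForm (a • A + b • B) := by
  ext x y
  simp [matrixForm_apply]

theorem matrixForm_skew {N : ℕ} {M : Matrix (Fin N) (Fin N) ℂ} (hM : Mᵀ = -M)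
    (x y : Fin N → ℂ) : matrixForm M x y = -matrixForm M y x := by
  rw [matrixForm_apply, matrixForm_apply, ← dotProduct_neg, ← Matrix.neg_mulVec, ← hM,
    Matrix.mulVec_transpose, Matrix.dotProduct_mulVec, dotProduct_comm]

theorem finrank_ker_matrixForm {N : ℕ} (M : Matrix (Fin N) (Fin N) ℂ) :
    Module.finrank ℂ (LinearMap.ker (matrixForm M)) + M.rank = N := by
  have hker : LinearMap.ker (matrixForm M) = LinearMap.ker Mᵀ.mulVecLin := by
    ext x
    rw [LinearMap.mem_ker, LinearMap.mem_ker, Matrix.mulVecLin_apply, Matrix.mulVec_transpose]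
    constructor
    · intro h
      refine dotProduct_eq_zero_iff.mp fun y => ?_
      rw [← Matrix.dotProduct_mulVec, ← matrixForm_apply, h]
      rfl
    · intro h
      refine LinearMap.ext fun y => ?_
      rw [matrixForm_apply, Matrix.dotProduct_mulVec, h, zero_dotProduct]
      rfl
  have e := LinearMap.finrank_range_add_finrank_ker Mᵀ.mulVecLin
  rw [Module.finrank_fin_fun] at e
  rw [hker, ← Matrix.rank_transpose M, Matrix.rank, add_comm, e]

theorem finrank_ker_blockDiagonal' {K ι : Type*} [Field K] [Fintype ι] [DecidableEq ι]
    {m : ι → Type*} [∀ j, Fintype (m j)] (M : ∀ j, Matrix (m j) (m j) K) :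
    Module.finrank K (LinearMap.ker (Matrix.blockDiagonal' M).mulVecLin) =
      ∑ j, Module.finrank K (LinearMap.ker (M j).mulVecLin) := by
  have happly : ∀ (v : (Σ j, m j) → K) (j : ι) (x : m j),
      (Matrix.blockDiagonal' M *ᵥ v) ⟨j, x⟩ = (M j *ᵥ fun y => v ⟨j, y⟩) x := by
    intro v j x
    simp only [Matrix.mulVec, dotProduct, Fintype.sum_sigma]
    rw [Finset.sum_eq_single j]
    · simp [Matrix.blockDiagonal'_apply_eq]
    · intro j' _ hj'
      simp [Matrix.blockDiagonal'_apply_ne _ _ _ (Ne.symm hj')]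
    · simp
  rw [← Module.finrank_pi_fintype K]
  let f : LinearMap.ker (Matrix.blockDiagonal' M).mulVecLin ≃ₗ[K]
      ∀ j, LinearMap.ker (M j).mulVecLin :=
    { toFun := fun v j => ⟨fun y => v.1 ⟨j, y⟩, by
        have hv : Matrix.blockDiagonal' M *ᵥ v.1 = 0 := v.2
        change M j *ᵥ _ = 0
        funext x
        rw [← happly, hv]
        rfl⟩
      invFun := fun w => ⟨fun s => (w s.1).1 s.2, by
        change Matrix.blockDiagonal' M *ᵥ _ = 0
        funext s
        have hw : M s.1 *ᵥ (w s.1).1 = 0 := (w s.1).2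
        rw [happly, hw]
        rfl⟩
      map_add' := fun _ _ => rfl
      map_smul' := fun _ _ => rfl
      left_inv := fun _ => rfl
      right_inv := fun _ => rfl }
  exact f.finrank_eq

theorem linearIndependent_row_smul_kronB1_add_smul_kronB2 (n : ℕ) {a b : ℂ}
    (hab : a ≠ 0 ∨ b ≠ 0) : LinearIndependent ℂ (a • kronB1 ℂ n + b • kronB2 ℂ n).row := by
  rw [← Matrix.vecMul_injective_iff, ← Matrix.coe_vecMulLinear, ← LinearMap.ker_eq_bot,
    LinearMap.ker_eq_bot']
  intro x hx
  have hx' : ∀ j : Fin (n + 1), (∑ i : Fin n, x i *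
      (a * (if (j : ℕ) = i then 1 else 0) + b * (if (j : ℕ) = i + 1 then 1 else 0))) = 0 :=
    fun j => congrFun hx j
  by_cases ha : a = 0
  · have hb : b ≠ 0 := hab.resolve_left (not_not.mpr ha)
    funext i
    have e := hx' i.succ
    rw [Finset.sum_eq_single i] at e
    · simpa [ha, hb] using e
    · intro i' _ hi'
      have : (i : ℕ) ≠ i' := fun h => hi' (Fin.ext h.symm)
      simp [ha, this]
    · simp
  · have hzero : ∀ (m : ℕ) (hm : m < n), x ⟨m, hm⟩ = 0 := by
      intro m
      induction m using Nat.strong_induction_on with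
      | _ m ih =>
        intro hm
        have e := hx' ⟨m, by omega⟩
        rw [Finset.sum_eq_single ⟨m, hm⟩] at e
        · simpa [ha] using e
        · intro i' _ hi'
          have hne : m ≠ i' := fun h => hi' (Fin.ext h.symm)
          by_cases hm' : m = i' + 1
          · rw [show x i' = 0 from ih i' (by omega) i'.2, zero_mul]
          · simp [hne, hm']
        · simp
    funext i
    exact hzero i i.2

theorem finrank_ker_smul_kronK1_add_smul_kronK2 (n : ℕ) {a b : ℂ} (hab : a ≠ 0 ∨ b ≠ 0) :
    Module.finrank ℂ (LinearMap.ker (a • kronK1 ℂ n + b • kronK2 ℂ n).mulVecLin) = 1 := by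
  have hli := linearIndependent_row_smul_kronB1_add_smul_kronB2 n hab
  have hblocks : a • kronK1 ℂ n + b • kronK2 ℂ n =
      Matrix.fromBlocks 0 (a • kronB1 ℂ n + b • kronB2 ℂ n)
        (-(a • kronB1 ℂ n + b • kronB2 ℂ n)ᵀ) 0 := by
    ext (i | i) (j | j) <;> simp [kronK1, kronK2, add_comm]
  generalize a • kronB1 ℂ n + b • kronB2 ℂ n = B at hli hblocks
  have hrank : B.rank = n := by simpa using hli.rank_matrix
  have hinj : ∀ v : Fin n → ℂ, Bᵀ *ᵥ v = 0 → v = 0 := by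
    intro v hv
    rw [Matrix.mulVec_transpose] at hv
    exact Matrix.vecMul_injective_iff.mpr hli (by simpa using hv)
  have hmul : ∀ v : Fin n ⊕ Fin (n + 1) → ℂ, (Matrix.fromBlocks 0 B (-Bᵀ) 0) *ᵥ v =
      Sum.elim (B *ᵥ (v ∘ Sum.inr)) (-(Bᵀ *ᵥ (v ∘ Sum.inl))) := by
    intro v
    rw [Matrix.fromBlocks_mulVec]
    simp [Matrix.neg_mulVec]
  let f : LinearMap.ker B.mulVecLin ≃ₗ[ℂ]
      LinearMap.ker (Matrix.fromBlocks 0 B (-Bᵀ) 0).mulVecLin :=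
    { toFun := fun v => ⟨Sum.elim 0 v.1, by
        have hv : B *ᵥ v.1 = 0 := v.2
        rw [LinearMap.mem_ker, Matrix.mulVecLin_apply, hmul]
        simp [hv]⟩
      invFun := fun w => ⟨w.1 ∘ Sum.inr, by
        have hw : Matrix.fromBlocks 0 B (-Bᵀ) 0 *ᵥ w.1 = 0 := w.2
        rw [hmul] at hw
        exact congrArg (· ∘ Sum.inl) hw⟩
      map_add' := fun v w => by ext (i | i) <;> simp
      map_smul' := fun c v => by ext (i | i) <;> simp
      left_inv := fun _ => rfl
      right_inv := fun w => by
        have hw : Matrix.fromBlocks 0 B (-Bᵀ) 0 *ᵥ w.1 = 0 := w.2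
        rw [hmul] at hw
        have hl := hinj (w.1 ∘ Sum.inl) (neg_eq_zero.mp (congrArg (· ∘ Sum.inr) hw))
        ext (i | i)
        · exact (congrFun hl i).symm
        · rfl }
  have e := LinearMap.finrank_range_add_finrank_ker B.mulVecLin
  rw [Module.finrank_fin_fun, ← Matrix.rank, hrank] at e
  rw [hblocks, ← f.finrank_eq]
  omega

/-- completeness is equivalent to a purely Kronecker decomposition: for complex
skew-symmetric `C1, C2`, the rank of `λ1·C1 + λ2·C2` is constant on `ℂ² \ {0}` if and only if
the pair is simultaneously congruent to a block-diagonal sum of Kronecker block pairs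
`K_i(n_1), …, K_i(n_k)` (i.e. its decomposition contains no Jordan blocks). -/
theorem complete_iff_kronecker (N : ℕ) (C₁ C₂ : Matrix (Fin N) (Fin N) ℂ)
    (h₁ : C₁ᵀ = -C₁) (h₂ : C₂ᵀ = -C₂) :
    (∀ l l' : ℂ × ℂ, l ≠ 0 → l' ≠ 0 →
        (l.1 • C₁ + l.2 • C₂).rank = (l'.1 • C₁ + l'.2 • C₂).rank) ↔
    ∃ (k : ℕ) (n : Fin k → ℕ)
      (e : Fin N ≃ (Σ j : Fin k, Fin (n j) ⊕ Fin (n j + 1)))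
      (P : Matrix (Fin N) (Fin N) ℂ), IsUnit P ∧
      N = ∑ j : Fin k, (2 * n j + 1) ∧
      Pᵀ * C₁ * P =
        Matrix.reindex e.symm e.symm (Matrix.blockDiagonal' fun j => kronK1 ℂ (n j)) ∧
      Pᵀ * C₂ * P =
        Matrix.reindex e.symm e.symm (Matrix.blockDiagonal' fun j => kronK2 ℂ (n j)) := by
  constructor
  · intro h
    have hC : HasConstCorank (matrixForm C₁) (matrixForm C₂) (N - C₁.rank) := by
      intro a b hab
      have e := h (a, b) (1, 0) (by rwa [Ne, Prod.ext_iff, not_and_or]) (by simp)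
      simp only [one_smul, zero_smul, add_zero] at e
      rw [matrixForm_smul_add_smul]
      have e2 := finrank_ker_matrixForm (a • C₁ + b • C₂)
      omega
    obtain ⟨ι, _, _, n, p, q, -, hf⟩ :=
      hC.exists_isKroneckerFamily (matrixForm_skew h₁) (matrixForm_skew h₂)
    have hf' := hf.reindex (Fintype.equivFin ι).symm
    let e := (Pi.basisFun ℂ (Fin N)).indexEquiv hf'.basis
    have hentry : ∀ (C : Matrix (Fin N) (Fin N) ℂ) (x y : Fin N),
        ((Matrix.of fun i j => hf'.basis (e j) i)ᵀ * C * Matrix.of fun i j => hf'.basis (e j) i)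
          x y = matrixForm C (hf'.basis (e x)) (hf'.basis (e y)) := by
      intro C x y
      rw [matrixForm_apply, Matrix.dotProduct_mulVec]
      rfl
    refine ⟨_, _, e, Matrix.of fun i j => hf'.basis (e j) i, ?_, ?_, ?_, ?_⟩
    · rw [← Matrix.linearIndependent_cols_iff_isUnit]
      exact hf'.basis.linearIndependent.comp e e.injective
    · have e2 := hf'.finrank_eq
      rwa [Module.finrank_fin_fun] at e2
    · ext x y
      rw [hentry, hf'.apply_basis_left (matrixForm_skew h₁)]
      rfl
    · ext x y
      rw [hentry, hf'.apply_basis_right (matrixForm_skew h₂)]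
      rfl
  · rintro ⟨k, n, e, P, hP, hN, hP₁, hP₂⟩
    have hdet : IsUnit P.det := (Matrix.isUnit_iff_isUnit_det P).mp hP
    have hrank : ∀ l : ℂ × ℂ, l ≠ 0 → (l.1 • C₁ + l.2 • C₂).rank + k = N := by
      intro l hl
      have hl' : l.1 ≠ 0 ∨ l.2 ≠ 0 := by
        by_contra! hl'
        exact hl (Prod.ext hl'.1 hl'.2)
      have hconj : Pᵀ * (l.1 • C₁ + l.2 • C₂) * P = Matrix.reindex e.symm e.symm
          (Matrix.blockDiagonal' fun j => l.1 • kronK1 ℂ (n j) + l.2 • kronK2 ℂ (n j)) := by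
        have hsum : (Matrix.blockDiagonal' fun j => l.1 • kronK1 ℂ (n j) + l.2 • kronK2 ℂ (n j)) =
            l.1 • (Matrix.blockDiagonal' fun j => kronK1 ℂ (n j)) +
              l.2 • Matrix.blockDiagonal' fun j => kronK2 ℂ (n j) := by
          rw [← Matrix.blockDiagonal'_smul, ← Matrix.blockDiagonal'_smul,
            ← Matrix.blockDiagonal'_add]
          rfl
        rw [hsum, Matrix.mul_add, Matrix.add_mul, Matrix.mul_smul, Matrix.mul_smul,
          Matrix.smul_mul, Matrix.smul_mul, hP₁, hP₂]
        rfl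
      have hrk := congrArg Matrix.rank hconj
      rw [Matrix.rank_mul_eq_left_of_isUnit_det _ _ hdet,
        Matrix.rank_mul_eq_right_of_isUnit_det _ _ (by rwa [Matrix.det_transpose]),
        Matrix.rank_reindex] at hrk
      have hker := finrank_ker_blockDiagonal' fun j =>
        l.1 • kronK1 ℂ (n j) + l.2 • kronK2 ℂ (n j)
      simp only [finrank_ker_smul_kronK1_add_smul_kronK2 _ hl', Finset.sum_const,
        Finset.card_univ, Fintype.card_fin, smul_eq_mul, mul_one] at hker
      have hrn := LinearMap.finrank_range_add_finrank_ker (Matrix.blockDiagonal' fun j =>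
        l.1 • kronK1 ℂ (n j) + l.2 • kronK2 ℂ (n j)).mulVecLin
      rw [hker, Module.finrank_fintype_fun_eq_card, ← Fintype.card_congr e, Fintype.card_fin] at hrn
      rw [hrk]
      exact hrn
    intro l l' hl hl'
    have e1 := hrank l hl
    have e2 := hrank l' hl'
    omega

end
end

section
/- The kernel of a Kronecker block sweeps a Veronese curve: For every integer n ≥ 0 and every (λ1,λ2) ∈ ℝ² \ {(0,0)}, the kernel of the real matrix λ1·K1(n) + λ2·K2(n) is one-dimensional, and it is spanned by the vector of ℝ^{2n+1} whose first n coordinates are 0 and whose last n+1 coordinates are the coordinates of w_n(λ1,λ2). -/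
open Matrix

noncomputable section

/-- The Veronese vector `w_n(λ1,λ2)` with coordinates `(−λ1)^{i} · λ2^{n−i}`, `i = 0,…,n`. -/
def veroneseVec (n : ℕ) (l : ℝ × ℝ) : Fin (n + 1) → ℝ :=
  fun i => (-l.1) ^ (i : ℕ) * l.2 ^ (n - (i : ℕ))

theorem kronB1_mulVec {K : Type*} [NonAssocSemiring K] {n : ℕ} (q : Fin (n + 1) → K) (i : Fin n) :
    (kronB1 K n *ᵥ q) i = q i.castSucc := by
  rw [mulVec, dotProduct, Finset.sum_eq_single i.castSucc]
  · simp [kronB1]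
  · intro j _ hj
    have : (j : ℕ) ≠ i := fun h => hj (Fin.ext h)
    simp [kronB1, this]
  · simp

theorem kronB2_mulVec {K : Type*} [NonAssocSemiring K] {n : ℕ} (q : Fin (n + 1) → K) (i : Fin n) :
    (kronB2 K n *ᵥ q) i = q i.succ := by
  rw [mulVec, dotProduct, Finset.sum_eq_single i.succ]
  · simp [kronB2]
  · intro j _ hj
    have : (j : ℕ) ≠ i + 1 := fun h => hj (Fin.ext h)
    simp [kronB2, this]
  · simp

theorem kronB1_transpose_mulVec_castSucc {K : Type*} [NonAssocSemiring K] {n : ℕ} (p : Fin n → K)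
    (i : Fin n) : ((kronB1 K n)ᵀ *ᵥ p) i.castSucc = p i := by
  rw [mulVec, dotProduct, Finset.sum_eq_single i]
  · simp [kronB1]
  · intro j _ hj
    have : (i : ℕ) ≠ j := fun h => hj (Fin.ext h.symm)
    simp [kronB1, this]
  · simp

theorem kronB2_transpose_mulVec_succ {K : Type*} [NonAssocSemiring K] {n : ℕ} (p : Fin n → K)
    (i : Fin n) : ((kronB2 K n)ᵀ *ᵥ p) i.succ = p i := by
  rw [mulVec, dotProduct, Finset.sum_eq_single i]
  · simp [kronB2]
  · intro j _ hj
    have : (i : ℕ) ≠ j := fun h => hj (Fin.ext h.symm)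
    simp [kronB2, this]
  · simp

theorem kronB2_transpose_mulVec_castSucc_eq_zero {K : Type*} [NonAssocSemiring K] {n : ℕ}
    {p : Fin n → K} {i : Fin n} (h : ∀ j < i, p j = 0) :
    ((kronB2 K n)ᵀ *ᵥ p) i.castSucc = 0 := by
  rw [mulVec, dotProduct]
  refine Finset.sum_eq_zero fun j _ => ?_
  by_cases hj : (i : ℕ) = j + 1
  · rw [h j (Fin.lt_def.2 (by omega)), mul_zero]
  · simp [kronB2, hj]

/-- The transposed pencil `a • B1ᵀ + b • B2ᵀ` is injective unless `a = b = 0`. -/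
theorem eq_zero_of_kronB_transpose_pencil {K : Type*} [Semiring K] [NoZeroDivisors K] {n : ℕ}
    {a b : K} (hab : a ≠ 0 ∨ b ≠ 0) {p : Fin n → K}
    (h : a • ((kronB1 K n)ᵀ *ᵥ p) + b • ((kronB2 K n)ᵀ *ᵥ p) = 0) : p = 0 := by
  funext i
  by_cases ha : a = 0
  · have hi := congrFun h i.succ
    simpa [ha, hab.resolve_left (not_not.2 ha), kronB2_transpose_mulVec_succ] using hi
  · induction i using WellFoundedLT.induction with
    | ind i ih =>
      have hi := congrFun h i.castSucc
      simpa [ha, kronB1_transpose_mulVec_castSucc,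
        kronB2_transpose_mulVec_castSucc_eq_zero ih] using hi

theorem kronK_pencil_mulVec_eq_zero_iff {K : Type*} [CommRing K] [NoZeroDivisors K] {n : ℕ}
    {a b : K} (hab : a ≠ 0 ∨ b ≠ 0) (p : Fin n → K) (q : Fin (n + 1) → K) :
    (a • kronK1 K n + b • kronK2 K n) *ᵥ Sum.elim p q = 0 ↔
      p = 0 ∧ ∀ i : Fin n, a * q i.castSucc + b * q i.succ = 0 := by
  have key : (a • kronK1 K n + b • kronK2 K n) *ᵥ Sum.elim p q =
      Sum.elim (a • (kronB1 K n *ᵥ q) + b • (kronB2 K n *ᵥ q))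
        (-(a • ((kronB1 K n)ᵀ *ᵥ p) + b • ((kronB2 K n)ᵀ *ᵥ p))) := by
    simp only [kronK1, kronK2, add_mulVec, smul_mulVec, fromBlocks_mulVec]
    funext i
    rcases i with i | i <;> simp [neg_mulVec, add_comm]
  rw [key]
  constructor
  · intro h
    refine ⟨eq_zero_of_kronB_transpose_pencil hab ?_, fun i => ?_⟩
    · funext j
      simpa only [Sum.elim_inr, Pi.neg_apply, Pi.zero_apply, neg_eq_zero] using
        congrFun h (Sum.inr j)
    · simpa [kronB1_mulVec, kronB2_mulVec] using congrFun h (Sum.inl i)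
  · rintro ⟨rfl, h⟩
    funext i
    rcases i with i | i
    · simpa [kronB1_mulVec, kronB2_mulVec] using h i
    · simp

theorem veroneseVec_recurrence {n : ℕ} (l : ℝ × ℝ) (i : Fin n) :
    l.1 * veroneseVec n l i.castSucc + l.2 * veroneseVec n l i.succ = 0 := by
  have hi : n - (i : ℕ) = n - (i + 1) + 1 := by omega
  simp only [veroneseVec, Fin.val_castSucc, Fin.val_succ, hi, pow_succ]
  ring

theorem veroneseVec_ne_zero (n : ℕ) {l : ℝ × ℝ} (hl : l ≠ 0) : veroneseVec n l ≠ 0 := by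
  intro h
  by_cases h2 : l.2 = 0
  · have h1 : l.1 ≠ 0 := fun h1 => hl (Prod.ext h1 h2)
    have := congrFun h (Fin.last n)
    simp [veroneseVec, h1] at this
  · have := congrFun h 0
    simp [veroneseVec, h2] at this

/-- Every solution of the recurrence `λ1 q_i + λ2 q_{i+1} = 0` is a multiple of the Veronese
vector. -/
theorem exists_smul_veroneseVec_eq {n : ℕ} {l : ℝ × ℝ} (hl : l ≠ 0) {q : Fin (n + 1) → ℝ}
    (h : ∀ i : Fin n, l.1 * q i.castSucc + l.2 * q i.succ = 0) :
    ∃ c : ℝ, c • veroneseVec n l = q := by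
  by_cases h2 : l.2 = 0
  · have h1 : l.1 ≠ 0 := fun h1 => hl (Prod.ext h1 h2)
    refine ⟨q (Fin.last n) / (-l.1) ^ n, funext fun i => ?_⟩
    induction i using Fin.lastCases with
    | last => simp [veroneseVec, h1]
    | cast i =>
      have hi : n - (i : ℕ) ≠ 0 := by omega
      have hq : q i.castSucc = 0 := by simpa [h1, h2] using h i
      simp [veroneseVec, h2, hi, hq]
  · refine ⟨q 0 / l.2 ^ n, funext fun i => ?_⟩
    induction i using Fin.induction with
    | zero => simp [veroneseVec, h2]
    | succ i ih =>
      apply mul_left_cancel₀ h2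
      have hw := veroneseVec_recurrence l i
      simp only [Pi.smul_apply, smul_eq_mul] at ih ⊢
      linear_combination q 0 / l.2 ^ n * hw - h i - l.1 * ih

/-- the kernel of `λ1·K1(n) + λ2·K2(n)` is one-dimensional and spanned by the
vector whose p-coordinates vanish and whose q-coordinates form `w_n(λ)`. -/
theorem kronecker_pencil_kernel (n : ℕ) (l : ℝ × ℝ) (hl : l ≠ 0) :
    LinearMap.ker (l.1 • kronK1 ℝ n + l.2 • kronK2 ℝ n).mulVecLin =
      Submodule.span ℝ {Sum.elim (0 : Fin n → ℝ) (veroneseVec n l)} ∧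
    Module.finrank ℝ
      (LinearMap.ker (l.1 • kronK1 ℝ n + l.2 • kronK2 ℝ n).mulVecLin) = 1 := by
  have hab : l.1 ≠ 0 ∨ l.2 ≠ 0 := by
    by_contra! h
    exact hl (Prod.ext h.1 h.2)
  have hker : LinearMap.ker (l.1 • kronK1 ℝ n + l.2 • kronK2 ℝ n).mulVecLin =
      Submodule.span ℝ {Sum.elim (0 : Fin n → ℝ) (veroneseVec n l)} := by
    ext x
    obtain ⟨p, q, rfl⟩ : ∃ p q, x = Sum.elim p q :=
      ⟨x ∘ Sum.inl, x ∘ Sum.inr, (Sum.elim_comp_inl_inr x).symm⟩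
    rw [LinearMap.mem_ker, mulVecLin_apply, kronK_pencil_mulVec_eq_zero_iff hab,
      Submodule.mem_span_singleton]
    constructor
    · rintro ⟨rfl, hq⟩
      obtain ⟨c, rfl⟩ := exists_smul_veroneseVec_eq hl hq
      exact ⟨c, by ext (i | i) <;> simp⟩
    · rintro ⟨c, hc⟩
      obtain rfl : 0 = p := funext fun i => by simpa using congrFun hc (Sum.inl i)
      obtain rfl : c • veroneseVec n l = q := funext fun i => by
        simpa using congrFun hc (Sum.inr i)
      refine ⟨rfl, fun i => ?_⟩
      simp only [Pi.smul_apply, smul_eq_mul]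
      linear_combination c * veroneseVec_recurrence l i
  refine ⟨hker, ?_⟩
  rw [hker]
  refine finrank_span_singleton fun h => veroneseVec_ne_zero n hl (funext fun i => ?_)
  simpa using congrFun h (Sum.inr i)

end
end

section
/- The bilagrangian subspace of a single Kronecker block: Let n ≥ 0. The intersection, over all (λ1,λ2) ∈ ℝ² \ {(0,0)}, of the column spaces of the real matrices λ1·K1(n) + λ2·K2(n) equals the span of the first n standard basis vectors of ℝ^{2n+1} (the p-coordinate subspace). Moreover, the same intersection is already attained over any n+1 pairwise non-proportional parameters (λ1,λ2). -/
open Matrix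

noncomputable section

/-- The span of the first `n` standard basis vectors ("p-coordinates") of `ℝ^{2n+1}`. -/
def pSpan (n : ℕ) : Submodule ℝ ((Fin n ⊕ Fin (n + 1)) → ℝ) :=
  Submodule.span ℝ (Set.range fun i : Fin n => Pi.single (Sum.inl i : Fin n ⊕ Fin (n + 1)) (1 : ℝ))

/-- A vector lies in `pSpan n` exactly when all its `q`-coordinates vanish. -/
theorem mem_pSpan_iff {n : ℕ} {x : Fin n ⊕ Fin (n + 1) → ℝ} :
    x ∈ pSpan n ↔ ∀ j, x (Sum.inr j) = 0 := by
  constructor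
  · intro hx j
    have hle : pSpan n ≤ LinearMap.ker (LinearMap.proj (R := ℝ)
        (φ := fun _ : Fin n ⊕ Fin (n + 1) => ℝ) (Sum.inr j)) := by
      refine Submodule.span_le.2 ?_
      rintro _ ⟨i, rfl⟩
      simp
    simpa using hle hx
  · intro hx
    have hsum : x = ∑ i : Fin n,
        x (Sum.inl i) • (Pi.single (Sum.inl i) 1 : Fin n ⊕ Fin (n + 1) → ℝ) := by
      ext (i | j)
      · simp [Finset.sum_apply, Pi.single_apply]
      · simp [Finset.sum_apply, hx]
    rw [hsum]
    exact Submodule.sum_mem _ fun i _ =>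
      Submodule.smul_mem _ _ (Submodule.subset_span ⟨i, rfl⟩)

/-- The rows of the pencil `a B1(n) + b B2(n)`. -/
theorem kronB_pencil_mulVec {n : ℕ} (a b : ℝ) (v : Fin (n + 1) → ℝ) (i : Fin n) :
    ((a • kronB1 ℝ n + b • kronB2 ℝ n) *ᵥ v) i = a * v i.castSucc + b * v i.succ := by
  have h1 (j : Fin (n + 1)) : (j : ℕ) = (i : ℕ) ↔ j = i.castSucc := by simp [Fin.ext_iff]
  have h2 (j : Fin (n + 1)) : (j : ℕ) = (i : ℕ) + 1 ↔ j = i.succ := by simp [Fin.ext_iff]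
  simp [mulVec, dotProduct, kronB1, kronB2, h1, h2, add_mul, Finset.sum_add_distrib]

theorem kronK_pencil_eq_fromBlocks (n : ℕ) (a b : ℝ) :
    a • kronK1 ℝ n + b • kronK2 ℝ n =
      fromBlocks 0 (a • kronB1 ℝ n + b • kronB2 ℝ n)
        (-(a • kronB1 ℝ n + b • kronB2 ℝ n)ᵀ) 0 := by
  simp [kronK1, kronK2, fromBlocks_smul, fromBlocks_add, add_comm]

/-- A nonzero member of the pencil `a B1(n) + b B2(n)` is surjective. -/
theorem kronB_pencil_surjective {n : ℕ} {a b : ℝ} (h : (a, b) ≠ 0) (y : Fin n → ℝ) :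
    ∃ v, (a • kronB1 ℝ n + b • kronB2 ℝ n) *ᵥ v = y := by
  by_cases hb : b = 0
  · have ha : a ≠ 0 := by
      rintro rfl
      exact h (by simp [hb])
    refine ⟨Fin.snoc (fun i => y i / a) 0, ?_⟩
    ext i
    rw [kronB_pencil_mulVec, Fin.snoc_castSucc, hb]
    field_simp
    simp
  · let v : Fin (n + 1) → ℝ := Fin.induction 0 fun i r => (y i - a * r) / b
    refine ⟨v, ?_⟩
    ext i
    have hv : v i.succ = (y i - a * v i.castSucc) / b := Fin.induction_succ _ _ i
    rw [kronB_pencil_mulVec, hv]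
    field_simp
    ring

theorem pSpan_le_range_kronK_pencil {n : ℕ} {a b : ℝ} (h : (a, b) ≠ 0) :
    pSpan n ≤ LinearMap.range (a • kronK1 ℝ n + b • kronK2 ℝ n).mulVecLin := by
  intro x hx
  rw [mem_pSpan_iff] at hx
  obtain ⟨v, hv⟩ := kronB_pencil_surjective h (x ∘ Sum.inl)
  refine ⟨Sum.elim 0 v, ?_⟩
  rw [mulVecLin_apply, kronK_pencil_eq_fromBlocks, fromBlocks_mulVec]
  ext (i | j)
  · simpa using congrFun hv i
  · simp [hx]

/-- The column space of a member of the Kronecker pencil is annihilated by the kernel vector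
with `q`-coordinates `(-a)^j b^(n-j)`. -/
theorem sum_mul_eq_zero_of_mem_range_kronK_pencil {n : ℕ} {a b : ℝ}
    {x : Fin n ⊕ Fin (n + 1) → ℝ}
    (hx : x ∈ LinearMap.range (a • kronK1 ℝ n + b • kronK2 ℝ n).mulVecLin) :
    ∑ j : Fin (n + 1), (-a) ^ (j : ℕ) * b ^ (j.rev : ℕ) * x (Sum.inr j) = 0 := by
  obtain ⟨w, rfl⟩ := hx
  have hker : (a • kronB1 ℝ n + b • kronB2 ℝ n) *ᵥ
      (fun j : Fin (n + 1) => (-a) ^ (j : ℕ) * b ^ (j.rev : ℕ)) = 0 := by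
    ext i
    have hi : n - (i : ℕ) = n - ((i : ℕ) + 1) + 1 := by omega
    simp only [kronB_pencil_mulVec, Fin.val_rev, Fin.val_castSucc, Fin.val_succ, Pi.zero_apply,
      Nat.add_sub_add_right, hi]
    ring
  rw [mulVecLin_apply, kronK_pencil_eq_fromBlocks, fromBlocks_mulVec]
  simp only [Sum.elim_inr, zero_mulVec, add_zero]
  change (fun j : Fin (n + 1) => (-a) ^ (j : ℕ) * b ^ (j.rev : ℕ)) ⬝ᵥ _ = 0
  rw [neg_mulVec, dotProduct_neg, dotProduct_mulVec, vecMul_transpose, hker, zero_dotProduct,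
    neg_zero]

theorem iInf_range_kronK_pencil_le_pSpan {n : ℕ} (l : Fin (n + 1) → ℝ × ℝ)
    (hl : ∀ s t, s ≠ t → (l s).1 * (l t).2 - (l s).2 * (l t).1 ≠ 0) :
    (⨅ s : Fin (n + 1),
      LinearMap.range ((l s).1 • kronK1 ℝ n + (l s).2 • kronK2 ℝ n).mulVecLin) ≤ pSpan n := by
  intro x hx
  rw [Submodule.mem_iInf] at hx
  have hdet : (projVandermonde (fun s => -(l s).1) fun s => (l s).2).det ≠ 0 := by
    rw [det_projVandermonde]
    refine Finset.prod_ne_zero_iff.2 fun s _ => Finset.prod_ne_zero_iff.2 fun t ht => ?_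
    have hst := hl s t (Finset.mem_Ioi.1 ht).ne
    contrapose! hst
    linarith
  have hzero : (projVandermonde (fun s => -(l s).1) fun s => (l s).2) *ᵥ
      (fun j => x (Sum.inr j)) = 0 := by
    ext s
    simpa [mulVec, dotProduct, projVandermonde_apply] using
      sum_mul_eq_zero_of_mem_range_kronK_pencil (hx s)
  exact mem_pSpan_iff.2 fun j => congrFun (eq_zero_of_mulVec_eq_zero hdet hzero) j

/-- the intersection over all nonzero `λ ∈ ℝ²` of the column spaces of
`λ1·K1(n) + λ2·K2(n)` is the p-coordinate subspace, and it is already attained over any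
`n+1` pairwise non-proportional parameters. -/
theorem kronecker_bilagrangian (n : ℕ) :
    (⨅ (l : ℝ × ℝ) (_ : l ≠ 0),
        LinearMap.range (l.1 • kronK1 ℝ n + l.2 • kronK2 ℝ n).mulVecLin) = pSpan n ∧
    ∀ l : Fin (n + 1) → ℝ × ℝ, (∀ s, l s ≠ 0) →
      (∀ s t, s ≠ t → (l s).1 * (l t).2 - (l s).2 * (l t).1 ≠ 0) →
      (⨅ s : Fin (n + 1),
        LinearMap.range ((l s).1 • kronK1 ℝ n + (l s).2 • kronK2 ℝ n).mulVecLin) = pSpan n := by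
  refine ⟨le_antisymm ?_ ?_, fun l hl0 hl => le_antisymm ?_ ?_⟩
  · refine le_trans (le_iInf fun s : Fin (n + 1) => ?_)
      (iInf_range_kronK_pencil_le_pSpan (fun s : Fin (n + 1) => ((1 : ℝ), (s : ℝ))) ?_)
    · exact iInf₂_le ((1 : ℝ), ((s : ℕ) : ℝ)) (by simp)
    · intro s t hst
      simpa [sub_eq_zero, Fin.ext_iff, eq_comm] using hst
  · exact le_iInf₂ fun l hl => pSpan_le_range_kronK_pencil hl
  · exact iInf_range_kronK_pencil_le_pSpan l hl
  · exact le_iInf fun s => pSpan_le_range_kronK_pencil (hl0 s)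

end
end
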